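/- arXiv:2104.04850 — 2 statements merged into one kernel-verified Lean document; each statement's English description precedes it below -/
import Mathlib

section
/- For every positive integer n and every real t ≥ 0, the number X_n of triangles in the Erdős–Rényi random graph G(n,1/2) satisfies log Pr(X_n ≤ t) ≤ −Φ_n(t + n^{23/8}) + 2·n^{15/8}. -/
open Classical

noncomputable section

/-- The edges of the complete graph `K_n`: two-element subsets of `{1,…,n}`. -/
abbrev Edge (n : ℕ) := {e : Finset (Fin n) // e.card = 2}

/-- The probability of the graph (configuration) `ω` under the product measure in which
each edge `e` is retained independently with probability `q e`. -/
def pw {V : Type*} [Fintype V] [DecidableEq V] (q : V → ℝ) (ω : Finset V) : ℝ :=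
  (∏ e ∈ ω, q e) * ∏ e ∈ ωᶜ, (1 - q e)

/-- The number of triangles of the graph `ω`. -/
def triCount (n : ℕ) (ω : Finset (Edge n)) : ℕ :=
  (((Finset.univ : Finset (Fin n)).powersetCard 3).filter
    (fun t => ∀ e : Edge n, e.1 ⊆ t → e ∈ ω)).card

/-- The expected number of triangles `E[N_{K₃}(G(n,q))]` of the random graph `G(n,q)`. -/
def expTri (n : ℕ) (q : Edge n → ℝ) : ℝ :=
  ∑ ω : Finset (Edge n), pw q ω * (triCount n ω : ℝ)

/-- `Φ_n(t)`: the least entropic cost of a product measure whose expected number of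
triangles is at most `t`. -/
def PhiTri (n : ℕ) (t : ℝ) : ℝ :=
  sInf {x | ∃ q : Edge n → ℝ, (∀ e, q e ∈ Set.Icc (0 : ℝ) 1) ∧ expTri n q ≤ t ∧
    x = ∑ e : Edge n,
      (q e * Real.log (q e) + (1 - q e) * Real.log (1 - q e) + Real.log 2)}

section Conditioning

variable {V : Type*} [DecidableEq V]

/-- The members of `A` that agree with `ω` on `S`. -/
def cell (A : Finset (Finset V)) (S ω : Finset V) : Finset (Finset V) :=
  A.filter (fun ω' => ω' ∩ S = ω ∩ S)

/-- The indicator of the event that `e` belongs to the random set. -/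
def ind (e : V) (ω : Finset V) : ℝ := if e ∈ ω then 1 else 0

/-- The conditional probability that `e` belongs to a uniform random member of `A`, given its
intersection with `S`. -/
def condMarg (A : Finset (Finset V)) (S : Finset V) (e : V) (ω : Finset V) : ℝ :=
  (∑ ω' ∈ cell A S ω, ind e ω') / ((cell A S ω).card : ℝ)

/-- The function `g` depends only on the trace of its argument on `S`. -/
def DependsOnTrace (S : Finset V) (g : Finset V → ℝ) : Prop :=
  ∀ ω ω', ω ∩ S = ω' ∩ S → g ω = g ω'

theorem ind_nonneg (e : V) (ω : Finset V) : 0 ≤ ind e ω := by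
  unfold ind; split_ifs <;> norm_num

theorem ind_le_one (e : V) (ω : Finset V) : ind e ω ≤ 1 := by
  unfold ind; split_ifs <;> norm_num

theorem mem_cell_self {A : Finset (Finset V)} {S ω : Finset V} (h : ω ∈ A) : ω ∈ cell A S ω := by
  simp [cell, h]

theorem cell_congr (A : Finset (Finset V)) {S ω ω' : Finset V} (h : ω ∩ S = ω' ∩ S) :
    cell A S ω = cell A S ω' := by
  simp [cell, h]

theorem condMarg_nonneg (A : Finset (Finset V)) (S : Finset V) (e : V) (ω : Finset V) :
    0 ≤ condMarg A S e ω :=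
  div_nonneg (Finset.sum_nonneg fun _ _ => ind_nonneg _ _) (Nat.cast_nonneg _)

theorem condMarg_le_one (A : Finset (Finset V)) (S : Finset V) (e : V) (ω : Finset V) :
    condMarg A S e ω ≤ 1 := by
  refine div_le_one_of_le₀ ?_ (Nat.cast_nonneg _)
  calc ∑ ω' ∈ cell A S ω, ind e ω' ≤ ∑ ω' ∈ cell A S ω, (1 : ℝ) :=
        Finset.sum_le_sum fun _ _ => ind_le_one _ _
    _ = _ := by simp

theorem dependsOnTrace_condMarg (A : Finset (Finset V)) (S : Finset V) (e : V) :
    DependsOnTrace S (condMarg A S e) := fun ω ω' h => by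
  simp only [condMarg, cell_congr A h]

theorem dependsOnTrace_ind {S : Finset V} {e : V} (h : e ∈ S) : DependsOnTrace S (ind e) := by
  intro ω ω' hω
  have : e ∈ ω ↔ e ∈ ω' := by
    have := congrArg (e ∈ ·) hω
    simpa [h] using this
  simp [ind, this]

theorem DependsOnTrace.mul {S : Finset V} {f g : Finset V → ℝ} (hf : DependsOnTrace S f)
    (hg : DependsOnTrace S g) : DependsOnTrace S (fun ω => f ω * g ω) := fun ω ω' h => by
  simp only [hf ω ω' h, hg ω ω' h]

theorem DependsOnTrace.mono {S S' : Finset V} {g : Finset V → ℝ} (hg : DependsOnTrace S g)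
    (h : S ⊆ S') : DependsOnTrace S' g := fun ω ω' hω => by
  refine hg ω ω' ?_
  rw [← Finset.inter_eq_right.mpr h, ← Finset.inter_assoc, hω, Finset.inter_assoc]

/-- The defining property of conditional expectation. -/
theorem sum_condMarg_mul (A : Finset (Finset V)) {S : Finset V} (e : V) {g : Finset V → ℝ}
    (hg : DependsOnTrace S g) :
    ∑ ω ∈ A, condMarg A S e ω * g ω = ∑ ω ∈ A, ind e ω * g ω := by
  have h1 : ∀ ω ∈ A, condMarg A S e ω * g ω
      = ∑ ω' ∈ cell A S ω, ind e ω' * g ω' / ((cell A S ω').card : ℝ) := by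
    intro ω _
    rw [condMarg, div_mul_eq_mul_div, Finset.sum_mul, Finset.sum_div]
    refine Finset.sum_congr rfl fun ω' h' => ?_
    have h' := (Finset.mem_filter.mp h').2
    rw [cell_congr A h', hg ω' ω h']
  rw [Finset.sum_congr rfl h1,
    Finset.sum_comm' (t' := A) (s' := fun ω' => cell A S ω')]
  · refine Finset.sum_congr rfl fun ω h => ?_
    have : ((cell A S ω).card : ℝ) ≠ 0 := by
      exact_mod_cast (Finset.card_pos.mpr ⟨ω, mem_cell_self h⟩).ne'
    simp only [Finset.sum_const, nsmul_eq_mul]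
    field_simp
  · intro x y
    simp only [cell, Finset.mem_filter]
    tauto

theorem sum_sq_condMarg_sub (A : Finset (Finset V)) {S S' : Finset V} (h : S ⊆ S') (e : V) :
    ∑ ω ∈ A, (condMarg A S' e ω - condMarg A S e ω) ^ 2
      = ∑ ω ∈ A, condMarg A S' e ω ^ 2 - ∑ ω ∈ A, condMarg A S e ω ^ 2 := by
  have h1 := sum_condMarg_mul A e ((dependsOnTrace_condMarg A S e).mono h)
  have h2 := sum_condMarg_mul A e (dependsOnTrace_condMarg A S e)
  have h3 : ∑ ω ∈ A, (condMarg A S' e ω - condMarg A S e ω) ^ 2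
      = ∑ ω ∈ A, condMarg A S' e ω ^ 2 - 2 * ∑ ω ∈ A, condMarg A S' e ω * condMarg A S e ω
        + ∑ ω ∈ A, condMarg A S e ω * condMarg A S e ω := by
    rw [Finset.mul_sum, ← Finset.sum_sub_distrib, ← Finset.sum_add_distrib]
    exact Finset.sum_congr rfl fun _ _ => by ring
  have h4 : ∑ ω ∈ A, condMarg A S e ω ^ 2 = ∑ ω ∈ A, condMarg A S e ω * condMarg A S e ω :=
    Finset.sum_congr rfl fun _ _ => by ring
  rw [h3, h4]
  linarith

/-- Replacing an indicator by its conditional probability given `S` in a sum against a weight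
depending on the trace on a larger set `S'`. -/
theorem sum_condMarg_mul_le (A : Finset (Finset V)) {S S' : Finset V} (e : V)
    {g : Finset V → ℝ} (hg : DependsOnTrace S' g) (h0 : ∀ ω, 0 ≤ g ω) (h1 : ∀ ω, g ω ≤ 1) :
    ∑ ω ∈ A, condMarg A S e ω * g ω
      ≤ ∑ ω ∈ A, ind e ω * g ω + ∑ ω ∈ A, |condMarg A S' e ω - condMarg A S e ω| := by
  rw [← sum_condMarg_mul A e hg, ← Finset.sum_add_distrib]
  refine Finset.sum_le_sum fun ω _ => ?_
  have := neg_abs_le (condMarg A S' e ω - condMarg A S e ω)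
  have := abs_nonneg (condMarg A S' e ω - condMarg A S e ω)
  nlinarith [h0 ω, h1 ω]

variable [Fintype V]

theorem sum_pw (q : V → ℝ) : ∑ ω : Finset V, pw q ω = 1 := by
  have := Finset.prod_add q (fun e => 1 - q e) Finset.univ
  simp only [add_sub_cancel, Finset.prod_const_one, Finset.powerset_univ] at this
  rw [this]
  exact Finset.sum_congr rfl fun ω _ => by rw [pw, Finset.compl_eq_univ_sdiff]

theorem sum_pw_superset (q : V → ℝ) (T : Finset V) :
    ∑ ω : Finset V, pw q ω * (if T ⊆ ω then 1 else 0) = ∏ e ∈ T, q e := by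
  have := Finset.prod_add q (fun e => if e ∈ T then 0 else 1 - q e) Finset.univ
  have h2 : ∀ e, q e + (if e ∈ T then 0 else 1 - q e) = if e ∈ T then q e else 1 := by
    intro e; split_ifs <;> ring
  simp only [h2, Finset.prod_ite_mem, Finset.univ_inter, Finset.powerset_univ] at this
  rw [this]
  refine Finset.sum_congr rfl fun ω _ => ?_
  rw [pw, ← Finset.compl_eq_univ_sdiff, mul_assoc]
  congr 1
  by_cases h : T ⊆ ω
  · rw [if_pos h, mul_one]
    refine Finset.prod_congr rfl fun e he => ?_
    rw [if_neg fun h' => Finset.mem_compl.mp he (h h')]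
  · obtain ⟨e, he, heω⟩ := Finset.not_subset.mp h
    rw [if_neg h, mul_zero]
    symm
    exact Finset.prod_eq_zero (i := e) (Finset.mem_compl.mpr heω) (by simp [he])

/-- Subadditivity of entropy for the uniform distribution on a nonempty family `B`. -/
theorem sum_marginal_entropy_le (B : Finset (Finset V)) (hB : B.Nonempty) (q : V → ℝ)
    (hq : ∀ e, q e = (∑ ω ∈ B, ind e ω) / (B.card : ℝ)) :
    ∑ e, (q e * Real.log (q e) + (1 - q e) * Real.log (1 - q e)) ≤ - Real.log B.card := by
  have hc : (0 : ℝ) < B.card := by exact_mod_cast hB.card_pos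
  have hqc : ∀ e, q e * B.card = ∑ ω ∈ B, ind e ω := fun e => by
    rw [hq, div_mul_cancel₀ _ hc.ne']
  have hqc' : ∀ e, (1 - q e) * B.card = ∑ ω ∈ B, (1 - ind e ω) := fun e => by
    rw [sub_mul, hqc, Finset.sum_sub_distrib]; simp
  have hpos : ∀ ω ∈ B, ∀ e ∈ ω, 0 < q e := fun ω hω e he => by
    have : 0 < ∑ ω ∈ B, ind e ω :=
      Finset.sum_pos' (fun _ _ => ind_nonneg _ _) ⟨ω, hω, by simp [ind, he]⟩
    rw [hq]; positivity
  have hpos' : ∀ ω ∈ B, ∀ e ∉ ω, 0 < 1 - q e := fun ω hω e he => by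
    have : 0 < ∑ ω ∈ B, (1 - ind e ω) :=
      Finset.sum_pos' (fun _ _ => sub_nonneg.mpr (ind_le_one _ _)) ⟨ω, hω, by simp [ind, he]⟩
    rw [← hqc'] at this
    exact pos_of_mul_pos_left this hc.le
  have hpw : ∀ ω ∈ B, 0 < pw q ω := fun ω hω =>
    mul_pos (Finset.prod_pos (hpos ω hω))
      (Finset.prod_pos fun e he => hpos' ω hω e (Finset.mem_compl.mp he))
  have hlog : ∀ ω ∈ B, Real.log (pw q ω)
      = ∑ e, (ind e ω * Real.log (q e) + (1 - ind e ω) * Real.log (1 - q e)) := by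
    intro ω hω
    rw [pw, Real.log_mul (Finset.prod_pos (hpos ω hω)).ne'
      (Finset.prod_pos fun e he => hpos' ω hω e (Finset.mem_compl.mp he)).ne',
      Real.log_prod fun e he => (hpos ω hω e he).ne',
      Real.log_prod fun e he => (hpos' ω hω e (Finset.mem_compl.mp he)).ne',
      ← Finset.sum_add_sum_compl ω]
    congr 1
    · exact Finset.sum_congr rfl fun e he => by simp [ind, he]
    · exact Finset.sum_congr rfl fun e he => by simp [ind, Finset.mem_compl.mp he]
  have hsum : ∑ ω ∈ B, Real.log (pw q ω)
      = B.card * ∑ e, (q e * Real.log (q e) + (1 - q e) * Real.log (1 - q e)) := by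
    rw [Finset.sum_congr rfl hlog, Finset.sum_comm, Finset.mul_sum]
    refine Finset.sum_congr rfl fun e _ => ?_
    rw [Finset.sum_add_distrib, ← Finset.sum_mul, ← Finset.sum_mul, ← hqc, ← hqc']
    ring
  have hle : ∑ ω ∈ B, Real.log (pw q ω) ≤ ∑ ω ∈ B, (B.card * pw q ω - 1 - Real.log B.card) := by
    refine Finset.sum_le_sum fun ω hω => ?_
    have h := Real.log_le_sub_one_of_pos (mul_pos hc (hpw ω hω))
    rw [Real.log_mul hc.ne' (hpw ω hω).ne'] at h
    linarith
  have hB1 : ∑ ω ∈ B, pw q ω ≤ 1 := by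
    rw [← sum_pw q]
    refine Finset.sum_le_sum_of_subset_of_nonneg (Finset.subset_univ B) fun ω _ _ => ?_
    have h0 : ∀ e, 0 ≤ q e := fun e => by
      rw [hq]; exact div_nonneg (Finset.sum_nonneg fun _ _ => ind_nonneg _ _) hc.le
    have h1 : ∀ e, 0 ≤ 1 - q e := fun e => by
      refine nonneg_of_mul_nonneg_left ?_ hc
      rw [hqc']
      exact Finset.sum_nonneg fun _ _ => sub_nonneg.mpr (ind_le_one _ _)
    exact mul_nonneg (Finset.prod_nonneg fun e _ => h0 e) (Finset.prod_nonneg fun e _ => h1 e)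
  rw [hsum, Finset.sum_sub_distrib, Finset.sum_sub_distrib, ← Finset.mul_sum] at hle
  simp only [Finset.sum_const, nsmul_eq_mul, mul_one] at hle
  refine le_of_mul_le_mul_left ?_ hc
  nlinarith

end Conditioning

section Triangles

variable {n : ℕ}

/-- The edges of `K_n` spanned by the vertex set `T`. -/
def spanned (T : Finset (Fin n)) : Finset (Edge n) :=
  Finset.univ.filter (fun e => e.1 ⊆ T)

/-- The edges of `K_n` incident to the vertex `v`. -/
def starAt (v : Fin n) : Finset (Edge n) :=
  Finset.univ.filter (fun e => v ∈ e.1)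

theorem triCount_eq (ω : Finset (Edge n)) :
    (triCount n ω : ℝ)
      = ∑ T ∈ (Finset.univ : Finset (Fin n)).powersetCard 3,
          if spanned T ⊆ ω then 1 else 0 := by
  rw [triCount, Finset.card_filter]
  push_cast
  refine Finset.sum_congr rfl fun T _ => ?_
  have : (∀ e : Edge n, e.1 ⊆ T → e ∈ ω) ↔ spanned T ⊆ ω := by
    simp only [spanned, Finset.subset_iff (s₂ := ω), Finset.mem_filter, Finset.mem_univ, true_and]
  simp only [this]

theorem expTri_eq (q : Edge n → ℝ) :
    expTri n q = ∑ T ∈ (Finset.univ : Finset (Fin n)).powersetCard 3, ∏ e ∈ spanned T, q e := by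
  simp only [expTri, triCount_eq, Finset.mul_sum]
  rw [Finset.sum_comm]
  exact Finset.sum_congr rfl fun T _ => by
    convert sum_pw_superset q (spanned T)

theorem triCount_eq_sum_prod_ind (ω : Finset (Edge n)) :
    (triCount n ω : ℝ)
      = ∑ T ∈ (Finset.univ : Finset (Fin n)).powersetCard 3, ∏ e ∈ spanned T, ind e ω := by
  rw [triCount_eq]
  refine Finset.sum_congr rfl fun T _ => ?_
  simp only [ind, Finset.prod_boole]
  rfl

theorem card_star_le (v : Fin n) : (starAt v).card ≤ n := by
  have h : (starAt v).map (Function.Embedding.subtype _)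
      ⊆ (Finset.univ : Finset (Fin n)).image (fun u => {v, u}) := by
    intro u hu
    simp only [starAt, Finset.mem_map, Finset.mem_filter, Finset.mem_univ, true_and,
      Function.Embedding.subtype_apply] at hu
    obtain ⟨e, he, rfl⟩ := hu
    obtain ⟨a, b, _, hab⟩ := Finset.card_eq_two.mp e.2
    rw [hab] at he ⊢
    simp only [Finset.mem_insert, Finset.mem_singleton] at he
    simp only [Finset.mem_image, Finset.mem_univ, true_and]
    rcases he with rfl | rfl
    · exact ⟨b, rfl⟩
    · exact ⟨a, Finset.pair_comm _ _⟩
  simpa using (Finset.card_le_card h).trans Finset.card_image_le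

theorem card_edge_le : (Fintype.card (Edge n) : ℝ) ≤ (n : ℝ) ^ 2 / 2 := by
  have : Fintype.card (Edge n) = n.choose 2 := by
    rw [Fintype.card_subtype, ← Finset.powerset_univ, ← Finset.powersetCard_eq_filter]
    simp
  rw [this, Nat.cast_choose_two]
  nlinarith [(Nat.cast_nonneg n : (0 : ℝ) ≤ n)]

theorem finset_pair_eq_pair_iff {α : Type*} [DecidableEq α] {x y z w : α} :
    ({x, y} : Finset α) = {z, w} ↔ x = z ∧ y = w ∨ x = w ∧ y = z := by
  rw [← Finset.coe_inj]
  simp only [Finset.coe_insert, Finset.coe_singleton, Set.pair_eq_pair_iff]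

theorem exists_spanned_eq {T : Finset (Fin n)} (hT : T.card = 3) :
    ∃ b c : Fin n, ∃ e f h : Edge n, b ∈ T ∧ c ∈ T ∧ b ≠ c ∧ e.1 = T.erase c ∧
      f.1 = T.erase b ∧ f ∈ starAt c ∧ h ∈ starAt c ∧ h ∈ starAt b ∧
      ∀ x : Edge n → ℝ, ∏ i ∈ spanned T, x i = x e * (x f * x h) := by
  obtain ⟨a, b, c, hab, hac, hbc, rfl⟩ := Finset.card_eq_three.mp hT
  refine ⟨b, c, ⟨{a, b}, Finset.card_pair hab⟩, ⟨{a, c}, Finset.card_pair hac⟩,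
    ⟨{b, c}, Finset.card_pair hbc⟩, by simp, by simp, hbc, ?_, ?_, by simp [starAt],
    by simp [starAt], by simp [starAt], ?_⟩
  · ext x; simp; grind
  · ext x; simp; grind
  · intro x
    have : spanned ({a, b, c} : Finset (Fin n)) = {⟨{a, b}, Finset.card_pair hab⟩,
        ⟨{a, c}, Finset.card_pair hac⟩, ⟨{b, c}, Finset.card_pair hbc⟩} := by
      ext ⟨e, he⟩
      obtain ⟨u, v, huv, rfl⟩ := Finset.card_eq_two.mp he
      simp only [spanned, Finset.mem_filter, Finset.mem_univ, true_and, Finset.mem_insert,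
        Finset.mem_singleton, Subtype.mk.injEq, Finset.insert_subset_iff,
        Finset.singleton_subset_iff, finset_pair_eq_pair_iff]
      grind
    rw [this, Finset.prod_insert, Finset.prod_pair]
    · simp only [ne_eq, Subtype.mk.injEq, finset_pair_eq_pair_iff]
      grind
    · simp only [Subtype.mk.injEq, finset_pair_eq_pair_iff, Finset.mem_insert,
        Finset.mem_singleton]
      grind

/-- The change of the conditional marginal of the edge `u` when the star of `v` is revealed in
addition to `S` (and `0` if `u` is not an edge). -/
def starGap (A : Finset (Finset (Edge n))) (S : Finset (Edge n)) (v : Fin n)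
    (u : Finset (Fin n)) : ℝ :=
  if h : u.card = 2 then
    ∑ ω ∈ A, |condMarg A (S ∪ starAt v) ⟨u, h⟩ ω - condMarg A S ⟨u, h⟩ ω|
  else 0

theorem starGap_nonneg (A : Finset (Finset (Edge n))) (S : Finset (Edge n)) (v : Fin n)
    (u : Finset (Fin n)) : 0 ≤ starGap A S v u := by
  unfold starGap
  split_ifs
  · exact Finset.sum_nonneg fun _ _ => abs_nonneg _
  · exact le_rfl

theorem starGap_coe (A : Finset (Finset (Edge n))) (S : Finset (Edge n)) (v : Fin n)
    (e : Edge n) :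
    starGap A S v e.1 = ∑ ω ∈ A, |condMarg A (S ∪ starAt v) e ω - condMarg A S e ω| :=
  dif_pos e.2

theorem sum_mul_prod_condMarg_le (A : Finset (Finset (Edge n))) (S : Finset (Edge n))
    {T : Finset (Fin n)} (hT : T.card = 3) {g : Finset (Edge n) → ℝ} (hg : DependsOnTrace S g)
    (h0 : ∀ ω, 0 ≤ g ω) (h1 : ∀ ω, g ω ≤ 1) :
    ∑ ω ∈ A, g ω * ∏ e ∈ spanned T, condMarg A S e ω
      ≤ ∑ ω ∈ A, g ω * ∏ e ∈ spanned T, ind e ω + ∑ v ∈ T, starGap A S v (T.erase v) := by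
  obtain ⟨b, c, e, f, h, hb, hc, hbc, he, hf, hfc, hhc, hhb, hprod⟩ := exists_spanned_eq hT
  have hS : ∀ v, S ⊆ S ∪ starAt v := fun v => Finset.subset_union_left
  have hstar : ∀ {v} {i : Edge n}, i ∈ starAt v → DependsOnTrace (S ∪ starAt v) (ind i) :=
    fun hi => dependsOnTrace_ind (Finset.mem_union_right _ hi)
  have hm := dependsOnTrace_condMarg A S
  have key1 := sum_condMarg_mul A h ((hg.mul (hm e)).mul (hm f))
  have key2 := sum_condMarg_mul_le A (S := S) f
    (((hg.mul (hm e)).mono (hS b)).mul (hstar hhb))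
    (fun ω => mul_nonneg (mul_nonneg (h0 ω) (condMarg_nonneg A S e ω)) (ind_nonneg h ω))
    (fun ω => mul_le_one₀ (mul_le_one₀ (h1 ω) (condMarg_nonneg A S e ω)
      (condMarg_le_one A S e ω)) (ind_nonneg h ω) (ind_le_one h ω))
  have key3 := sum_condMarg_mul_le A (S := S) e
    (((hg.mono (hS c)).mul (hstar hfc)).mul (hstar hhc))
    (fun ω => mul_nonneg (mul_nonneg (h0 ω) (ind_nonneg f ω)) (ind_nonneg h ω))
    (fun ω => mul_le_one₀ (mul_le_one₀ (h1 ω) (ind_nonneg f ω)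
      (ind_le_one f ω)) (ind_nonneg h ω) (ind_le_one h ω))
  rw [← starGap_coe] at key2 key3
  have hgap : starGap A S b f.1 + starGap A S c e.1 ≤ ∑ v ∈ T, starGap A S v (T.erase v) := by
    rw [he, hf, ← Finset.sum_pair (f := fun v => starGap A S v (T.erase v)) hbc]
    refine Finset.sum_le_sum_of_subset_of_nonneg ?_ fun _ _ _ => starGap_nonneg _ _ _ _
    simp [Finset.insert_subset_iff, hb, hc]
  simp only [hprod]
  have e1 : ∑ ω ∈ A, g ω * (condMarg A S e ω * (condMarg A S f ω * condMarg A S h ω))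
      = ∑ ω ∈ A, condMarg A S h ω * (g ω * condMarg A S e ω * condMarg A S f ω) :=
    Finset.sum_congr rfl fun _ _ => by ring
  have e2 : ∑ ω ∈ A, ind h ω * (g ω * condMarg A S e ω * condMarg A S f ω)
      = ∑ ω ∈ A, condMarg A S f ω * (g ω * condMarg A S e ω * ind h ω) :=
    Finset.sum_congr rfl fun _ _ => by ring
  have e3 : ∑ ω ∈ A, ind f ω * (g ω * condMarg A S e ω * ind h ω)
      = ∑ ω ∈ A, condMarg A S e ω * (g ω * ind f ω * ind h ω) :=
    Finset.sum_congr rfl fun _ _ => by ring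
  have e4 : ∑ ω ∈ A, ind e ω * (g ω * ind f ω * ind h ω)
      = ∑ ω ∈ A, g ω * (ind e ω * (ind f ω * ind h ω)) :=
    Finset.sum_congr rfl fun _ _ => by ring
  linarith

theorem sum_sum_erase_le (y : Fin n → Finset (Fin n) → ℝ) (hy : ∀ v u, 0 ≤ y v u) :
    ∑ T ∈ (Finset.univ : Finset (Fin n)).powersetCard 3, ∑ v ∈ T, y v (T.erase v)
      ≤ ∑ v, ∑ e : Edge n, y v e.1 := by
  rw [Finset.sum_comm' (t' := Finset.univ)
    (s' := fun v => ((Finset.univ : Finset (Fin n)).powersetCard 3).filter (v ∈ ·))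
    (by intro x y; simp)]
  refine Finset.sum_le_sum fun v _ => ?_
  have hinj : Set.InjOn (fun T : Finset (Fin n) => T.erase v)
      ((((Finset.univ : Finset (Fin n)).powersetCard 3).filter (v ∈ ·) :
        Finset (Finset (Fin n))) : Set (Finset (Fin n))) := by
    intro T hT T' hT' h
    simp only [Finset.coe_filter, Set.mem_ofPred_eq] at hT hT'
    rw [← Finset.insert_erase hT.2, ← Finset.insert_erase hT'.2]
    exact congrArg (insert v) h
  rw [← Finset.sum_image (f := y v) hinj]
  have : ∑ e : Edge n, y v e.1 = ∑ u ∈ Finset.univ.filter (fun u : Finset (Fin n) => u.card = 2),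
      y v u := (Finset.sum_subtype _ (by simp) _).symm
  rw [this]
  refine Finset.sum_le_sum_of_subset_of_nonneg ?_ fun _ _ _ => hy _ _
  intro u hu
  simp only [Finset.mem_image, Finset.mem_filter, Finset.mem_powersetCard_univ] at hu
  obtain ⟨T, ⟨hT, hv⟩, rfl⟩ := hu
  simp [Finset.card_erase_of_mem hv, hT]

/-- There is a small set of vertices such that, once the edges incident to it are revealed,
revealing the star of any further vertex changes the conditional marginals only slightly. -/
theorem exists_stars (A : Finset (Finset (Edge n))) (hA : A.Nonempty) {δ : ℝ} (hδ : 0 < δ) :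
    ∃ W : Finset (Fin n), δ * W.card ≤ (n : ℝ) ^ 2 / 2 ∧ ∀ v,
      ∑ e : Edge n, ∑ ω ∈ A, (condMarg A (W.biUnion starAt ∪ starAt v) e ω
        - condMarg A (W.biUnion starAt) e ω) ^ 2 ≤ δ * A.card := by
  have hc : (0 : ℝ) < A.card := by exact_mod_cast hA.card_pos
  set G : Finset (Fin n) → ℝ := fun W =>
    ∑ e : Edge n, ∑ ω ∈ A, condMarg A (W.biUnion starAt) e ω ^ 2 with hG
  obtain ⟨W, -, hW⟩ := Finset.exists_max_image (Finset.univ : Finset (Finset (Fin n)))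
    (fun W => G W - δ * A.card * W.card) ⟨∅, Finset.mem_univ _⟩
  refine ⟨W, ?_, fun v => ?_⟩
  · have h := hW ∅ (Finset.mem_univ _)
    have h0 : 0 ≤ G ∅ := Finset.sum_nonneg fun _ _ => Finset.sum_nonneg fun _ _ => sq_nonneg _
    have h1 : G W ≤ A.card * ((n : ℝ) ^ 2 / 2) := by
      calc G W ≤ ∑ e : Edge n, ∑ ω ∈ A, (1 : ℝ) :=
            Finset.sum_le_sum fun e _ => Finset.sum_le_sum fun ω _ =>
              pow_le_one₀ (condMarg_nonneg _ _ _ _) (condMarg_le_one _ _ _ _)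
        _ = A.card * Fintype.card (Edge n) := by simp [mul_comm]
        _ ≤ _ := mul_le_mul_of_nonneg_left card_edge_le hc.le
    simp only [Finset.card_empty, Nat.cast_zero, mul_zero, sub_zero] at h
    refine le_of_mul_le_mul_left ?_ hc
    linarith
  · have h := hW (insert v W) (Finset.mem_univ _)
    have hle : ((insert v W).card : ℝ) ≤ W.card + 1 := by
      exact_mod_cast Finset.card_insert_le v W
    have hGv : G (insert v W)
        = ∑ e : Edge n, ∑ ω ∈ A, condMarg A (W.biUnion starAt ∪ starAt v) e ω ^ 2 := by
      simp only [hG, Finset.biUnion_insert, Finset.union_comm]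
    simp only [sum_sq_condMarg_sub A (Finset.subset_union_left :
      W.biUnion starAt ⊆ W.biUnion starAt ∪ starAt v), Finset.sum_sub_distrib]
    rw [← hGv]
    have := mul_le_mul_of_nonneg_left hle (mul_pos hδ hc).le
    change G (insert v W) - G W ≤ _
    linarith

theorem sum_starGap_le (A : Finset (Finset (Edge n))) (S : Finset (Edge n)) {δ l : ℝ}
    (hl : 0 < l) (h : ∀ v, ∑ e : Edge n, ∑ ω ∈ A, (condMarg A (S ∪ starAt v) e ω
        - condMarg A S e ω) ^ 2 ≤ δ * A.card) :
    ∑ v, ∑ e : Edge n, starGap A S v e.1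
      ≤ A.card * (n * (l * δ / 2 + (n : ℝ) ^ 2 / (4 * l))) := by
  have habs : ∀ x : ℝ, |x| ≤ l / 2 * x ^ 2 + 1 / (2 * l) := fun x => by
    have h1 : l / 2 * x ^ 2 + 1 / (2 * l) - |x| = (l * |x| - 1) ^ 2 / (2 * l) := by
      rw [← sq_abs x]; field_simp; ring
    have : 0 ≤ (l * |x| - 1) ^ 2 / (2 * l) := by positivity
    linarith
  have hv : ∀ v, ∑ e : Edge n, starGap A S v e.1
      ≤ A.card * (l * δ / 2 + (n : ℝ) ^ 2 / (4 * l)) := fun v => by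
    calc ∑ e : Edge n, starGap A S v e.1
        ≤ ∑ e : Edge n, ∑ ω ∈ A, (l / 2 * (condMarg A (S ∪ starAt v) e ω
        - condMarg A S e ω) ^ 2 + 1 / (2 * l)) := by
          simp only [starGap_coe]
          exact Finset.sum_le_sum fun e _ => Finset.sum_le_sum fun ω _ => habs _
      _ = l / 2 * ∑ e : Edge n, ∑ ω ∈ A, (condMarg A (S ∪ starAt v) e ω
        - condMarg A S e ω) ^ 2 + A.card * (1 / (2 * l)) * Fintype.card (Edge n) := by
          simp only [Finset.sum_add_distrib, ← Finset.mul_sum, Finset.sum_const, nsmul_eq_mul,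
            Finset.card_univ]
          ring
      _ ≤ l / 2 * (δ * A.card) + A.card * (1 / (2 * l)) * ((n : ℝ) ^ 2 / 2) := by
          gcongr
          · exact h v
          · exact card_edge_le
      _ = _ := by field_simp; ring
  calc _ ≤ ∑ _v : Fin n, A.card * (l * δ / 2 + (n : ℝ) ^ 2 / (4 * l)) :=
        Finset.sum_le_sum fun v _ => hv v
    _ = _ := by simp; ring

theorem expTri_condMarg_congr (A : Finset (Finset (Edge n))) (S : Finset (Edge n)) :
    DependsOnTrace S (fun ω => expTri n fun e => condMarg A S e ω) := fun ω ω' h => by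
  simp only [dependsOnTrace_condMarg A S _ ω ω' h]

/-- Markov's inequality for the number of configurations whose conditional marginals have too
many expected triangles. -/
theorem card_bad_mul_le (A : Finset (Finset (Edge n))) (S : Finset (Edge n)) {t r : ℝ}
    (hA : ∀ ω ∈ A, (triCount n ω : ℝ) ≤ t) :
    ((A.filter fun ω => t + r < expTri n fun e => condMarg A S e ω).card : ℝ) * r
      ≤ ∑ v, ∑ e : Edge n, starGap A S v e.1 := by
  set g : Finset (Edge n) → ℝ :=
    fun ω => if t + r < expTri n fun e => condMarg A S e ω then 1 else 0 with hgdef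
  have hg : DependsOnTrace S g := fun ω ω' h => by
    simp only [hgdef, expTri_condMarg_congr A S ω ω' h]
  have h0 : ∀ ω, 0 ≤ g ω := fun ω => by simp only [hgdef]; split_ifs <;> norm_num
  have h1 : ∀ ω, g ω ≤ 1 := fun ω => by simp only [hgdef]; split_ifs <;> norm_num
  have hcard : ((A.filter fun ω => t + r < expTri n fun e => condMarg A S e ω).card : ℝ)
      = ∑ ω ∈ A, g ω := by simp [hgdef]
  have hlow : (∑ ω ∈ A, g ω) * (t + r)
      ≤ ∑ ω ∈ A, g ω * expTri n fun e => condMarg A S e ω := by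
    rw [Finset.sum_mul]
    refine Finset.sum_le_sum fun ω _ => ?_
    simp only [hgdef]
    split_ifs with h
    · linarith
    · simp
  have hup : ∑ ω ∈ A, g ω * (triCount n ω : ℝ) ≤ (∑ ω ∈ A, g ω) * t := by
    rw [Finset.sum_mul]
    exact Finset.sum_le_sum fun ω hω => mul_le_mul_of_nonneg_left (hA ω hω) (h0 ω)
  have hmid : ∑ ω ∈ A, g ω * (expTri n fun e => condMarg A S e ω)
      ≤ ∑ ω ∈ A, g ω * (triCount n ω : ℝ) + ∑ v, ∑ e : Edge n, starGap A S v e.1 := by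
    refine le_trans ?_ (add_le_add_right (sum_sum_erase_le _ (starGap_nonneg A S)) _)
    simp only [expTri_eq, triCount_eq_sum_prod_ind, Finset.mul_sum]
    rw [Finset.sum_comm, Finset.sum_comm (s := A), ← Finset.sum_add_distrib]
    exact Finset.sum_le_sum fun T hT =>
      sum_mul_prod_condMarg_le A S (Finset.mem_powersetCard.mp hT).2 hg h0 h1
  rw [hcard]
  linarith

theorem PhiTri_le {t : ℝ} {q : Edge n → ℝ} (hq : ∀ e, q e ∈ Set.Icc (0 : ℝ) 1)
    (ht : expTri n q ≤ t) :
    PhiTri n t ≤ ∑ e : Edge n,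
      (q e * Real.log (q e) + (1 - q e) * Real.log (1 - q e) + Real.log 2) := by
  refine csInf_le ⟨0, ?_⟩ ⟨q, hq, ht, rfl⟩
  rintro x ⟨p, -, -, rfl⟩
  refine Finset.sum_nonneg fun e _ => ?_
  have := Real.binEntropy_le_log_two (p := p e)
  rw [Real.binEntropy_eq_negMulLog_add_negMulLog_one_sub, Real.negMulLog, Real.negMulLog] at this
  linarith

theorem log_card_cell_le (A : Finset (Finset (Edge n))) (S : Finset (Edge n)) {t : ℝ}
    {ω : Finset (Edge n)} (hω : ω ∈ A) (h : (expTri n fun e => condMarg A S e ω) ≤ t) :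
    Real.log (cell A S ω).card ≤ Fintype.card (Edge n) * Real.log 2 - PhiTri n t := by
  have h1 := PhiTri_le (fun e => ⟨condMarg_nonneg A S e ω, condMarg_le_one A S e ω⟩) h
  have h2 := sum_marginal_entropy_le (cell A S ω) ⟨ω, mem_cell_self hω⟩
    (fun e => condMarg A S e ω) (fun e => rfl)
  rw [Finset.sum_add_distrib] at h1
  simp only [Finset.sum_const, nsmul_eq_mul, Finset.card_univ] at h1
  linarith

theorem card_good_le (A : Finset (Finset (Edge n))) (S : Finset (Edge n)) (t : ℝ) :
    ((A.filter fun ω => (expTri n fun e => condMarg A S e ω) ≤ t).card : ℝ)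
      ≤ 2 ^ S.card * Real.exp (Fintype.card (Edge n) * Real.log 2 - PhiTri n t) := by
  set B := A.filter fun ω => (expTri n fun e => condMarg A S e ω) ≤ t with hB
  rw [Finset.card_eq_sum_card_fiberwise (f := fun ω => ω ∩ S) (s := B) (t := S.powerset)
    (fun ω _ => by simp)]
  push_cast
  calc _ ≤ ∑ _s ∈ S.powerset, Real.exp (Fintype.card (Edge n) * Real.log 2 - PhiTri n t) := by
        refine Finset.sum_le_sum fun s _ => ?_
        rcases (B.filter fun ω => ω ∩ S = s).eq_empty_or_nonempty with h | ⟨ω, hω⟩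
        · rw [h]; simp [Real.exp_nonneg]
        · rw [Finset.mem_filter, hB, Finset.mem_filter] at hω
          have hsub : (B.filter fun ω => ω ∩ S = s) ⊆ cell A S ω := by
            intro ω' h'
            rw [Finset.mem_filter, hB, Finset.mem_filter] at h'
            rw [cell, Finset.mem_filter]
            exact ⟨h'.1.1, h'.2.trans hω.2.symm⟩
          have hpos : (0 : ℝ) < (cell A S ω).card := by
            exact_mod_cast Finset.card_pos.mpr ⟨ω, mem_cell_self hω.1.1⟩
          refine le_trans (Nat.cast_le.mpr (Finset.card_le_card hsub)) ?_
          rw [← Real.log_le_iff_le_exp hpos]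
          exact log_card_cell_le A S hω.1.1 hω.1.2
    _ = _ := by simp

theorem sum_pw_half (t : ℝ) :
    (∑ ω : Finset (Edge n), if (triCount n ω : ℝ) ≤ t then pw (fun _ => (1 / 2 : ℝ)) ω else 0)
      = ((Finset.univ.filter fun ω : Finset (Edge n) => (triCount n ω : ℝ) ≤ t).card : ℝ)
        * (1 / 2) ^ Fintype.card (Edge n) := by
  have hpw : ∀ ω : Finset (Edge n),
      pw (fun _ => (1 / 2 : ℝ)) ω = (1 / 2) ^ Fintype.card (Edge n) := fun ω => by
    rw [pw, show (1 : ℝ) - 1 / 2 = 1 / 2 by norm_num, Finset.prod_const, Finset.prod_const,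
      ← pow_add, Finset.card_add_card_compl]
  simp only [hpw]
  rw [← Finset.sum_filter, Finset.sum_const, nsmul_eq_mul]

end Triangles

/-- Theorem `thm:triangles`: if `X_n` is the number of triangles in `G(n, 1/2)`, then for
every `n ≥ 1` and every `t ≥ 0`,
`log Pr(X_n ≤ t) ≤ − Φ_n(t + n^{23/8}) + 2 n^{15/8}`. -/
theorem triangle_lower_tail (n : ℕ) (hn : 0 < n) (t : ℝ) (ht : 0 ≤ t) :
    Real.log (∑ ω : Finset (Edge n),
        if (triCount n ω : ℝ) ≤ t then pw (fun _ => (1 / 2 : ℝ)) ω else 0)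
      ≤ - PhiTri n (t + (n : ℝ) ^ ((23 : ℝ) / 8)) + 2 * (n : ℝ) ^ ((15 : ℝ) / 8) := by
  have hn1 : (1 : ℝ) ≤ n := by exact_mod_cast hn
  have hn0 : (0 : ℝ) < n := by linarith
  set A := Finset.univ.filter fun ω : Finset (Edge n) => (triCount n ω : ℝ) ≤ t with hAdef
  have hA : A.Nonempty := by
    refine ⟨∅, Finset.mem_filter.mpr ⟨Finset.mem_univ _, ?_⟩⟩
    have : triCount n ∅ = 0 := by
      rw [triCount, Finset.card_eq_zero, Finset.filter_eq_empty_iff]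
      intro T hT h
      obtain ⟨b, c, e, -, -, -, -, -, he, -⟩ :=
        exists_spanned_eq (Finset.mem_powersetCard.mp hT).2
      exact absurd (h e (he ▸ Finset.erase_subset _ _)) (Finset.notMem_empty _)
    simpa [this] using ht
  have hc : (0 : ℝ) < A.card := by exact_mod_cast hA.card_pos
  obtain ⟨W, hW, hstars⟩ := exists_stars A hA
    (show (0 : ℝ) < (n : ℝ) ^ ((9 : ℝ) / 8) / 2 by positivity)
  set S := W.biUnion starAt with hSdef
  set r := (n : ℝ) ^ ((23 : ℝ) / 8) with hr
  have hr0 : 0 < r := by positivity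
  have hWcard : (W.card : ℝ) ≤ (n : ℝ) ^ ((7 : ℝ) / 8) := by
    have h : (n : ℝ) ^ 2 = (n : ℝ) ^ ((9 : ℝ) / 8) * (n : ℝ) ^ ((7 : ℝ) / 8) := by
      rw [← Real.rpow_add hn0, ← Real.rpow_natCast]; norm_num
    rw [h] at hW
    have h9 : (0 : ℝ) < (n : ℝ) ^ ((9 : ℝ) / 8) := by positivity
    refine le_of_mul_le_mul_left ?_ h9
    linarith
  have hScard : (S.card : ℝ) ≤ (n : ℝ) ^ ((15 : ℝ) / 8) := by
    have h1 : S.card ≤ W.card * n := Finset.card_biUnion_le_card_mul _ _ _ fun v _ =>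
      card_star_le v
    calc (S.card : ℝ) ≤ W.card * n := by exact_mod_cast h1
      _ ≤ (n : ℝ) ^ ((7 : ℝ) / 8) * n := by gcongr
      _ = _ := by
        nth_rewrite 2 [← Real.rpow_one (n : ℝ)]
        rw [← Real.rpow_add hn0]; norm_num
  have hbad := card_bad_mul_le A S (t := t) (r := r) fun ω hω => (Finset.mem_filter.mp hω).2
  have hgap := sum_starGap_le A S (l := (n : ℝ) ^ ((1 : ℝ) / 4)) (by positivity) hstars
  have herr : (n : ℝ) * ((n : ℝ) ^ ((1 : ℝ) / 4) * ((n : ℝ) ^ ((9 : ℝ) / 8) / 2) / 2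
      + (n : ℝ) ^ 2 / (4 * (n : ℝ) ^ ((1 : ℝ) / 4))) ≤ r / 2 := by
    have h1 : (n : ℝ) * ((n : ℝ) ^ ((1 : ℝ) / 4) * (n : ℝ) ^ ((9 : ℝ) / 8)) ≤ r := by
      nth_rewrite 1 [← Real.rpow_one (n : ℝ)]
      rw [← Real.rpow_add hn0, ← Real.rpow_add hn0]
      exact Real.rpow_le_rpow_of_exponent_le hn1 (by norm_num)
    have h2 : (n : ℝ) * ((n : ℝ) ^ 2 / (n : ℝ) ^ ((1 : ℝ) / 4)) ≤ r := by
      nth_rewrite 1 [← Real.rpow_one (n : ℝ)]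
      rw [← Real.rpow_natCast, ← Real.rpow_sub hn0, ← Real.rpow_add hn0]
      exact Real.rpow_le_rpow_of_exponent_le hn1 (by norm_num)
    have h3 : (n : ℝ) ^ 2 / (4 * (n : ℝ) ^ ((1 : ℝ) / 4))
        = (n : ℝ) ^ 2 / (n : ℝ) ^ ((1 : ℝ) / 4) / 4 := by
      field_simp
    rw [h3]
    linarith
  have hbad2 : ((A.filter fun ω => t + r < expTri n fun e => condMarg A S e ω).card : ℝ)
      ≤ A.card / 2 := by
    refine le_of_mul_le_mul_right ?_ hr0
    have := mul_le_mul_of_nonneg_left herr hc.le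
    linarith
  have hgood := card_good_le A S (t + r)
  have hsplit : ((A.filter fun ω => (expTri n fun e => condMarg A S e ω) ≤ t + r).card : ℝ)
      + ((A.filter fun ω => t + r < expTri n fun e => condMarg A S e ω).card : ℝ) = A.card := by
    simp only [← not_le]
    exact_mod_cast Finset.card_filter_add_card_filter_not (s := A) _
  have hAle : (A.card : ℝ)
      ≤ 2 * (2 ^ S.card * Real.exp (Fintype.card (Edge n) * Real.log 2 - PhiTri n (t + r))) := by
    linarith
  have hlogA := Real.log_le_log hc hAle
  rw [Real.log_mul (by norm_num) (by positivity), Real.log_mul (by positivity)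
    (Real.exp_ne_zero _), Real.log_exp, Real.log_pow] at hlogA
  rw [sum_pw_half, Real.log_mul hc.ne' (by positivity), Real.log_pow, one_div, Real.log_inv]
  have hlog2 : Real.log 2 ≤ 1 := by linarith [Real.log_two_lt_d9]
  have hlog20 : 0 ≤ Real.log 2 := Real.log_nonneg (by norm_num)
  have h15 : 1 ≤ (n : ℝ) ^ ((15 : ℝ) / 8) := Real.one_le_rpow hn1 (by norm_num)
  nlinarith

end
end

section
/- For every nonempty graph H, every p_0 < 1, and every ε > 0, there exists a constant L such that the following holds: if L·n^{−1/m_2(H)} ≤ p ≤ p_0 and X denotes the number N_H(G(n,p)) of copies of H in the binomial random graph G(n,p), then for every η ∈ [0,1], (1−ε)·Φ_{n,p}^H(η+ε) ≤ −log Pr(X ≤ η·E[X]) ≤ (1+ε)·Φ_{n,p}^H((1−ε)η). -/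
open Classical

noncomputable section

/-- The relative entropy `i_p(q) = D_KL(Ber(q) ‖ Ber(p))`.  (In Lean `Real.log 0 = 0`,
which implements the convention `0 · log 0 = 0`.) -/
def ip (p q : ℝ) : ℝ :=
  q * Real.log (q / p) + (1 - q) * Real.log ((1 - q) / (1 - p))

/-- The number of copies (embeddings) of the graph `H` in the graph `ω ⊆ E(K_n)`. -/
def copyCount {α : Type*} [Fintype α] [DecidableEq α] (H : SimpleGraph α) (n : ℕ)
    (ω : Finset (Edge n)) : ℕ :=
  (Finset.univ.filter fun φ : α ↪ Fin n =>
    ∀ a b, H.Adj a b → ∀ h : ({φ a, φ b} : Finset (Fin n)).card = 2,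
      (⟨{φ a, φ b}, h⟩ : Edge n) ∈ ω).card

/-- `E[N_H(G(n, q))]`: the expected number of copies of `H` in the random graph
`G(n, q)`. -/
def expCopy {α : Type*} [Fintype α] [DecidableEq α] (H : SimpleGraph α) (n : ℕ)
    (q : Edge n → ℝ) : ℝ :=
  ∑ ω : Finset (Edge n), pw q ω * (copyCount H n ω : ℝ)

/-- `Φ_{n,p}^H(η) = min { ∑_e i_p(q_e) : q ∈ [0,1]^{E(K_n)},
E[N_H(G(n,q))] ≤ η · E[N_H(G(n,p))] }`. -/
def PhiCopy {α : Type*} [Fintype α] [DecidableEq α] (H : SimpleGraph α) (n : ℕ)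
    (p η : ℝ) : ℝ :=
  sInf {x | ∃ q : Edge n → ℝ, (∀ e, q e ∈ Set.Icc (0 : ℝ) 1) ∧
    expCopy H n q ≤ η * expCopy H n (fun _ => p) ∧ x = ∑ e, ip p (q e)}

/-- `Pr(X ≤ η E[X])` where `X = N_H(G(n,p))`. -/
def PrCopy {α : Type*} [Fintype α] [DecidableEq α] (H : SimpleGraph α) (n : ℕ)
    (p η : ℝ) : ℝ :=
  ∑ ω : Finset (Edge n),
    if (copyCount H n ω : ℝ) ≤ η * expCopy H n (fun _ => p)
    then pw (fun _ => p) ω else 0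

/-- The `2`-density `m₂(H)` of a graph `H`: if `H` has at least two edges it is
`max {(e_F − 1)/(v_F − 2) : F ⊆ H, e_F ≥ 2}` (the maximum over subgraphs `F`, given by
their edge sets, with `v_F` the number of non-isolated vertices of `F`); otherwise it
is `1/2`. -/
def m2 {α : Type*} [Fintype α] (H : SimpleGraph α) : ℝ :=
  if 2 ≤ H.edgeSet.ncard then
    sSup {x | ∃ F : Set (Sym2 α), F ⊆ H.edgeSet ∧ 2 ≤ F.ncard ∧
      x = ((F.ncard : ℝ) - 1) / (({v | ∃ e ∈ F, v ∈ e} : Set α).ncard - 2)}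
  else 1 / 2

namespace LowerTail

section ProductMeasure

variable {V : Type*} [Fintype V] [DecidableEq V]

theorem pw_eq_prod (q : V → ℝ) (ω : Finset V) :
    pw q ω = ∏ v, if v ∈ ω then q v else 1 - q v := by
  rw [Finset.prod_ite, pw]
  congr 1
  · exact Finset.prod_congr (by ext; simp) fun _ _ => rfl
  · exact Finset.prod_congr (by ext; simp) fun _ _ => rfl

theorem pw_nonneg {q : V → ℝ} (hq : ∀ v, q v ∈ Set.Icc (0 : ℝ) 1) (ω : Finset V) :
    0 ≤ pw q ω :=
  mul_nonneg (Finset.prod_nonneg fun v _ => (hq v).1)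
    (Finset.prod_nonneg fun v _ => sub_nonneg.2 (hq v).2)

theorem sum_pw_mul_prod (q F G : V → ℝ) :
    ∑ ω, pw q ω * ∏ v, (if v ∈ ω then F v else G v) =
      ∏ v, (q v * F v + (1 - q v) * G v) := by
  rw [Finset.prod_add, Finset.powerset_univ]
  refine Finset.sum_congr rfl fun ω _ => ?_
  rw [pw_eq_prod, ← Finset.prod_mul_distrib]
  have : ∀ v, ((if v ∈ ω then q v else 1 - q v) * if v ∈ ω then F v else G v) =
      if v ∈ ω then q v * F v else (1 - q v) * G v := fun v => by split_ifs <;> rfl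
  simp_rw [this]
  rw [Finset.prod_ite]
  congr 1
  · exact Finset.prod_congr (by ext; simp) fun _ _ => rfl
  · exact Finset.prod_congr (by ext; simp) fun _ _ => rfl

theorem sum_pw (q : V → ℝ) : ∑ ω, pw q ω = 1 := by
  simpa using sum_pw_mul_prod q 1 1

theorem sum_pw_subset_notMem (q : V → ℝ) (S : Finset V) {v : V} (hv : v ∉ S) :
    ∑ ω, pw q ω * (if S ⊆ ω ∧ v ∉ ω then 1 else 0) = (∏ w ∈ S, q w) * (1 - q v) := by
  have h := sum_pw_mul_prod q (fun w => if w = v then 0 else 1) (fun w => if w ∈ S then 0 else 1)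
  have h1 : ∀ ω : Finset V, (∏ w, if w ∈ ω then (if w = v then (0 : ℝ) else 1) else
      if w ∈ S then 0 else 1) = if S ⊆ ω ∧ v ∉ ω then 1 else 0 := by
    intro ω
    split_ifs with hω
    · refine Finset.prod_eq_one fun w _ => ?_
      split_ifs with h1 h2 h3
      · exact absurd (h2 ▸ h1) hω.2
      · rfl
      · exact absurd (hω.1 h3) h1
      · rfl
    · rw [Finset.prod_eq_zero_iff]
      by_cases hvω : v ∈ ω
      · exact ⟨v, Finset.mem_univ _, by simp [hvω]⟩
      · have : ¬ S ⊆ ω := fun h => hω ⟨h, hvω⟩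
        obtain ⟨w, hw, hwω⟩ := Finset.not_subset.1 this
        exact ⟨w, Finset.mem_univ _, by simp [hw, hwω]⟩
  simp_rw [h1] at h
  rw [h, ← Finset.prod_erase_mul _ _ (Finset.mem_univ v)]
  congr 1
  · rw [← Finset.prod_subset (s₁ := S)
      (fun w hw => Finset.mem_erase.2 ⟨ne_of_mem_of_not_mem hw hv, Finset.mem_univ _⟩)]
    · refine Finset.prod_congr rfl fun w hw => ?_
      have : w ≠ v := fun h => hv (h ▸ hw)
      simp [this, hw]
    · intro w hw hwS
      simp [Finset.ne_of_mem_erase hw, hwS]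
  · simp [hv]

theorem sum_pw_subset (q : V → ℝ) (S : Finset V) :
    ∑ ω, pw q ω * (if S ⊆ ω then 1 else 0) = ∏ w ∈ S, q w := by
  have h := sum_pw_mul_prod q 1 (fun w => if w ∈ S then 0 else 1)
  have h1 : ∀ ω : Finset V, (∏ w, if w ∈ ω then (1 : V → ℝ) w else
      if w ∈ S then 0 else 1) = if S ⊆ ω then 1 else 0 := by
    intro ω
    split_ifs with hω
    · refine Finset.prod_eq_one fun w _ => ?_
      split_ifs with h1 h3
      · rfl
      · exact absurd (hω h3) h1
      · rfl
    · rw [Finset.prod_eq_zero_iff]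
      obtain ⟨w, hw, hwω⟩ := Finset.not_subset.1 hω
      exact ⟨w, Finset.mem_univ _, by simp [hw, hwω]⟩
  simp_rw [h1] at h
  rw [h, ← Finset.prod_subset (s₁ := S) (Finset.subset_univ _)]
  · exact Finset.prod_congr rfl fun w hw => by simp [hw]
  · intro w _ hwS
    simp [hwS]

theorem sum_pw_card (q : V → ℝ) : ∑ ω, pw q ω * (ω.card : ℝ) = ∑ v, q v := by
  have h : ∀ ω : Finset V, (ω.card : ℝ) = ∑ v, if ({v} : Finset V) ⊆ ω then 1 else 0 := by
    intro ω
    simp [Finset.sum_ite_mem]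
  simp_rw [h, Finset.mul_sum]
  rw [Finset.sum_comm]
  refine Finset.sum_congr rfl fun v _ => ?_
  rw [sum_pw_subset]
  simp

/-- The variance of a sum of independent centred two-valued variables. -/
theorem sum_pw_sq (q x y : V → ℝ) (h0 : ∀ v, q v * x v + (1 - q v) * y v = 0) :
    ∑ ω, pw q ω * (∑ v, if v ∈ ω then x v else y v) ^ 2 =
      ∑ v, (q v * x v ^ 2 + (1 - q v) * y v ^ 2) := by
  have key : ∀ v w, ∑ ω, pw q ω * ((if v ∈ ω then x v else y v) * if w ∈ ω then x w else y w) =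
      if v = w then q v * x v ^ 2 + (1 - q v) * y v ^ 2 else 0 := by
    intro v w
    have h1 : ∀ ω : Finset V, ((if v ∈ ω then x v else y v) * if w ∈ ω then x w else y w) =
        ∏ u, if u ∈ ω then (if u = v then x u else 1) * (if u = w then x u else 1)
          else (if u = v then y u else 1) * (if u = w then y u else 1) := by
      intro ω
      have : ∀ u, (if u ∈ ω then (if u = v then x u else 1) * (if u = w then x u else 1)
          else (if u = v then y u else 1) * (if u = w then y u else 1)) =
          (if u = v then (if u ∈ ω then x u else y u) else 1) *
          (if u = w then (if u ∈ ω then x u else y u) else 1) := by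
        intro u; split_ifs <;> rfl
      simp_rw [this, Finset.prod_mul_distrib]
      simp
    simp_rw [h1]
    rw [sum_pw_mul_prod q (fun u => (if u = v then x u else 1) * (if u = w then x u else 1))
      (fun u => (if u = v then y u else 1) * (if u = w then y u else 1))]
    split_ifs with hvw
    · subst hvw
      rw [Finset.prod_eq_single v]
      · simp; ring
      · intro u _ hu
        simp [hu]
      · simp
    · rw [Finset.prod_eq_zero_iff]
      exact ⟨v, Finset.mem_univ _, by simp [hvw, h0]⟩
  simp_rw [sq (∑ v, _), Finset.sum_mul_sum, Finset.mul_sum]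
  rw [Finset.sum_comm]
  refine Finset.sum_congr rfl fun v _ => ?_
  rw [Finset.sum_comm]
  simp_rw [key]
  simp

end ProductMeasure

section RelativeEntropy

theorem ip_nonneg {p q : ℝ} (hp : 0 < p) (hp1 : p < 1) (hq : q ∈ Set.Icc (0 : ℝ) 1) :
    0 ≤ ip p q := by
  have key : ∀ a b : ℝ, 0 ≤ a → 0 < b → a - b ≤ a * Real.log (a / b) := by
    intro a b ha hb
    rcases ha.eq_or_lt with rfl | ha
    · simp [hb.le]
    · have h := Real.one_sub_inv_le_log_of_pos (div_pos ha hb)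
      have h2 := mul_le_mul_of_nonneg_left h ha.le
      have h3 : a * (1 - (a / b)⁻¹) = a - b := by field_simp
      linarith
  have h1 := key q p hq.1 hp
  have h2 := key (1 - q) (1 - p) (by linarith [hq.2]) (by linarith)
  rw [ip]
  linarith

theorem ip_self {p : ℝ} : ip p p = 0 := by
  have h : ∀ x : ℝ, x * Real.log (x / x) = 0 := by
    intro x
    by_cases hx : x = 0 <;> simp [hx]
  rw [ip, h, h, add_zero]

theorem sq_div_le_ip {p q : ℝ} (hp : 0 < p) (hp1 : p < 1) (hq : 0 ≤ q) (hqp : q ≤ p) :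
    (p - q) ^ 2 / (4 * p) ≤ ip p q := by
  have h2 : p - q ≤ (1 - q) * Real.log ((1 - q) / (1 - p)) := by
    have ha : 0 < 1 - q := by linarith
    have hb : 0 < 1 - p := by linarith
    have h := Real.one_sub_inv_le_log_of_pos (div_pos ha hb)
    have h2 := mul_le_mul_of_nonneg_left h ha.le
    have h3 : (1 - q) * (1 - ((1 - q) / (1 - p))⁻¹) = p - q := by field_simp; ring
    linarith
  have h1 : q - p + (p - q) ^ 2 / (4 * p) ≤ q * Real.log (q / p) := by
    set s := Real.sqrt (q / p)
    have hsq : s ^ 2 = q / p := Real.sq_sqrt (by positivity)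
    have hqs : q = p * s ^ 2 := by rw [hsq]; field_simp
    have hs0 : 0 ≤ s := Real.sqrt_nonneg _
    have hl : 2 * s ^ 2 - 2 * s ≤ s ^ 2 * Real.log (s ^ 2) := by
      rcases hs0.eq_or_lt with h | h
      · simp [← h]
      · have h4 := Real.one_sub_inv_le_log_of_pos h
        have h5 := mul_le_mul_of_nonneg_left h4 (by positivity : 0 ≤ 2 * s ^ 2)
        rw [Real.log_pow]
        have h6 : 2 * s ^ 2 * (1 - s⁻¹) = 2 * s ^ 2 - 2 * s := by field_simp
        push_cast
        linarith
    rw [← hsq, hqs]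
    have h7 : (p - p * s ^ 2) ^ 2 / (4 * p) = p * (1 - s ^ 2) ^ 2 / 4 := by field_simp
    rw [h7]
    have h8 : (1 - s ^ 2) ^ 2 / 4 ≤ (1 - s) ^ 2 := by
      have : (1 - s ^ 2) ^ 2 = (1 - s) ^ 2 * (1 + s) ^ 2 := by ring
      rw [this]
      have h9 : (1 + s) ^ 2 ≤ 4 := by nlinarith
      nlinarith [mul_le_mul_of_nonneg_left h9 (sq_nonneg (1 - s))]
    nlinarith
  rw [ip]
  linarith

/-- The variance of the log-likelihood ratio of two Bernoulli variables is bounded by a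
multiple of their relative entropy. -/
theorem llr_variance_le {p p₀ q : ℝ} (hp : 0 < p) (hpp : p ≤ p₀) (hp1 : p₀ < 1) (hq : 0 ≤ q)
    (hqp : q ≤ p) :
    q * (1 - q) * (Real.log (q / p) - Real.log ((1 - q) / (1 - p))) ^ 2 ≤
      (32 + 8 / (1 - p₀) ^ 2) * ip p q := by
  have hp0 : 0 < 1 - p₀ := by linarith
  have hip := sq_div_le_ip hp (by linarith) hq hqp
  set a := Real.log (q / p)
  set b := Real.log ((1 - q) / (1 - p))
  have hpq : (p - q) ^ 2 ≤ 4 * p * ip p q := by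
    rwa [div_le_iff₀ (by positivity), mul_comm] at hip
  have hA : q * a ^ 2 ≤ 4 * (p - q) ^ 2 / p := by
    set s := Real.sqrt (q / p)
    have hsq : s ^ 2 = q / p := Real.sq_sqrt (by positivity)
    have hqs : q = p * s ^ 2 := by rw [hsq]; field_simp
    have hs0 : 0 ≤ s := Real.sqrt_nonneg _
    have hs1 : s ≤ 1 := Real.sqrt_le_one.2 ((div_le_one hp).2 hqp)
    have hl : (s * Real.log s) ^ 2 ≤ (1 - s) ^ 2 := by
      rcases hs0.eq_or_lt with h | h
      · simp [← h]
      · have h4 := Real.one_sub_inv_le_log_of_pos h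
        have h5 := mul_le_mul_of_nonneg_left h4 hs0
        have h6 : s * (1 - s⁻¹) = s - 1 := by field_simp
        have h7 : Real.log s ≤ 0 := Real.log_nonpos hs0 hs1
        have h8 := mul_nonneg hs0 (neg_nonneg.2 h7)
        nlinarith
    have ha : a = 2 * Real.log s := by
      simp only [a]
      rw [← hsq, Real.log_pow]; push_cast; ring
    rw [ha]
    have h9 : 4 * (p - q) ^ 2 / p = 4 * p * (1 - s ^ 2) ^ 2 := by
      rw [hqs]; field_simp
    rw [h9, hqs]
    have h10 : (1 - s) ^ 2 ≤ (1 - s ^ 2) ^ 2 := by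
      have : (1 - s ^ 2) ^ 2 = (1 - s) ^ 2 * (1 + s) ^ 2 := by ring
      rw [this]
      nlinarith [sq_nonneg (1 - s)]
    nlinarith
  have hB : b ^ 2 ≤ (p - q) ^ 2 / (1 - p₀) ^ 2 := by
    have h1q : 0 < 1 - q := by linarith
    have h1p : 0 < 1 - p := by linarith
    have hb0 : 0 ≤ b := Real.log_nonneg ((one_le_div h1p).2 (by linarith))
    have hb1 : b ≤ (p - q) / (1 - p₀) := by
      have h := Real.log_le_sub_one_of_pos (div_pos h1q h1p)
      have h2 : (1 - q) / (1 - p) - 1 = (p - q) / (1 - p) := by field_simp; ring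
      have h3 : (p - q) / (1 - p) ≤ (p - q) / (1 - p₀) :=
        div_le_div_of_nonneg_left (by linarith) hp0 (by linarith)
      linarith
    rw [← div_pow]
    exact pow_le_pow_left₀ hb0 hb1 2
  have hA' : q * a ^ 2 ≤ 16 * ip p q := by
    refine hA.trans ?_
    rw [div_le_iff₀ hp]
    linarith
  have hB' : q * b ^ 2 ≤ 4 / (1 - p₀) ^ 2 * ip p q := by
    have h1 : q * b ^ 2 ≤ 1 * ((p - q) ^ 2 / (1 - p₀) ^ 2) :=
      mul_le_mul (by linarith) hB (sq_nonneg _) zero_le_one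
    have h2 : (p - q) ^ 2 ≤ 4 * ip p q := by nlinarith
    calc q * b ^ 2 ≤ (p - q) ^ 2 / (1 - p₀) ^ 2 := by linarith
      _ ≤ 4 * ip p q / (1 - p₀) ^ 2 := by gcongr
      _ = _ := by ring
  have h1 : q * (1 - q) * (a - b) ^ 2 ≤ q * (a - b) ^ 2 := by
    have := mul_nonneg hq (sq_nonneg (a - b))
    nlinarith
  have h2 : q * (a - b) ^ 2 ≤ 2 * (q * a ^ 2) + 2 * (q * b ^ 2) := by
    nlinarith [mul_nonneg hq (sq_nonneg (a + b))]
  calc _ ≤ 2 * (16 * ip p q) + 2 * (4 / (1 - p₀) ^ 2 * ip p q) := by linarith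
    _ = _ := by ring

end RelativeEntropy

section Tilting

variable {V : Type*} [Fintype V] [DecidableEq V]

/-- Change of measure: an event of probability at least `ε` under a product measure `q ≤ p` of
large relative entropy `D` has probability at least `exp (-(1 + ε) D)` under the `p`-biased
measure. -/
theorem neg_log_le_of_tilt (A : Finset V → Prop) {p p₀ ε : ℝ} {q : V → ℝ} (hp : 0 < p)
    (hpp : p ≤ p₀) (hp1 : p₀ < 1) (hε : 0 < ε) (hq : ∀ v, 0 ≤ q v)
    (hqp : ∀ v, q v ≤ p) (hA : ε ≤ ∑ ω, if A ω then pw q ω else 0)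
    (hD1 : 8 * (32 + 8 / (1 - p₀) ^ 2) / ε ^ 3 ≤ ∑ v, ip p (q v))
    (hD2 : 2 / ε * Real.log (2 / ε) ≤ ∑ v, ip p (q v)) :
    -Real.log (∑ ω, if A ω then pw (fun _ => p) ω else 0) ≤ (1 + ε) * ∑ v, ip p (q v) := by
  set D := ∑ v, ip p (q v) with hD
  set C := 32 + 8 / (1 - p₀) ^ 2
  have hDpos : 0 < D := lt_of_lt_of_le (by positivity) hD1
  have hqI : ∀ v, q v ∈ Set.Icc (0 : ℝ) 1 := fun v => ⟨hq v, by linarith [hqp v]⟩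
  have hq1 : ∀ v, 0 < 1 - q v := fun v => by linarith [hqp v]
  set a : V → ℝ := fun v => Real.log (q v / p)
  set b : V → ℝ := fun v => Real.log ((1 - q v) / (1 - p))
  let l : Finset V → ℝ := fun ω => ∑ v, if v ∈ ω then a v else b v
  have hip : ∀ v, ip p (q v) = q v * a v + (1 - q v) * b v := fun v => rfl
  have hvar : ∑ ω, pw q ω * (l ω - D) ^ 2 ≤ C * D := by
    have h1 : ∀ ω, l ω - D = ∑ v, if v ∈ ω then a v - ip p (q v) else b v - ip p (q v) := by
      intro ω
      rw [hD, ← Finset.sum_sub_distrib]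
      exact Finset.sum_congr rfl fun v _ => by split_ifs <;> rfl
    simp_rw [h1]
    rw [sum_pw_sq q (fun v => a v - ip p (q v)) (fun v => b v - ip p (q v))
      (fun v => by rw [hip]; ring), hD, Finset.mul_sum]
    refine Finset.sum_le_sum fun v _ => ?_
    refine le_trans (le_of_eq ?_) (llr_variance_le hp hpp hp1 (hq v) (hqp v))
    rw [hip]
    ring
  let B : Finset V → Prop := fun ω => l ω ≤ (1 + ε / 2) * D
  have hcheb : ∑ ω, (if ¬ B ω then pw q ω else 0) ≤ ε / 2 := by
    have h1 : ∀ ω, (if ¬ B ω then pw q ω else 0) * (ε / 2 * D) ^ 2 ≤ pw q ω * (l ω - D) ^ 2 := by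
      intro ω
      have hw := pw_nonneg hqI ω
      split_ifs with h
      · rw [zero_mul]; positivity
      · refine mul_le_mul_of_nonneg_left (pow_le_pow_left₀ (by positivity) ?_ 2) hw
        have : (1 + ε / 2) * D < l ω := not_le.1 h
        linarith
    have h2 := (Finset.sum_le_sum fun ω (_ : ω ∈ Finset.univ) => h1 ω).trans hvar
    rw [← Finset.sum_mul] at h2
    rw [div_le_iff₀ (by positivity)] at hD1
    by_contra! hcon
    have h3 : ε / 2 * (ε / 2 * D) ^ 2 < C * D :=
      lt_of_lt_of_le (mul_lt_mul_of_pos_right hcon (by positivity)) h2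
    have h4 : 8 * C * D ≤ D * ε ^ 3 * D := mul_le_mul_of_nonneg_right hD1 hDpos.le
    nlinarith
  have hAB : ε / 2 ≤ ∑ ω, if A ω ∧ B ω then pw q ω else 0 := by
    have h1 : ∑ ω, (if A ω then pw q ω else 0) ≤
        ∑ ω, (if A ω ∧ B ω then pw q ω else 0) + ∑ ω, (if ¬ B ω then pw q ω else 0) := by
      rw [← Finset.sum_add_distrib]
      refine Finset.sum_le_sum fun ω _ => ?_
      have hw := pw_nonneg hqI ω
      by_cases h1 : A ω <;> by_cases h2 : B ω <;> simp [h1, h2, hw]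
    linarith
  have hpI : ∀ _ : V, p ∈ Set.Icc (0 : ℝ) 1 := fun _ => ⟨hp.le, by linarith⟩
  have hpt : ∀ ω, Real.exp (-((1 + ε / 2) * D)) * (if A ω ∧ B ω then pw q ω else 0) ≤
      if A ω then pw (fun _ => p) ω else 0 := by
    intro ω
    have hw := pw_nonneg hqI ω
    have hw' := pw_nonneg (q := fun _ : V => p) hpI ω
    by_cases hAB : A ω ∧ B ω
    · rw [if_pos hAB, if_pos hAB.1]
      rcases hw.eq_or_lt with h0 | h0
      · rw [← h0, mul_zero]; exact hw'
      · have hne : ∀ v, 0 < if v ∈ ω then q v else 1 - q v := by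
          intro v
          have h2 : (if v ∈ ω then q v else 1 - q v) ≠ 0 := by
            intro h3
            rw [pw_eq_prod, Finset.prod_eq_zero (Finset.mem_univ v) h3] at h0
            exact lt_irrefl _ h0
          refine lt_of_le_of_ne ?_ h2.symm
          split_ifs
          · exact hq v
          · exact (hq1 v).le
        have h4 : pw (fun _ => p) ω = Real.exp (-l ω) * pw q ω := by
          rw [pw_eq_prod, pw_eq_prod, ← Finset.sum_neg_distrib, Real.exp_sum,
            ← Finset.prod_mul_distrib]
          refine Finset.prod_congr rfl fun v _ => ?_
          have := hne v
          have h1p : 0 < 1 - p := by linarith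
          split_ifs at this ⊢ with hv
          · rw [Real.exp_neg, Real.exp_log (by positivity)]
            field_simp
          · rw [Real.exp_neg, Real.exp_log (by positivity)]
            field_simp
        rw [h4]
        refine mul_le_mul_of_nonneg_right (Real.exp_le_exp.2 (neg_le_neg hAB.2)) hw
    · rw [if_neg hAB, mul_zero]
      split_ifs
      · exact hw'
      · exact le_rfl
  have hlow : Real.exp (-((1 + ε / 2) * D)) * (ε / 2) ≤
      ∑ ω, if A ω then pw (fun _ => p) ω else 0 := by
    refine le_trans (mul_le_mul_of_nonneg_left hAB (Real.exp_pos _).le) ?_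
    rw [Finset.mul_sum]
    exact Finset.sum_le_sum fun ω _ => hpt ω
  have hlog := Real.log_le_log (by positivity) hlow
  rw [Real.log_mul (Real.exp_pos _).ne' (by positivity), Real.log_exp] at hlog
  have h5 : Real.log (2 / ε) = -Real.log (ε / 2) := by
    rw [← Real.log_inv, inv_div]
  have h6 : Real.log (2 / ε) ≤ ε / 2 * D := by
    have := mul_le_mul_of_nonneg_left hD2 (by positivity : 0 ≤ ε / 2)
    have h7 : ε / 2 * (2 / ε * Real.log (2 / ε)) = Real.log (2 / ε) := by field_simp
    linarith
  linarith

end Tilting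

section Conditioning

variable {V : Type*} [DecidableEq V]

/-- The indicator function of the event that a configuration contains `S`. -/
def ind (S ω : Finset V) : ℝ := if S ⊆ ω then 1 else 0

/-- A function of configurations that depends only on the configuration on `U`. -/
def DependsOnly (U : Finset V) (g : Finset V → ℝ) : Prop :=
  ∀ ω ω', ω ∩ U = ω' ∩ U → g ω = g ω'

theorem ind_nonneg (S ω : Finset V) : 0 ≤ ind S ω := by
  rw [ind]; split_ifs <;> norm_num

theorem ind_le_one (S ω : Finset V) : ind S ω ≤ 1 := by
  rw [ind]; split_ifs <;> norm_num

theorem ind_mul_ind (S T ω : Finset V) : ind S ω * ind T ω = ind (S ∪ T) ω := by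
  simp only [ind, Finset.union_subset_iff]
  by_cases h1 : S ⊆ ω <;> by_cases h2 : T ⊆ ω <;> simp [h1, h2]

theorem dependsOnly_ind {S U : Finset V} (h : S ⊆ U) : DependsOnly U (ind S) := by
  intro ω ω' hω
  have : ∀ ω : Finset V, S ⊆ ω ↔ S ⊆ ω ∩ U := fun ω => by
    simp [Finset.subset_inter_iff, h]
  have h2 : S ⊆ ω ↔ S ⊆ ω' := by rw [this ω, this ω', hω]
  simp only [ind, h2]

theorem DependsOnly.mono {U U' : Finset V} (h : U ⊆ U') {g : Finset V → ℝ}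
    (hg : DependsOnly U g) : DependsOnly U' g := by
  intro ω ω' hω
  refine hg ω ω' ?_
  have : ∀ ω : Finset V, ω ∩ U = ω ∩ U' ∩ U := fun ω => by
    rw [Finset.inter_assoc, Finset.inter_eq_right.2 h]
  rw [this ω, this ω', hω]

variable [Fintype V] {ν : Finset V → ℝ}

/-- The conditional expectation of `f` under the weights `ν`, given the configuration on `U`. -/
def condE (ν : Finset V → ℝ) (U : Finset V) (f : Finset V → ℝ) (ω : Finset V) : ℝ :=
  (∑ ω', if ω' ∩ U = ω ∩ U then ν ω' * f ω' else 0) / ∑ ω', if ω' ∩ U = ω ∩ U then ν ω' else 0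

theorem dependsOnly_condE (U : Finset V) (f : Finset V → ℝ) : DependsOnly U (condE ν U f) := by
  intro ω ω' h
  simp only [condE, h]

theorem eq_zero_of_mass_eq_zero (hν : ∀ ω, 0 ≤ ν ω) {U ω : Finset V}
    (h : (∑ ω', if ω' ∩ U = ω ∩ U then ν ω' else 0) = 0) {ω' : Finset V}
    (hω : ω' ∩ U = ω ∩ U) : ν ω' = 0 := by
  have := (Finset.sum_eq_zero_iff_of_nonneg fun ω' _ => by
    split_ifs
    · exact hν ω'
    · exact le_rfl).1 h ω' (Finset.mem_univ _)
  simpa [hω] using this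

theorem sum_mul_condE (hν : ∀ ω, 0 ≤ ν ω) {U : Finset V} {g : Finset V → ℝ}
    (hg : DependsOnly U g) (f : Finset V → ℝ) :
    ∑ ω, ν ω * (g ω * condE ν U f ω) = ∑ ω, ν ω * (g ω * f ω) := by
  have h1 : ∀ ω, ν ω * (g ω * condE ν U f ω) = ∑ ω', if ω' ∩ U = ω ∩ U then
      ν ω * (g ω' * (ν ω' * f ω')) / (∑ η, if η ∩ U = ω' ∩ U then ν η else 0) else 0 := by
    intro ω
    rw [condE, mul_div_assoc', mul_div_assoc', Finset.mul_sum, Finset.mul_sum, Finset.sum_div]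
    refine Finset.sum_congr rfl fun ω' _ => ?_
    split_ifs with h
    · rw [hg _ _ h, h]
    · simp
  simp_rw [h1]
  rw [Finset.sum_comm]
  refine Finset.sum_congr rfl fun ω' _ => ?_
  set m := ∑ η, if η ∩ U = ω' ∩ U then ν η else 0 with hm
  have h2 : ∀ ω, (if ω' ∩ U = ω ∩ U then ν ω * (g ω' * (ν ω' * f ω')) / m else 0) =
      (if ω ∩ U = ω' ∩ U then ν ω else 0) * (g ω' * (ν ω' * f ω') / m) := by
    intro ω
    by_cases h : ω' ∩ U = ω ∩ U
    · rw [if_pos h, if_pos h.symm]; ring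
    · rw [if_neg h, if_neg (Ne.symm h), zero_mul]
  simp_rw [h2]
  rw [← Finset.sum_mul, ← hm]
  by_cases h0 : m = 0
  · rw [eq_zero_of_mass_eq_zero hν h0 rfl]; simp
  · field_simp

theorem sum_condE (hν : ∀ ω, 0 ≤ ν ω) (U : Finset V) (f : Finset V → ℝ) :
    ∑ ω, ν ω * condE ν U f ω = ∑ ω, ν ω * f ω := by
  simpa using sum_mul_condE hν (U := U) (g := fun _ => 1) (fun _ _ _ => rfl) f

theorem condE_mul_condE (hν : ∀ ω, 0 ≤ ν ω) {U U' : Finset V} (hU : U ⊆ U')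
    {g : Finset V → ℝ} (hg : DependsOnly U' g) (f : Finset V → ℝ) (ω : Finset V) :
    condE ν U (fun ω' => g ω' * condE ν U' f ω') ω = condE ν U (fun ω' => g ω' * f ω') ω := by
  have hd : DependsOnly U' (fun ω' => (if ω' ∩ U = ω ∩ U then 1 else 0) * g ω') := by
    intro a b hab
    have : a ∩ U = b ∩ U := by
      rw [← Finset.inter_eq_right.2 hU, ← Finset.inter_assoc, ← Finset.inter_assoc, hab]
    simp only [this, hg a b hab]
  have h := sum_mul_condE hν hd f
  rw [condE, condE]
  congr 1
  refine Eq.trans (Finset.sum_congr rfl fun ω' _ => ?_)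
    (h.trans (Finset.sum_congr rfl fun ω' _ => ?_)) <;> split_ifs <;> ring

theorem condE_mul_left {U : Finset V} {g : Finset V → ℝ} (hg : DependsOnly U g)
    (f : Finset V → ℝ) (ω : Finset V) :
    condE ν U (fun ω' => g ω' * f ω') ω = g ω * condE ν U f ω := by
  rw [condE, condE, mul_div_assoc', Finset.mul_sum]
  congr 1
  refine Finset.sum_congr rfl fun ω' _ => ?_
  split_ifs with h
  · rw [hg _ _ h]; ring
  · simp

theorem condE_sum {ι : Type*} (s : Finset ι) (U : Finset V) (f : ι → Finset V → ℝ)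
    (ω : Finset V) :
    condE ν U (fun ω' => ∑ i ∈ s, f i ω') ω = ∑ i ∈ s, condE ν U (f i) ω := by
  simp only [condE]
  rw [← Finset.sum_div, Finset.sum_comm]
  congr 1
  refine Finset.sum_congr rfl fun ω' _ => ?_
  split_ifs
  · rw [Finset.mul_sum]
  · simp

theorem condE_sub (U : Finset V) (f g : Finset V → ℝ) (ω : Finset V) :
    condE ν U (fun ω' => f ω' - g ω') ω = condE ν U f ω - condE ν U g ω := by
  simp only [condE]
  rw [← sub_div, ← Finset.sum_sub_distrib]
  congr 1
  refine Finset.sum_congr rfl fun ω' _ => ?_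
  split_ifs <;> ring

theorem condE_mono (hν : ∀ ω, 0 ≤ ν ω) (U : Finset V) {f g : Finset V → ℝ}
    (hfg : ∀ ω, ν ω ≠ 0 → f ω ≤ g ω) (ω : Finset V) : condE ν U f ω ≤ condE ν U g ω := by
  rw [condE, condE]
  refine div_le_div_of_nonneg_right (Finset.sum_le_sum fun ω' _ => ?_)
    (Finset.sum_nonneg fun ω' _ => ?_)
  · split_ifs
    · by_cases h : ν ω' = 0
      · simp [h]
      · exact mul_le_mul_of_nonneg_left (hfg ω' h) (hν ω')
    · exact le_rfl
  · split_ifs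
    · exact hν ω'
    · exact le_rfl

theorem condE_nonneg (hν : ∀ ω, 0 ≤ ν ω) (U : Finset V) {f : Finset V → ℝ}
    (hf : ∀ ω, 0 ≤ f ω) (ω : Finset V) : 0 ≤ condE ν U f ω := by
  have h := condE_mono hν U (f := fun _ => 0) (fun ω _ => hf ω) ω
  simpa [condE] using h

theorem condE_const (hν : ∀ ω, 0 ≤ ν ω) (U : Finset V) (x : ℝ) {ω : Finset V} (hω : ν ω ≠ 0) :
    condE ν U (fun _ => x) ω = x := by
  have h : (∑ ω', if ω' ∩ U = ω ∩ U then ν ω' else 0) ≠ 0 := fun h0 =>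
    hω (eq_zero_of_mass_eq_zero hν h0 rfl)
  have h2 : (∑ ω', if ω' ∩ U = ω ∩ U then ν ω' * x else 0) =
      (∑ ω', if ω' ∩ U = ω ∩ U then ν ω' else 0) * x := by
    rw [Finset.sum_mul]
    exact Finset.sum_congr rfl fun ω' _ => by split_ifs <;> simp
  rw [condE, h2, mul_div_cancel_left₀ _ h]

theorem condE_ind_le_one (hν : ∀ ω, 0 ≤ ν ω) (U S : Finset V) (ω : Finset V) :
    condE ν U (ind S) ω ≤ 1 := by
  refine (condE_mono hν U (g := fun _ => 1) (fun ω _ => ind_le_one S ω) ω).trans ?_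
  simp only [condE, mul_one]
  exact div_self_le_one _

theorem sum_sq_condE_sub (hν : ∀ ω, 0 ≤ ν ω) {U U' : Finset V} (hU : U ⊆ U')
    (f : Finset V → ℝ) :
    ∑ ω, ν ω * (condE ν U f ω - condE ν U' f ω) ^ 2 =
      ∑ ω, ν ω * condE ν U' f ω ^ 2 - ∑ ω, ν ω * condE ν U f ω ^ 2 := by
  have hd := dependsOnly_condE (ν := ν) U f
  have h1 := sum_mul_condE hν hd f
  have h2 := sum_mul_condE hν (hd.mono hU) f
  have h3 : ∀ ω, ν ω * (condE ν U f ω - condE ν U' f ω) ^ 2 =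
      ν ω * condE ν U' f ω ^ 2 + ν ω * (condE ν U f ω * condE ν U f ω)
        - 2 * (ν ω * (condE ν U f ω * condE ν U' f ω)) := fun ω => by ring
  have h4 : ∀ ω, ν ω * condE ν U f ω ^ 2 = ν ω * (condE ν U f ω * condE ν U f ω) :=
    fun ω => by ring
  simp_rw [h3, h4]
  rw [Finset.sum_sub_distrib, Finset.sum_add_distrib, ← Finset.mul_sum, h1, h2]
  ring

/-- A family of product measures that depends only on the configuration on `U`, and whose
marginals on `U` are fixed, has total mass one. -/
theorem sum_pw_dependsOnly {p : ℝ} {U : Finset V} (h : Finset V → V → ℝ)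
    (hdep : ∀ ω ω', ω ∩ U = ω' ∩ U → h ω = h ω') (hU : ∀ ω, ∀ v ∈ U, h ω v = p) :
    ∑ ω, pw (h ω) ω = 1 := by
  have hcyl : ∀ (q : V → ℝ) (σ : Finset V), (∀ v ∈ U, q v = p) →
      ∑ ω, (if ω ∩ U = σ ∩ U then pw q ω else 0) =
        ∏ v, (p * (if v ∈ U then (if v ∈ σ then 1 else 0) else 1) +
          (1 - p) * (if v ∈ U then (if v ∈ σ then 0 else 1) else 1)) := by
    intro q σ hq
    have h1 : ∀ ω : Finset V, (if ω ∩ U = σ ∩ U then pw q ω else 0) = pw q ω *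
        ∏ v, if v ∈ ω then (if v ∈ U then (if v ∈ σ then (1 : ℝ) else 0) else 1)
          else (if v ∈ U then (if v ∈ σ then 0 else 1) else 1) := by
      intro ω
      by_cases hω : ω ∩ U = σ ∩ U
      · rw [if_pos hω, Finset.prod_eq_one, mul_one]
        intro v _
        have := Finset.ext_iff.1 hω v
        clear hω
        by_cases h1 : v ∈ U <;> by_cases h2 : v ∈ ω <;> by_cases h3 : v ∈ σ <;> simp_all
      · rw [if_neg hω]
        rw [Finset.ext_iff] at hω
        push Not at hω
        obtain ⟨v, hv⟩ := hω
        rw [Finset.prod_eq_zero (Finset.mem_univ v), mul_zero]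
        by_cases h1 : v ∈ U <;> by_cases h2 : v ∈ ω <;> by_cases h3 : v ∈ σ <;> simp_all
    simp_rw [h1]
    rw [sum_pw_mul_prod q (fun v => if v ∈ U then (if v ∈ σ then (1 : ℝ) else 0) else 1)
      (fun v => if v ∈ U then (if v ∈ σ then 0 else 1) else 1)]
    refine Finset.prod_congr rfl fun v _ => ?_
    by_cases hv : v ∈ U
    · rw [hq v hv]
    · simp [hv]
  have hsplit : ∀ f : Finset V → ℝ, ∑ ω, f ω =
      ∑ σ ∈ U.powerset, ∑ ω, if ω ∩ U = σ ∩ U then f ω else 0 := by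
    intro f
    rw [Finset.sum_comm]
    refine Finset.sum_congr rfl fun ω _ => ?_
    rw [Finset.sum_eq_single_of_mem (ω ∩ U) (Finset.mem_powerset.2 Finset.inter_subset_right)]
    · simp
    · intro σ hσ hne
      rw [if_neg]
      intro h
      exact hne (by rw [h, Finset.inter_eq_left.2 (Finset.mem_powerset.1 hσ)])
  rw [hsplit, ← sum_pw (fun _ : V => p), hsplit]
  refine Finset.sum_congr rfl fun σ _ => ?_
  rw [hcyl (fun _ => p) σ (fun _ _ => rfl), ← hcyl (h σ) σ (hU σ)]
  refine Finset.sum_congr rfl fun ω _ => ?_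
  split_ifs with hω
  · rw [hdep ω σ hω]
  · rfl

/-- Superadditivity of relative entropy, conditionally on the configuration on `U`. -/
theorem sum_ip_condE_le {p M : ℝ} (hp : 0 < p) (hp1 : p < 1) (hν : ∀ ω, 0 ≤ ν ω)
    (hν1 : ∑ ω, ν ω = 1) (hM : 0 < M) (hνM : ∀ ω, ν ω ≤ M * pw (fun _ => p) ω) (U : Finset V) :
    ∑ ω, ν ω * ∑ v ∈ Uᶜ, ip p (condE ν U (ind {v}) ω) ≤ Real.log M := by
  set q : V → Finset V → ℝ := fun v => condE ν U (ind {v})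
  have hq0 : ∀ v ω, 0 ≤ q v ω := fun v ω => condE_nonneg hν U (ind_nonneg _) ω
  have hq1 : ∀ v ω, q v ω ≤ 1 := fun v ω => condE_ind_le_one hν U _ ω
  have hdep : ∀ (F : ℝ → ℝ) (v : V), DependsOnly U (fun ω => F (q v ω)) := fun F v a b h =>
    congrArg F (dependsOnly_condE U (ind {v}) a b h)
  let g : Finset V → ℝ := fun ω =>
    ∏ v ∈ Uᶜ, if v ∈ ω then q v ω / p else (1 - q v ω) / (1 - p)
  have hg0 : ∀ ω, 0 ≤ g ω := fun ω => Finset.prod_nonneg fun v _ => by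
    split_ifs
    · exact div_nonneg (hq0 _ _) hp.le
    · exact div_nonneg (sub_nonneg.2 (hq1 _ _)) (by linarith)
  have hpg : ∑ ω, pw (fun _ => p) ω * g ω = 1 := by
    rw [← sum_pw_dependsOnly (p := p) (U := U) (fun ω v => if v ∈ U then p else q v ω)]
    · refine Finset.sum_congr rfl fun ω _ => ?_
      rw [pw_eq_prod, pw_eq_prod, ← Finset.prod_mul_prod_compl U, mul_assoc,
        ← Finset.prod_mul_distrib, ← Finset.prod_mul_prod_compl U]
      congr 1
      · exact Finset.prod_congr rfl fun v hv => by simp [hv]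
      · refine Finset.prod_congr rfl fun v hv => ?_
        have h1p : 1 - p ≠ 0 := by linarith
        have hv' : v ∉ U := by simpa using hv
        simp only [hv', if_false]
        split_ifs <;> field_simp
    · intro ω ω' h
      funext v
      split_ifs
      · rfl
      · exact dependsOnly_condE U (ind {v}) _ _ h
    · intro ω v hv
      simp [hv]
  have hsum : ∀ v, ∑ ω, ν ω * ip p (q v ω) = ∑ ω, ν ω *
      (if v ∈ ω then Real.log (q v ω / p) else Real.log ((1 - q v ω) / (1 - p))) := by
    intro v
    have h1 := sum_mul_condE hν (hdep (fun x => Real.log (x / p)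
      - Real.log ((1 - x) / (1 - p))) v) (ind {v})
    have h2 : ∀ ω, ν ω * ip p (q v ω) = ν ω * ((Real.log (q v ω / p)
        - Real.log ((1 - q v ω) / (1 - p))) * condE ν U (ind {v}) ω)
        + ν ω * Real.log ((1 - q v ω) / (1 - p)) := by
      intro ω
      change ν ω * ip p (q v ω) = ν ω * ((Real.log (q v ω / p)
        - Real.log ((1 - q v ω) / (1 - p))) * q v ω) + ν ω * Real.log ((1 - q v ω) / (1 - p))
      rw [ip]; ring
    simp_rw [h2]
    rw [Finset.sum_add_distrib, h1, ← Finset.sum_add_distrib]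
    refine Finset.sum_congr rfl fun ω _ => ?_
    simp only [ind, Finset.singleton_subset_iff]
    split_ifs <;> ring
  have hfac : ∀ ω, ν ω ≠ 0 → ∀ v,
      0 < if v ∈ ω then q v ω / p else (1 - q v ω) / (1 - p) := by
    intro ω hω v
    have hm : (∑ ω', if ω' ∩ U = ω ∩ U then ν ω' else 0) ≠ 0 := fun h0 =>
      hω (eq_zero_of_mass_eq_zero hν h0 rfl)
    have hm' : 0 < (∑ ω', if ω' ∩ U = ω ∩ U then ν ω' else 0) :=
      lt_of_le_of_ne (Finset.sum_nonneg fun ω' _ => by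
        split_ifs
        · exact hν ω'
        · exact le_rfl) hm.symm
    have hωpos : 0 < ν ω := lt_of_le_of_ne (hν ω) hω.symm
    have hpos : ∀ f : Finset V → ℝ, (∀ ω, 0 ≤ f ω) → 0 < f ω → 0 < condE ν U f ω := by
      intro f hf hfω
      refine div_pos (Finset.sum_pos' (fun ω' _ => ?_) ⟨ω, Finset.mem_univ _, ?_⟩) hm'
      · split_ifs
        · exact mul_nonneg (hν ω') (hf ω')
        · exact le_rfl
      · rw [if_pos rfl]; exact mul_pos hωpos hfω
    split_ifs with hv
    · exact div_pos (hpos _ (ind_nonneg _) (by simp [ind, hv])) hp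
    · refine div_pos ?_ (by linarith)
      have h1 := condE_sub (ν := ν) U (fun _ => 1) (ind {v}) ω
      rw [condE_const hν U 1 hω] at h1
      rw [← h1]
      exact hpos _ (fun ω' => sub_nonneg.2 (ind_le_one _ _)) (by simp [ind, hv])
  have hlog : ∀ ω, ν ω * ∑ v ∈ Uᶜ,
      (if v ∈ ω then Real.log (q v ω / p) else Real.log ((1 - q v ω) / (1 - p))) ≤
      pw (fun _ => p) ω * g ω + ν ω * (Real.log M - 1) := by
    intro ω
    by_cases hω : ν ω = 0
    · have hpI : ∀ _ : V, p ∈ Set.Icc (0 : ℝ) 1 := fun _ => ⟨hp.le, hp1.le⟩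
      have := mul_nonneg (pw_nonneg hpI ω) (hg0 ω)
      rw [hω]; linarith
    · have hgpos : 0 < g ω := Finset.prod_pos fun v _ => hfac ω hω v
      have h1 : ∑ v ∈ Uᶜ,
          (if v ∈ ω then Real.log (q v ω / p) else Real.log ((1 - q v ω) / (1 - p))) =
          Real.log (g ω) := by
        rw [Real.log_prod fun v _ => (hfac ω hω v).ne']
        exact Finset.sum_congr rfl fun v _ => by split_ifs <;> rfl
      rw [h1]
      have h2 := Real.log_le_sub_one_of_pos (div_pos hgpos hM)
      rw [Real.log_div hgpos.ne' hM.ne'] at h2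
      have h3 := mul_le_mul_of_nonneg_left h2 (hν ω)
      have h4 : ν ω * (g ω / M) ≤ pw (fun _ => p) ω * g ω := by
        rw [mul_div_assoc', div_le_iff₀ hM]
        nlinarith [mul_le_mul_of_nonneg_right (hνM ω) hgpos.le]
      linarith
  calc ∑ ω, ν ω * ∑ v ∈ Uᶜ, ip p (q v ω)
      = ∑ ω, ν ω * ∑ v ∈ Uᶜ,
        (if v ∈ ω then Real.log (q v ω / p) else Real.log ((1 - q v ω) / (1 - p))) := by
        simp_rw [Finset.mul_sum]
        rw [Finset.sum_comm, Finset.sum_comm (t := Uᶜ)]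
        exact Finset.sum_congr rfl fun v _ => hsum v
    _ ≤ ∑ ω, (pw (fun _ => p) ω * g ω + ν ω * (Real.log M - 1)) :=
        Finset.sum_le_sum fun ω _ => hlog ω
    _ = Real.log M := by
        rw [Finset.sum_add_distrib, hpg, ← Finset.sum_mul, hν1]; ring

end Conditioning

section Decreasing

variable {V : Type*} [Fintype V] [DecidableEq V]

theorem pw_erase (p : ℝ) {ω : Finset V} {v : V} (hv : v ∈ ω) :
    (1 - p) * pw (fun _ => p) ω = p * pw (fun _ => p) (ω.erase v) := by
  rw [pw, pw, ← Finset.mul_prod_erase _ _ hv, Finset.compl_erase,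
    Finset.prod_insert (by simpa using hv)]
  ring

theorem sum_mem_le (𝒜 : Finset V → Prop) {p : ℝ} (hp : 0 < p) (hp1 : p < 1) (v : V)
    (hcl : ∀ ω, 𝒜 ω → 𝒜 (ω.erase v)) :
    ∑ ω with 𝒜 ω ∧ v ∈ ω, pw (fun _ => p) ω ≤ p * ∑ ω with 𝒜 ω, pw (fun _ => p) ω := by
  have hpI : ∀ _ : V, p ∈ Set.Icc (0 : ℝ) 1 := fun _ => ⟨hp.le, hp1.le⟩
  have h1 : (1 - p) * ∑ ω with 𝒜 ω ∧ v ∈ ω, pw (fun _ => p) ω ≤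
      p * ∑ ω with 𝒜 ω ∧ v ∉ ω, pw (fun _ => p) ω := by
    have hinj : Set.InjOn (fun ω : Finset V => ω.erase v)
        (Finset.univ.filter fun ω => 𝒜 ω ∧ v ∈ ω : Finset (Finset V)) := by
      intro a ha b hb hab
      have ha' : v ∈ a := by simp at ha; exact ha.2
      have hb' : v ∈ b := by simp at hb; exact hb.2
      rw [← Finset.insert_erase ha', ← Finset.insert_erase hb']
      exact congrArg _ hab
    rw [Finset.mul_sum, Finset.mul_sum]
    calc ∑ ω with 𝒜 ω ∧ v ∈ ω, (1 - p) * pw (fun _ => p) ω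
        = ∑ ω with 𝒜 ω ∧ v ∈ ω, p * pw (fun _ => p) (ω.erase v) :=
          Finset.sum_congr rfl fun ω hω => pw_erase p (Finset.mem_filter.1 hω).2.2
      _ = ∑ ω ∈ (Finset.univ.filter fun ω => 𝒜 ω ∧ v ∈ ω).image (fun ω => ω.erase v),
            p * pw (fun _ => p) ω := by rw [Finset.sum_image hinj]
      _ ≤ _ := by
          refine Finset.sum_le_sum_of_subset_of_nonneg ?_ fun ω _ _ =>
            mul_nonneg hp.le (pw_nonneg hpI ω)
          intro ω hω
          obtain ⟨ω', hω', rfl⟩ := Finset.mem_image.1 hω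
          have := (Finset.mem_filter.1 hω').2
          simp [hcl _ this.1]
  have h2 : ∑ ω with 𝒜 ω, pw (fun _ => p) ω = ∑ ω with 𝒜 ω ∧ v ∈ ω, pw (fun _ => p) ω +
      ∑ ω with 𝒜 ω ∧ v ∉ ω, pw (fun _ => p) ω := by
    rw [← Finset.sum_filter_add_sum_filter_not (Finset.univ.filter 𝒜) (fun ω => v ∈ ω),
      Finset.filter_filter, Finset.filter_filter]
  rw [h2]
  linarith

/-- A special case of the Harris inequality. -/
theorem sum_subset_le (𝒜 : Finset V → Prop) {p : ℝ} (hp : 0 < p) (hp1 : p < 1) (S : Finset V)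
    (hcl : ∀ ω, 𝒜 ω → ∀ v ∈ S, 𝒜 (ω.erase v)) :
    ∑ ω with 𝒜 ω ∧ S ⊆ ω, pw (fun _ => p) ω ≤ p ^ S.card * ∑ ω with 𝒜 ω, pw (fun _ => p) ω := by
  induction S using Finset.induction_on with
  | empty => simp
  | insert v S hv ih =>
    have h1 := sum_mem_le (fun ω => 𝒜 ω ∧ S ⊆ ω) hp hp1 v fun ω hω =>
      ⟨hcl ω hω.1 v (Finset.mem_insert_self v S), Finset.subset_erase.2 ⟨hω.2, hv⟩⟩
    have h2 := ih fun ω hω w hw => hcl ω hω w (Finset.mem_insert_of_mem hw)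
    rw [Finset.card_insert_of_notMem hv, pow_succ']
    calc ∑ ω with 𝒜 ω ∧ insert v S ⊆ ω, pw (fun _ => p) ω
        = ∑ ω with (𝒜 ω ∧ S ⊆ ω) ∧ v ∈ ω, pw (fun _ => p) ω := by
          refine Finset.sum_congr (Finset.filter_congr fun ω _ => ?_) fun _ _ => rfl
          rw [Finset.insert_subset_iff]; tauto
      _ ≤ p * ∑ ω with 𝒜 ω ∧ S ⊆ ω, pw (fun _ => p) ω := by convert h1
      _ ≤ p * (p ^ S.card * ∑ ω with 𝒜 ω, pw (fun _ => p) ω) :=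
          mul_le_mul_of_nonneg_left h2 hp.le
      _ = _ := by ring

/-- The `p`-biased measure conditioned on the event `A`. -/
def condMeasure (p : ℝ) (A : Finset V → Prop) (ω : Finset V) : ℝ :=
  (if A ω then pw (fun _ => p) ω else 0) / ∑ ω', if A ω' then pw (fun _ => p) ω' else 0

variable {p : ℝ} {A : Finset V → Prop}

theorem condMeasure_nonneg (hp : 0 < p) (hp1 : p < 1) (ω : Finset V) :
    0 ≤ condMeasure p A ω := by
  have hpI : ∀ _ : V, p ∈ Set.Icc (0 : ℝ) 1 := fun _ => ⟨hp.le, hp1.le⟩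
  have h : ∀ ω, 0 ≤ if A ω then pw (fun _ => p) ω else 0 := fun ω => by
    split_ifs
    · exact pw_nonneg hpI ω
    · exact le_rfl
  exact div_nonneg (h ω) (Finset.sum_nonneg fun ω _ => h ω)

theorem sum_ind_condMeasure_le (hp : 0 < p) (hp1 : p < 1) (hA : ∀ ω v, A ω → A (ω.erase v))
    (S : Finset V) : ∑ ω, condMeasure p A ω * ind S ω ≤ p ^ S.card := by
  have hpI : ∀ _ : V, p ∈ Set.Icc (0 : ℝ) 1 := fun _ => ⟨hp.le, hp1.le⟩
  have h := sum_subset_le A hp hp1 S fun ω hω v _ => hA ω v hω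
  have h1 : ∀ ω, condMeasure p A ω * ind S ω = (if A ω ∧ S ⊆ ω then pw (fun _ => p) ω else 0) /
      ∑ ω', if A ω' then pw (fun _ => p) ω' else 0 := by
    intro ω
    rw [condMeasure, ind]
    by_cases h1 : A ω <;> by_cases h2 : S ⊆ ω <;> simp [h1, h2]
  simp_rw [h1]
  rw [← Finset.sum_div]
  refine div_le_of_le_mul₀ (Finset.sum_nonneg fun ω _ => ?_) (by positivity) ?_
  · split_ifs
    · exact pw_nonneg hpI ω
    · exact le_rfl
  · simpa only [Finset.sum_filter] using h

theorem condE_condMeasure_le (hp : 0 < p) (hp1 : p < 1) (hA : ∀ ω v, A ω → A (ω.erase v))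
    {U : Finset V} {v : V} (hv : v ∉ U) (ω : Finset V) :
    condE (condMeasure p A) U (ind {v}) ω ≤ p := by
  have h := sum_mem_le (fun ω' => A ω' ∧ ω' ∩ U = ω ∩ U) hp hp1 v fun ω' hω' =>
    ⟨hA _ _ hω'.1, by rw [Finset.erase_inter, Finset.erase_eq_of_notMem (by simp [hv]), hω'.2]⟩
  have hν := condMeasure_nonneg (A := A) hp hp1
  refine div_le_of_le_mul₀ (Finset.sum_nonneg fun ω' _ => ?_) hp.le ?_
  · split_ifs
    · exact hν ω'
    · exact le_rfl
  · set m := ∑ ω', if A ω' then pw (fun _ => p) ω' else 0 with hm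
    have hm0 : 0 ≤ m := Finset.sum_nonneg fun ω' _ => by
      split_ifs
      · exact pw_nonneg (fun _ => ⟨hp.le, hp1.le⟩) ω'
      · exact le_rfl
    have h1 : ∀ ω', (if ω' ∩ U = ω ∩ U then condMeasure p A ω' * ind {v} ω' else 0) =
        (if (A ω' ∧ ω' ∩ U = ω ∩ U) ∧ v ∈ ω' then pw (fun _ => p) ω' else 0) / m := by
      intro ω'
      rw [condMeasure, ind, ← hm]
      by_cases h1 : A ω' <;> by_cases h2 : v ∈ ω' <;> by_cases h3 : ω' ∩ U = ω ∩ U <;>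
        simp [h1, h2, h3]
    have h2 : ∀ ω', (if ω' ∩ U = ω ∩ U then condMeasure p A ω' else 0) =
        (if A ω' ∧ ω' ∩ U = ω ∩ U then pw (fun _ => p) ω' else 0) / m := by
      intro ω'
      rw [condMeasure, ← hm]
      by_cases h1 : A ω' <;> by_cases h3 : ω' ∩ U = ω ∩ U <;> simp [h1, h3]
    simp_rw [h1, h2]
    rw [← Finset.sum_div, ← Finset.sum_div, ← mul_div_assoc]
    refine div_le_div_of_nonneg_right ?_ hm0
    simp only [Finset.sum_filter] at h
    refine (le_of_eq ?_).trans (h.trans (le_of_eq ?_))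
    · exact Finset.sum_congr rfl fun _ _ => by congr
    · exact congrArg (p * ·) (Finset.sum_congr rfl fun _ _ => by congr)

end Decreasing

section Energy

variable {V : Type*} [Fintype V] [DecidableEq V] {ν : Finset V → ℝ}

/-- There is a small set `U` such that revealing the configuration on a further set `W`
changes the conditional edge probabilities only little, in mean square. -/
theorem exists_stable_set {p κ : ℝ} (hp : 0 < p) (hκ : 0 < κ) (hν : ∀ ω, 0 ≤ ν ω)
    (hν1 : ∑ ω, ν ω = 1) (hdom : ∀ (U : Finset V) (v : V), v ∉ U → ∀ ω, condE ν U (ind {v}) ω ≤ p) :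
    ∃ U : Finset V, (U.card : ℝ) ≤ κ * Fintype.card V ∧ ∀ W : Finset V,
      ∑ v ∈ (U ∪ W)ᶜ, ∑ ω, ν ω * (condE ν U (ind {v}) ω - condE ν (U ∪ W) (ind {v}) ω) ^ 2 ≤
        p ^ 2 / κ * W.card := by
  let E : Finset V → V → ℝ := fun U v => ∑ ω, ν ω * condE ν U (ind {v}) ω ^ 2
  have hE0 : ∀ U v, 0 ≤ E U v := fun U v =>
    Finset.sum_nonneg fun ω _ => mul_nonneg (hν ω) (sq_nonneg _)
  have hE1 : ∀ U v, v ∉ U → E U v ≤ p ^ 2 := by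
    intro U v hv
    calc E U v ≤ ∑ ω, ν ω * p ^ 2 := Finset.sum_le_sum fun ω _ =>
          mul_le_mul_of_nonneg_left (pow_le_pow_left₀ (condE_nonneg hν U (ind_nonneg _) ω)
            (hdom U v hv ω) 2) (hν ω)
      _ = p ^ 2 := by rw [← Finset.sum_mul, hν1, one_mul]
  let F : Finset V → ℝ := fun U => ∑ v ∈ Uᶜ, E U v + p ^ 2 * U.card
  have hF0 : 0 ≤ F ∅ := by
    simp only [F]
    exact add_nonneg (Finset.sum_nonneg fun v _ => hE0 _ _) (by positivity)
  have hF1 : ∀ U, F U ≤ p ^ 2 * Fintype.card V := by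
    intro U
    have h1 : ∑ v ∈ Uᶜ, E U v ≤ ∑ v ∈ Uᶜ, p ^ 2 :=
      Finset.sum_le_sum fun v hv => hE1 U v (Finset.mem_compl.1 hv)
    rw [Finset.sum_const, nsmul_eq_mul] at h1
    have h2 : (U.card : ℝ) + (Uᶜ.card : ℝ) = Fintype.card V := by
      exact_mod_cast Finset.card_add_card_compl U
    simp only [F]
    rw [← h2]
    linarith
  obtain ⟨U, -, hU⟩ := Finset.exists_max_image (Finset.univ : Finset (Finset V))
    (fun U => F U - p ^ 2 / κ * U.card) Finset.univ_nonempty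
  refine ⟨U, ?_, fun W => ?_⟩
  · have h1 := hU ∅ (Finset.mem_univ _)
    simp only [Finset.card_empty, Nat.cast_zero, mul_zero, sub_zero] at h1
    have h2 : p ^ 2 / κ * U.card ≤ p ^ 2 * Fintype.card V := by linarith [hF1 U]
    rw [div_mul_eq_mul_div, div_le_iff₀ hκ] at h2
    have h3 : p ^ 2 * (U.card : ℝ) ≤ p ^ 2 * (κ * Fintype.card V) := by linarith
    exact le_of_mul_le_mul_left h3 (by positivity)
  · have h1 := hU (U ∪ W) (Finset.mem_univ _)
    have h2 : ∀ v, ∑ ω, ν ω * (condE ν U (ind {v}) ω - condE ν (U ∪ W) (ind {v}) ω) ^ 2 =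
        E (U ∪ W) v - E U v := fun v => sum_sq_condE_sub hν Finset.subset_union_left _
    simp_rw [h2]
    rw [Finset.sum_sub_distrib]
    have h3 : ∑ v ∈ Uᶜ, E U v ≤ ∑ v ∈ (U ∪ W)ᶜ, E U v + p ^ 2 * ((U ∪ W).card - U.card : ℝ) := by
      have hsub : (U ∪ W)ᶜ ⊆ Uᶜ := Finset.compl_subset_compl.2 Finset.subset_union_left
      rw [← Finset.sum_sdiff hsub]
      have h4 : ∑ v ∈ Uᶜ \ (U ∪ W)ᶜ, E U v ≤ ∑ v ∈ Uᶜ \ (U ∪ W)ᶜ, p ^ 2 :=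
        Finset.sum_le_sum fun v hv => hE1 U v (by simp at hv; exact hv.1)
      have h5 : ((Uᶜ \ (U ∪ W)ᶜ).card : ℝ) = (U ∪ W).card - U.card := by
        have h6 := Finset.card_sdiff_add_card_eq_card hsub
        have h7 := Finset.card_add_card_compl U
        have h8 := Finset.card_add_card_compl (U ∪ W)
        rw [eq_sub_iff_add_eq]
        exact_mod_cast (by omega)
      rw [Finset.sum_const, nsmul_eq_mul, h5] at h4
      linarith
    have h4 : p ^ 2 / κ * ((U ∪ W).card - U.card : ℝ) ≤ p ^ 2 / κ * W.card := by
      refine mul_le_mul_of_nonneg_left ?_ (by positivity)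
      have : ((U ∪ W).card : ℝ) ≤ U.card + W.card := by exact_mod_cast Finset.card_union_le U W
      linarith
    simp only [F] at h1
    linarith

theorem condE_mul_sub_le (hν : ∀ ω, 0 ≤ ν ω) {U W B : Finset V} (hB : B ⊆ W) (v : V)
    (ω : Finset V) :
    condE ν U (ind {v}) ω * condE ν U (ind B) ω - condE ν U (ind (insert v B)) ω ≤
      condE ν U (fun ω' => |condE ν U (ind {v}) ω' - condE ν (U ∪ W) (ind {v}) ω'| * ind B ω')
        ω := by
  have h1 := condE_mul_left (ν := ν) (dependsOnly_condE (ν := ν) U (ind {v})) (ind B) ω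
  have h2 := condE_mul_condE hν (Finset.subset_union_left (s₁ := U) (s₂ := W))
    (dependsOnly_ind (hB.trans Finset.subset_union_right)) (ind {v}) ω
  have h3 : (fun ω' => ind B ω' * ind {v} ω') = ind (insert v B) := by
    funext ω'
    rw [ind_mul_ind, Finset.union_comm]
    rfl
  rw [h3] at h2
  rw [← h1, ← h2, ← condE_sub]
  refine condE_mono hν U (fun ω' _ => ?_) ω
  rw [mul_comm (ind B ω'), ← sub_mul]
  exact mul_le_mul_of_nonneg_right (le_abs_self _) (ind_nonneg _ _)

end Energy

section Profile

variable {V : Type*} [Fintype V] [DecidableEq V] {ν : Finset V → ℝ}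

theorem prod_mul_sub_eq_sum (q P : ℕ → ℝ) (r : ℕ) :
    (∏ j ∈ Finset.range r, q j) * P 0 - P r =
      ∑ i ∈ Finset.range r, (∏ j ∈ Finset.Ico (i + 1) r, q j) * (q i * P i - P (i + 1)) := by
  have h := Finset.sum_range_sub' (fun i => (∏ j ∈ Finset.Ico i r, q j) * P i) r
  simp only [Finset.Ico_self, Finset.prod_empty, one_mul, ← Finset.range_eq_Ico] at h
  rw [← h]
  refine Finset.sum_congr rfl fun i hi => ?_
  rw [Finset.prod_eq_prod_Ico_succ_bot (Finset.mem_range.1 hi)]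
  ring

/-- The defect of multiplicativity of conditional probabilities is dominated by a function of
small mean. -/
theorem exists_defect_bound {ι : Type*} [Fintype ι] {p κ δ K l : ℝ} {i : ℕ} {U : Finset V}
    (hδ : 0 ≤ δ) (hδ1 : δ ≤ 1) (hl : 0 < l) (hν : ∀ ω, 0 ≤ ν ω)
    (hdom : ∀ S : Finset V, ∑ ω, ν ω * ind S ω ≤ p ^ S.card)
    (hU : ∀ W : Finset V,
      ∑ v ∈ (U ∪ W)ᶜ, ∑ ω, ν ω * (condE ν U (ind {v}) ω - condE ν (U ∪ W) (ind {v}) ω) ^ 2 ≤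
        p ^ 2 / κ * W.card)
    (v : ι → V) (B : ι → Finset V) (hvB : ∀ φ, v φ ∉ B φ) (hB : ∀ φ, (B φ).card = i)
    (g : ι → Finset V → ℝ) (hg : ∀ φ, DependsOnly U (g φ)) (hg0 : ∀ φ ω, 0 ≤ g φ ω)
    (hgK : ∀ φ ω, g φ ω ≤ K) (hgU : ∀ φ, v φ ∈ U → ∀ ω, g φ ω = 0) :
    ∃ S : Finset V → ℝ, (∀ ω, 0 ≤ S ω) ∧
      (∀ ω, δ ^ i * (1 - δ) * ∑ φ, g φ ω * (condE ν U (ind {v φ}) ω * condE ν U (ind (B φ)) ω -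
        condE ν U (ind (insert (v φ) (B φ))) ω) ≤ S ω) ∧
      ∑ ω, ν ω * S ω ≤ l / 2 * (p ^ 2 / κ * (δ * Fintype.card V)) +
        K ^ 2 / (2 * l) * ∑ φ, ∑ φ', if v φ = v φ' then (δ * p) ^ (B φ ∪ B φ').card else 0 := by
  have hδI : ∀ _ : V, δ ∈ Set.Icc (0 : ℝ) 1 := fun _ => ⟨hδ, hδ1⟩
  let Δ : Finset V → V → Finset V → ℝ := fun W v ω =>
    condE ν U (ind {v}) ω - condE ν (U ∪ W) (ind {v}) ω
  let τ : ι → Finset V → ℝ := fun φ W => if B φ ⊆ W ∧ v φ ∉ W then 1 else 0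
  have hτ0 : ∀ φ W, 0 ≤ τ φ W := fun φ W => by
    simp only [τ]; split_ifs <;> norm_num
  let R : Finset V → Finset V → ℝ := fun W ω =>
    ∑ φ, (τ φ W * g φ ω) * (|Δ W (v φ) ω| * ind (B φ) ω)
  have hR0 : ∀ W ω, 0 ≤ R W ω := fun W ω => Finset.sum_nonneg fun φ _ =>
    mul_nonneg (mul_nonneg (hτ0 φ W) (hg0 φ ω)) (mul_nonneg (abs_nonneg _) (ind_nonneg _ _))
  refine ⟨fun ω => ∑ W, pw (fun _ => δ) W * condE ν U (R W) ω, fun ω => ?_, fun ω => ?_, ?_⟩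
  · exact Finset.sum_nonneg fun W _ =>
      mul_nonneg (pw_nonneg hδI W) (condE_nonneg hν U (hR0 W) ω)
  · have h1 : ∀ φ, ∑ W, pw (fun _ => δ) W * τ φ W = δ ^ i * (1 - δ) := by
      intro φ
      simp only [τ]
      rw [sum_pw_subset_notMem _ _ (hvB φ), Finset.prod_const, hB]
    rw [Finset.mul_sum]
    conv_lhs => enter [2, φ]; rw [← h1 φ, Finset.sum_mul]
    rw [Finset.sum_comm]
    refine Finset.sum_le_sum fun W _ => ?_
    simp_rw [mul_assoc]
    rw [← Finset.mul_sum]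
    refine mul_le_mul_of_nonneg_left ?_ (pw_nonneg hδI W)
    simp only [R]
    rw [condE_sum]
    refine Finset.sum_le_sum fun φ _ => ?_
    have hd : DependsOnly U (fun ω => τ φ W * g φ ω) := fun a b hab => by
      change τ φ W * g φ a = τ φ W * g φ b
      rw [hg φ a b hab]
    rw [condE_mul_left hd, ← mul_assoc]
    by_cases hφ : B φ ⊆ W ∧ v φ ∉ W
    · exact mul_le_mul_of_nonneg_left (condE_mul_sub_le hν hφ.1 _ _)
        (mul_nonneg (hτ0 φ W) (hg0 φ ω))
    · simp [τ, hφ]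
  · let Z : Finset V → Finset V → V → ℝ := fun W ω u =>
      ∑ φ, if v φ = u then K * (ind (B φ) W * ind (B φ) ω) else 0
    have hRZ : ∀ W ω, R W ω ≤ l / 2 * ∑ u ∈ (U ∪ W)ᶜ, Δ W u ω ^ 2 +
        1 / (2 * l) * ∑ u, Z W ω u ^ 2 := by
      intro W ω
      have h1 : R W ω ≤ ∑ u ∈ (U ∪ W)ᶜ, |Δ W u ω| * Z W ω u := by
        simp only [Z, Finset.mul_sum]
        rw [Finset.sum_comm]
        refine Finset.sum_le_sum fun φ _ => ?_
        have hK : 0 ≤ K := (hg0 φ ω).trans (hgK φ ω)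
        have hnn : ∀ u, 0 ≤ |Δ W u ω| * (if v φ = u then K * (ind (B φ) W * ind (B φ) ω) else 0) :=
          fun u => mul_nonneg (abs_nonneg _) (by
            split_ifs
            · exact mul_nonneg hK (mul_nonneg (ind_nonneg _ _) (ind_nonneg _ _))
            · exact le_rfl)
        by_cases h : (B φ ⊆ W ∧ v φ ∉ W) ∧ v φ ∉ U
        · have hmem : v φ ∈ (U ∪ W)ᶜ := by simp [h.2, h.1.2]
          refine le_trans ?_ (Finset.single_le_sum (fun u _ => hnn u) hmem)
          have hBW : ind (B φ) W = 1 := if_pos h.1.1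
          have hτ : τ φ W = 1 := if_pos h.1
          rw [if_pos rfl, hτ, hBW, one_mul, one_mul]
          have := mul_le_mul_of_nonneg_right (hgK φ ω)
            (mul_nonneg (abs_nonneg (Δ W (v φ) ω)) (ind_nonneg (B φ) ω))
          linarith
        · have : τ φ W * g φ ω = 0 := by
            by_cases h' : B φ ⊆ W ∧ v φ ∉ W
            · rw [hgU φ (by by_contra h2; exact h ⟨h', h2⟩), mul_zero]
            · simp [τ, h']
          rw [this, zero_mul]
          exact Finset.sum_nonneg fun u _ => hnn u
      have h2 : ∑ u ∈ (U ∪ W)ᶜ, Z W ω u ^ 2 ≤ ∑ u, Z W ω u ^ 2 :=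
        Finset.sum_le_sum_of_subset_of_nonneg (Finset.subset_univ _) fun _ _ _ => sq_nonneg _
      have h3 : ∑ u ∈ (U ∪ W)ᶜ, |Δ W u ω| * Z W ω u ≤
          l / 2 * ∑ u ∈ (U ∪ W)ᶜ, Δ W u ω ^ 2 + 1 / (2 * l) * ∑ u ∈ (U ∪ W)ᶜ, Z W ω u ^ 2 := by
        rw [Finset.mul_sum, Finset.mul_sum, ← Finset.sum_add_distrib]
        refine Finset.sum_le_sum fun u _ => ?_
        have h4 : l / 2 * Δ W u ω ^ 2 + 1 / (2 * l) * Z W ω u ^ 2 - |Δ W u ω| * Z W ω u =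
            1 / (2 * l) * (l * |Δ W u ω| - Z W ω u) ^ 2 := by
          rw [← sq_abs (Δ W u ω)]; field_simp; ring
        have h5 : 0 ≤ 1 / (2 * l) * (l * |Δ W u ω| - Z W ω u) ^ 2 := by positivity
        linarith
      have h6 : 1 / (2 * l) * ∑ u ∈ (U ∪ W)ᶜ, Z W ω u ^ 2 ≤ 1 / (2 * l) * ∑ u, Z W ω u ^ 2 :=
        mul_le_mul_of_nonneg_left h2 (by positivity)
      linarith
    have hZ : ∀ W ω, ∑ u, Z W ω u ^ 2 = ∑ φ, ∑ φ', if v φ = v φ' then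
        K ^ 2 * (ind (B φ ∪ B φ') W * ind (B φ ∪ B φ') ω) else 0 := by
      intro W ω
      simp only [Z, sq (∑ φ, _), Finset.sum_mul_sum]
      rw [Finset.sum_comm]
      refine Finset.sum_congr rfl fun φ _ => ?_
      rw [Finset.sum_comm]
      refine Finset.sum_congr rfl fun φ' _ => ?_
      rw [Finset.sum_eq_single (v φ)]
      · rw [if_pos rfl]
        by_cases h : v φ' = v φ
        · rw [if_pos h, if_pos h.symm, ← ind_mul_ind, ← ind_mul_ind]; ring
        · rw [if_neg h, if_neg (Ne.symm h), mul_zero]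
      · intro u _ hu
        rw [if_neg (Ne.symm hu), zero_mul]
      · simp
    have hSR : ∑ ω, ν ω * ∑ W, pw (fun _ => δ) W * condE ν U (R W) ω =
        ∑ W, pw (fun _ => δ) W * ∑ ω, ν ω * R W ω := by
      simp_rw [Finset.mul_sum]
      rw [Finset.sum_comm]
      refine Finset.sum_congr rfl fun W _ => ?_
      rw [← Finset.mul_sum, ← sum_condE hν U (R W), Finset.mul_sum]
      exact Finset.sum_congr rfl fun ω _ => by ring
    rw [hSR]
    have h1 : ∑ W, pw (fun _ => δ) W * ∑ ω, ν ω * R W ω ≤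
        ∑ W, pw (fun _ => δ) W * ∑ ω, ν ω * (l / 2 * ∑ u ∈ (U ∪ W)ᶜ, Δ W u ω ^ 2 +
        1 / (2 * l) * ∑ u, Z W ω u ^ 2) :=
      Finset.sum_le_sum fun W _ => mul_le_mul_of_nonneg_left
        (Finset.sum_le_sum fun ω _ => mul_le_mul_of_nonneg_left (hRZ W ω) (hν ω)) (pw_nonneg hδI W)
    refine h1.trans ?_
    simp_rw [mul_add, Finset.sum_add_distrib, mul_add, Finset.sum_add_distrib]
    refine add_le_add ?_ ?_
    · calc _ = l / 2 * ∑ W, pw (fun _ => δ) W * ∑ u ∈ (U ∪ W)ᶜ, ∑ ω, ν ω * Δ W u ω ^ 2 := by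
            simp_rw [Finset.mul_sum]
            refine Finset.sum_congr rfl fun W _ => ?_
            rw [Finset.sum_comm]
            exact Finset.sum_congr rfl fun _ _ => Finset.sum_congr rfl fun _ _ => by ring
        _ ≤ l / 2 * ∑ W, pw (fun _ => δ) W * (p ^ 2 / κ * (W.card : ℝ)) :=
            mul_le_mul_of_nonneg_left (Finset.sum_le_sum fun W _ =>
              mul_le_mul_of_nonneg_left (hU W) (pw_nonneg hδI W)) (by positivity)
        _ = _ := by
            have h2 : ∑ W : Finset V, pw (fun _ => δ) W * (p ^ 2 / κ * (W.card : ℝ)) =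
                p ^ 2 / κ * ∑ W : Finset V, pw (fun _ => δ) W * (W.card : ℝ) := by
              rw [Finset.mul_sum]
              exact Finset.sum_congr rfl fun _ _ => by ring
            rw [h2, sum_pw_card, Finset.sum_const, nsmul_eq_mul, Finset.card_univ]
            ring
    · simp_rw [hZ]
      calc _ = ∑ φ, ∑ φ', if v φ = v φ' then K ^ 2 / (2 * l) *
            ((∑ W, pw (fun _ => δ) W * ind (B φ ∪ B φ') W) *
              ∑ ω, ν ω * ind (B φ ∪ B φ') ω) else 0 := by
            simp_rw [Finset.mul_sum]
            rw [Finset.sum_congr rfl fun _ _ => Finset.sum_comm, Finset.sum_comm]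
            refine Finset.sum_congr rfl fun φ _ => ?_
            rw [Finset.sum_congr rfl fun _ _ => Finset.sum_comm, Finset.sum_comm]
            refine Finset.sum_congr rfl fun φ' _ => ?_
            split_ifs
            · rw [Finset.sum_comm]
              refine Finset.sum_congr rfl fun ω _ => ?_
              rw [Finset.sum_mul, Finset.mul_sum]
              refine Finset.sum_congr rfl fun W _ => ?_
              ring
            · simp
        _ ≤ _ := by
            rw [Finset.mul_sum]
            refine Finset.sum_le_sum fun φ _ => ?_
            rw [Finset.mul_sum]
            refine Finset.sum_le_sum fun φ' _ => ?_
            split_ifs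
            · refine mul_le_mul_of_nonneg_left ?_ (by positivity)
              simp only [ind]
              rw [sum_pw_subset, Finset.prod_const, mul_pow]
              exact mul_le_mul_of_nonneg_left (hdom _) (by positivity)
            · simp

end Profile

section Profile

variable {V : Type*} [Fintype V] [DecidableEq V] {ν : Finset V → ℝ}
  {ι : Type*} [Fintype ι] {c : ι → ℕ → V} {r : ℕ} {U : Finset V} {p κ δ t C : ℝ}

/-- The total defect of multiplicativity of conditional probabilities, over the sets
`{c φ 0, …, c φ (r - 1)}` that avoid `U`, is dominated by a function of small mean. -/
theorem exists_total_defect_bound (hp : 0 < p) (hκ : 0 < κ) (ht : 0 < t)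
    (hδ : 0 < δ) (hδ1 : δ ≤ 1 / 2) (hι : 0 < Fintype.card ι)
    (hinj : ∀ φ, Set.InjOn (c φ) (Finset.range r : Set ℕ))
    (hν : ∀ ω, 0 ≤ ν ω) (hdom : ∀ S : Finset V, ∑ ω, ν ω * ind S ω ≤ p ^ S.card)
    (hdomU : ∀ v ∉ U, ∀ ω, condE ν U (ind {v}) ω ≤ p)
    (hU : ∀ W : Finset V,
      ∑ v ∈ (U ∪ W)ᶜ, ∑ ω, ν ω * (condE ν U (ind {v}) ω - condE ν (U ∪ W) (ind {v}) ω) ^ 2 ≤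
        p ^ 2 / κ * W.card)
    (hpair : ∀ i < r, Fintype.card V * ∑ φ, ∑ φ', (if c φ i = c φ' i then
      (δ * p) ^ ((Finset.range i).image (c φ) ∪ (Finset.range i).image (c φ')).card else 0) ≤
        C * (δ * p) ^ (2 * i) * (Fintype.card ι : ℝ) ^ 2) :
    ∃ S : Finset V → ℝ, (∀ ω, 0 ≤ S ω) ∧
      (∀ ω, ν ω ≠ 0 → ∑ φ, (if ∀ j < r, c φ j ∉ U then
        (∏ j ∈ Finset.range r, condE ν U (ind {c φ j}) ω) -
          condE ν U (ind ((Finset.range r).image (c φ))) ω else 0) ≤ S ω) ∧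
      ∑ ω, ν ω * S ω ≤ r * (Fintype.card ι * p ^ r * (t * δ / κ + C / t)) := by
  set D : ℝ := (Fintype.card ι : ℝ)
  set N : ℝ := (Fintype.card V : ℝ)
  let q : V → Finset V → ℝ := fun v => condE ν U (ind {v})
  have hq0 : ∀ v ω, 0 ≤ q v ω := fun v => condE_nonneg hν U (ind_nonneg _)
  let B : ℕ → ι → Finset V := fun i φ => (Finset.range i).image (c φ)
  let g : ℕ → ι → Finset V → ℝ := fun i φ ω =>
    if ∀ j < r, c φ j ∉ U then ∏ j ∈ Finset.Ico (i + 1) r, q (c φ j) ω else 0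
  have hstep : ∀ i, ∃ T : Finset V → ℝ, i < r → (∀ ω, 0 ≤ T ω) ∧
      (∀ ω, ∑ φ, g i φ ω * (q (c φ i) ω * condE ν U (ind (B i φ)) ω -
        condE ν U (ind (B (i + 1) φ)) ω) ≤ T ω) ∧
      ∑ ω, ν ω * T ω ≤ D * p ^ r * (t * δ / κ + C / t) := by
    intro i
    by_cases hi : i < r
    swap
    · exact ⟨0, fun h => absurd h hi⟩
    obtain ⟨φ₀⟩ := Fintype.card_pos_iff.1 hι
    have hN : 0 < N := Nat.cast_pos.2 (Fintype.card_pos_iff.2 ⟨c φ₀ 0⟩)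
    have hl : 0 < t * D * p ^ r * δ ^ i / (N * p ^ 2) := by positivity
    obtain ⟨S, hS0, hS1, hS2⟩ := exists_defect_bound (K := p ^ (r - 1 - i)) (i := i) hδ.le
      (by linarith) hl hν hdom hU (fun φ => c φ i) (B i) (fun φ h => by
        obtain ⟨j, hj, hji⟩ := Finset.mem_image.1 h
        have hj := Finset.mem_range.1 hj
        have := hinj φ (by simpa using hj.trans hi) (by simpa using hi) hji
        omega) (fun φ => by
        rw [Finset.card_image_of_injOn, Finset.card_range]
        exact (hinj φ).mono fun j hj => by
          simp only [Finset.coe_range, Set.mem_Iio] at hj ⊢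
          omega) (g i) (fun φ a b hab => by
        have : ∀ v, q v a = q v b := fun v => dependsOnly_condE _ _ a b hab
        simp only [g, this]) (fun φ ω => by
        simp only [g]
        split_ifs
        · exact Finset.prod_nonneg fun j _ => hq0 _ _
        · exact le_rfl) (fun φ ω => by
        simp only [g]
        split_ifs with h
        · calc _ ≤ ∏ j ∈ Finset.Ico (i + 1) r, p := Finset.prod_le_prod (fun j _ => hq0 _ _)
                fun j hj => hdomU _ (h j (Finset.mem_Ico.1 hj).2) ω
            _ = _ := by rw [Finset.prod_const, Nat.card_Ico]; congr 1; omega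
        · positivity) (fun φ h ω => if_neg fun h' => h' i hi h)
    have hd : 0 < δ ^ i * (1 - δ) := by
      have : 0 < 1 - δ := by linarith
      positivity
    refine ⟨fun ω => S ω / (δ ^ i * (1 - δ)), fun _ => ⟨fun ω => div_nonneg (hS0 ω) hd.le,
      fun ω => ?_, ?_⟩⟩
    · rw [le_div_iff₀ hd, mul_comm]
      have hB : ∀ φ, B (i + 1) φ = insert (c φ i) (B i φ) := fun φ => by
        simp only [B, Finset.range_add_one, Finset.image_insert]
      simp only [hB]
      exact hS1 ω
    · have h1 : ∑ ω, ν ω * (S ω / (δ ^ i * (1 - δ))) =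
          (∑ ω, ν ω * S ω) / (δ ^ i * (1 - δ)) := by
        rw [Finset.sum_div]
        exact Finset.sum_congr rfl fun ω _ => by ring
      rw [h1, div_le_iff₀ hd]
      have h2 := hpair i hi
      obtain ⟨k, rfl⟩ : ∃ k, r = i + 1 + k := ⟨r - 1 - i, by omega⟩
      have hk : i + 1 + k - 1 - i = k := by omega
      rw [hk] at hS2
      have h3 : (p ^ k) ^ 2 / (2 * (t * D * p ^ (i + 1 + k) * δ ^ i / (N * p ^ 2))) *
          ∑ φ, ∑ φ', (if c φ i = c φ' i then (δ * p) ^ (B i φ ∪ B i φ').card else 0) ≤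
          C * D * p ^ (i + 1 + k) * δ ^ i / (2 * t) := by
        calc _ = (p ^ k) ^ 2 * p ^ 2 / (2 * (t * D * p ^ (i + 1 + k) * δ ^ i)) *
              (N * ∑ φ, ∑ φ', (if c φ i = c φ' i then
                (δ * p) ^ (B i φ ∪ B i φ').card else 0)) := by field_simp
          _ ≤ (p ^ k) ^ 2 * p ^ 2 / (2 * (t * D * p ^ (i + 1 + k) * δ ^ i)) *
              (C * (δ * p) ^ (2 * i) * D ^ 2) := mul_le_mul_of_nonneg_left h2 (by positivity)
          _ = _ := by
            rw [mul_pow, pow_mul', pow_mul', pow_add p (i + 1) k, pow_succ p i]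
            field_simp
      have hC : 0 ≤ C := by
        have h4 : 0 ≤ C * (δ * p) ^ (2 * i) * D ^ 2 := h2.trans' (mul_nonneg hN.le
          (Finset.sum_nonneg fun φ _ => Finset.sum_nonneg fun φ' _ => by
            split_ifs <;> positivity))
        rw [mul_assoc] at h4
        exact nonneg_of_mul_nonneg_left h4 (by positivity)
      calc _ ≤ _ := hS2
        _ ≤ t * D * p ^ (i + 1 + k) * δ ^ i / (N * p ^ 2) / 2 * (p ^ 2 / κ * (δ * N)) +
            C * D * p ^ (i + 1 + k) * δ ^ i / (2 * t) := by gcongr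
        _ = D * p ^ (i + 1 + k) * (t * δ / κ + C / t) * (δ ^ i * (1 / 2)) := by
            field_simp
        _ ≤ _ := by
            have : 1 / 2 ≤ 1 - δ := by linarith
            gcongr
  choose T hT using hstep
  refine ⟨fun ω => ∑ i ∈ Finset.range r, T i ω,
    fun ω => Finset.sum_nonneg fun i hi => (hT i (Finset.mem_range.1 hi)).1 ω, fun ω hω => ?_, ?_⟩
  · refine le_trans (le_of_eq ?_)
      (Finset.sum_le_sum fun i hi => (hT i (Finset.mem_range.1 hi)).2.1 ω)
    rw [Finset.sum_comm]
    refine Finset.sum_congr rfl fun φ _ => ?_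
    split_ifs with h
    · have h1 := prod_mul_sub_eq_sum (fun j => q (c φ j) ω) (fun j => condE ν U (ind (B j φ)) ω) r
      have h0 : condE ν U (ind (B 0 φ)) ω = 1 := by
        have : ind (B 0 φ) = fun _ => 1 := funext fun ω => by simp [B, ind]
        rw [this, condE_const hν U 1 hω]
      rw [h0, mul_one] at h1
      refine h1.trans (Finset.sum_congr rfl fun i _ => ?_)
      simp only [g, if_pos h]
    · exact (Finset.sum_eq_zero fun i _ => by simp only [g, if_neg h, zero_mul]).symm
  · simp_rw [Finset.mul_sum]
    rw [Finset.sum_comm]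
    refine (Finset.sum_le_sum fun i hi => (hT i (Finset.mem_range.1 hi)).2.2).trans (le_of_eq ?_)
    rw [Finset.sum_const, Finset.card_range, nsmul_eq_mul]

end Profile

section Profile

variable {V : Type*} [Fintype V] [DecidableEq V] {ν : Finset V → ℝ}
  {ι : Type*} [Fintype ι] {c : ι → ℕ → V} {r : ℕ}

theorem card_hit_le {C : ℝ} {U : Finset V}
    (hdeg : ∀ i < r, ∀ v, (Fintype.card V : ℝ) * (Finset.univ.filter fun φ => c φ i = v).card ≤
      C * Fintype.card ι) :
    (Fintype.card V : ℝ) * (Finset.univ.filter fun φ => ¬ ∀ j < r, c φ j ∉ U).card ≤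
      r * (U.card * (C * Fintype.card ι)) := by
  have h1 : (Finset.univ.filter fun φ => ¬ ∀ j < r, c φ j ∉ U) ⊆
      (Finset.range r).biUnion fun j => U.biUnion fun v => Finset.univ.filter fun φ => c φ j = v := by
    intro φ hφ
    simp only [Finset.mem_filter, Finset.mem_univ, true_and, not_forall, not_not] at hφ
    obtain ⟨j, hj, hU⟩ := hφ
    simp only [Finset.mem_biUnion, Finset.mem_range, Finset.mem_filter, Finset.mem_univ, true_and]
    exact ⟨j, hj, _, hU, rfl⟩
  have h2 : ((Finset.univ.filter fun φ => ¬ ∀ j < r, c φ j ∉ U).card : ℝ) ≤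
      ∑ j ∈ Finset.range r, ∑ v ∈ U, ((Finset.univ.filter fun φ => c φ j = v).card : ℝ) := by
    exact_mod_cast (Finset.card_le_card h1).trans (Finset.card_biUnion_le.trans
      (Finset.sum_le_sum fun j _ => Finset.card_biUnion_le))
  refine (mul_le_mul_of_nonneg_left h2 (Nat.cast_nonneg _)).trans ?_
  simp_rw [Finset.mul_sum]
  calc _ ≤ ∑ j ∈ Finset.range r, ∑ v ∈ U, C * (Fintype.card ι : ℝ) :=
        Finset.sum_le_sum fun j hj => Finset.sum_le_sum fun v _ =>
          hdeg j (Finset.mem_range.1 hj) v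
    _ = _ := by simp

/-- A measure of bounded density with few expected copies yields a product measure of bounded
entropy with few expected copies. -/
theorem exists_profile {p ε C δ η M m : ℝ} (hp : 0 < p) (hp1 : p < 1) (hε : 0 < ε) (hε1 : ε < 1)
    (hC : 0 < C) (hr : 0 < r) (hδ : 0 < δ) (hδ1 : δ ≤ 1 / 2)
    (hδC : δ ≤ ε ^ 5 / (128 * r ^ 3 * C ^ 2)) (hι : 0 < Fintype.card ι)
    (hinj : ∀ φ, Set.InjOn (c φ) (Finset.range r : Set ℕ))
    (hν : ∀ ω, 0 ≤ ν ω) (hν1 : ∑ ω, ν ω = 1)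
    (hM : 0 < M) (hνM : ∀ ω, ν ω ≤ M * pw (fun _ => p) ω)
    (hdom : ∀ S : Finset V, ∑ ω, ν ω * ind S ω ≤ p ^ S.card)
    (hdomU : ∀ U : Finset V, ∀ v ∉ U, ∀ ω, condE ν U (ind {v}) ω ≤ p)
    (hdeg : ∀ i < r, ∀ v, (Fintype.card V : ℝ) * (Finset.univ.filter fun φ => c φ i = v).card ≤
      C * Fintype.card ι)
    (hpair : ∀ i < r, Fintype.card V * ∑ φ, ∑ φ', (if c φ i = c φ' i then
      (δ * p) ^ ((Finset.range i).image (c φ) ∪ (Finset.range i).image (c φ')).card else 0) ≤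
        C * (δ * p) ^ (2 * i) * (Fintype.card ι : ℝ) ^ 2)
    (hcount : ∀ ω, ν ω ≠ 0 → ∑ φ, ind ((Finset.range r).image (c φ)) ω ≤
      η * (Fintype.card ι * p ^ r))
    (hm : Real.log M ≤ m) (hm0 : 0 < m) :
    ∃ q : V → ℝ, (∀ v, q v ∈ Set.Icc (0 : ℝ) 1) ∧
      ∑ φ, ∏ j ∈ Finset.range r, q (c φ j) ≤ (η + ε) * (Fintype.card ι * p ^ r) ∧
      (1 - ε) * ∑ v, ip p (q v) ≤ m := by
  have hN : (0 : ℝ) < Fintype.card V := by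
    obtain ⟨φ₀⟩ := Fintype.card_pos_iff.1 hι
    exact Nat.cast_pos.2 (Fintype.card_pos_iff.2 ⟨c φ₀ 0⟩)
  have hκ : 0 < ε / (2 * r * C) := by positivity
  have ht : 0 < 8 * r * C / ε ^ 2 := by positivity
  obtain ⟨U, hUc, hU⟩ := exists_stable_set hp hκ hν hν1 hdomU
  obtain ⟨S, hS0, hS1, hS2⟩ := exists_total_defect_bound hp hκ ht hδ hδ1 hι hinj hν hdom
    (hdomU U) hU hpair
  set E : ℝ := Fintype.card ι * p ^ r with hE
  have hE0 : 0 < E := by positivity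
  have hS3 : ∑ ω, ν ω * S ω ≤ ε ^ 2 / 4 * E := by
    refine hS2.trans ?_
    have h1 : 8 * r * C / ε ^ 2 * δ / (ε / (2 * r * C)) ≤ ε ^ 2 / (8 * r) := by
      calc _ = 16 * r ^ 2 * C ^ 2 / ε ^ 3 * δ := by field_simp; ring
        _ ≤ 16 * r ^ 2 * C ^ 2 / ε ^ 3 * (ε ^ 5 / (128 * r ^ 3 * C ^ 2)) := by gcongr
        _ = _ := by field_simp; norm_num
    calc (r : ℝ) * (E * (8 * r * C / ε ^ 2 * δ / (ε / (2 * r * C)) + C / (8 * r * C / ε ^ 2)))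
        ≤ r * (E * (ε ^ 2 / (8 * r) + C / (8 * r * C / ε ^ 2))) := by gcongr
      _ = _ := by field_simp; norm_num
  let q : V → Finset V → ℝ := fun v => condE ν U (ind {v})
  have hq0 : ∀ v ω, 0 ≤ q v ω := fun v => condE_nonneg hν U (ind_nonneg _)
  have hq1 : ∀ v ω, q v ω ≤ 1 := fun v => condE_ind_le_one hν U _
  let f : Finset V → ℝ := fun ω => ∑ v ∈ Uᶜ, ip p (q v ω)
  have hf0 : ∀ ω, 0 ≤ f ω := fun ω => Finset.sum_nonneg fun v _ =>
    ip_nonneg hp hp1 ⟨hq0 v ω, hq1 v ω⟩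
  have hf : ∑ ω, ν ω * f ω ≤ m := (sum_ip_condE_le hp hp1 hν hν1 hM hνM U).trans hm
  obtain ⟨ω, hω, hlt⟩ : ∃ ω, ν ω ≠ 0 ∧ (1 - ε) * f ω / m + S ω / (ε / 2 * E) < 1 := by
    by_contra! h
    have h1 : 1 ≤ ∑ ω, ν ω * ((1 - ε) * f ω / m + S ω / (ε / 2 * E)) := by
      refine hν1.symm.le.trans (Finset.sum_le_sum fun ω _ => ?_)
      by_cases h0 : ν ω = 0
      · simp [h0]
      · exact le_mul_of_one_le_right (hν ω) (h ω h0)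
    have h2 : ∑ ω, ν ω * ((1 - ε) * f ω / m + S ω / (ε / 2 * E)) =
        (1 - ε) / m * ∑ ω, ν ω * f ω + (∑ ω, ν ω * S ω) / (ε / 2 * E) := by
      rw [Finset.mul_sum, Finset.sum_div, ← Finset.sum_add_distrib]
      exact Finset.sum_congr rfl fun ω _ => by ring
    have h3 : (1 - ε) / m * ∑ ω, ν ω * f ω ≤ 1 - ε := by
      calc _ ≤ (1 - ε) / m * m := mul_le_mul_of_nonneg_left hf (div_nonneg (by linarith) hm0.le)
        _ = _ := by field_simp
    have h4 : (∑ ω, ν ω * S ω) / (ε / 2 * E) ≤ ε / 2 := by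
      rw [div_le_iff₀ (by positivity)]
      linarith
    linarith
  have hfm : (1 - ε) * f ω ≤ m := by
    have : 0 ≤ S ω / (ε / 2 * E) := div_nonneg (hS0 ω) (by positivity)
    rw [← div_le_one hm0]
    linarith
  have hSω : S ω ≤ ε / 2 * E := by
    have : 0 ≤ (1 - ε) * f ω / m := div_nonneg (mul_nonneg (by linarith) (hf0 ω)) hm0.le
    rw [← div_le_one (by positivity)]
    linarith
  let Q : V → ℝ := fun v => if v ∈ U then p else q v ω
  have hQ0 : ∀ v, 0 ≤ Q v := fun v => by
    simp only [Q]; split_ifs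
    · exact hp.le
    · exact hq0 v ω
  have hQp : ∀ v, Q v ≤ p := fun v => by
    simp only [Q]; split_ifs with h
    · exact le_rfl
    · exact hdomU U v h ω
  refine ⟨Q, fun v => ⟨hQ0 v, (hQp v).trans hp1.le⟩, ?_, ?_⟩
  · have h1 : ∀ φ, ∏ j ∈ Finset.range r, Q (c φ j) ≤
        (if ∀ j < r, c φ j ∉ U then (∏ j ∈ Finset.range r, condE ν U (ind {c φ j}) ω) -
          condE ν U (ind ((Finset.range r).image (c φ))) ω else 0) +
        condE ν U (ind ((Finset.range r).image (c φ))) ω +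
        p ^ r * (if ¬ ∀ j < r, c φ j ∉ U then 1 else 0) := by
      intro φ
      by_cases h : ∀ j < r, c φ j ∉ U
      · rw [if_pos h, if_neg (not_not.2 h), sub_add_cancel, mul_zero, add_zero]
        exact (Finset.prod_congr rfl fun j hj => if_neg (h j (Finset.mem_range.1 hj))).le
      · rw [if_neg h, if_pos h, zero_add, mul_one]
        have h2 : ∏ j ∈ Finset.range r, Q (c φ j) ≤ p ^ r :=
          (Finset.prod_le_prod (fun j _ => hQ0 _) fun j _ => hQp _).trans (by simp)
        exact h2.trans (le_add_of_nonneg_left (condE_nonneg hν U (ind_nonneg _) ω))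
    have h2 : ∑ φ, condE ν U (ind ((Finset.range r).image (c φ))) ω ≤ η * E := by
      rw [← condE_sum Finset.univ U (fun φ => ind ((Finset.range r).image (c φ))) ω,
        ← condE_const hν U (η * E) hω]
      exact condE_mono hν U hcount ω
    have h3 : p ^ r * ∑ φ, (if ¬ ∀ j < r, c φ j ∉ U then (1 : ℝ) else 0) ≤ ε / 2 * E := by
      rw [Finset.sum_boole]
      have h4 := card_hit_le (U := U) hdeg
      have h5 : (Fintype.card V : ℝ) * (Finset.univ.filter fun φ => ¬ ∀ j < r, c φ j ∉ U).card ≤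
          Fintype.card V * (ε / 2 * Fintype.card ι) := by
        refine h4.trans ?_
        calc _ ≤ r * (ε / (2 * r * C) * Fintype.card V * (C * Fintype.card ι)) := by gcongr
          _ = _ := by field_simp
      have h6 := le_of_mul_le_mul_left h5 hN
      calc _ ≤ p ^ r * (ε / 2 * Fintype.card ι) := mul_le_mul_of_nonneg_left h6 (by positivity)
        _ = _ := by rw [hE]; ring
    calc _ ≤ _ := Finset.sum_le_sum fun φ _ => h1 φ
      _ ≤ ε / 2 * E + η * E + ε / 2 * E := by
          rw [Finset.sum_add_distrib, Finset.sum_add_distrib, ← Finset.mul_sum]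
          exact add_le_add (add_le_add ((hS1 ω hω).trans hSω) h2) h3
      _ = _ := by ring
  · have : ∑ v, ip p (Q v) = f ω := by
      rw [← Finset.sum_add_sum_compl U, Finset.sum_eq_zero, zero_add]
      · exact Finset.sum_congr rfl fun v hv => by
          simp only [Q, if_neg (Finset.mem_compl.1 hv)]
      · intro v hv
        simp only [Q, if_pos hv, ip_self]
    rw [this]
    exact hfm

end Profile

section Embeddings

variable {α : Type*} [Fintype α] {n : ℕ}

theorem card_embedding_range_supset (S : Finset (Fin n)) :
    n ^ S.card * Fintype.card {φ : α ↪ Fin n // ∀ x ∈ S, ∃ a, φ a = x} ≤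
      Fintype.card α ^ S.card * n ^ Fintype.card α := by
  choose g hg using fun φ : {φ : α ↪ Fin n // ∀ x ∈ S, ∃ a, φ a = x} => fun x : S => φ.2 x x.2
  have hinj : Function.Injective
      fun z : (S → Fin n) × {φ : α ↪ Fin n // ∀ x ∈ S, ∃ a, φ a = x} =>
        ((g z.2, fun a => if h : z.2.1 a ∈ S then z.1 ⟨z.2.1 a, h⟩ else z.2.1 a) :
          (S → α) × (α → Fin n)) := by
    rintro ⟨y, φ⟩ ⟨y', φ'⟩ h
    obtain ⟨h1, h2⟩ := Prod.mk.inj h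
    dsimp only at h1 h2
    have h3 : ∀ x : S, φ.1 (g φ x) = x ∧ φ'.1 (g φ x) = x := fun x => ⟨hg φ x, by
      rw [h1]; exact hg φ' x⟩
    have hφ : φ = φ' := by
      refine Subtype.ext (Function.Embedding.ext fun a => ?_)
      by_cases ha : φ.1 a ∈ S
      · have : g φ ⟨φ.1 a, ha⟩ = a := φ.1.injective (h3 ⟨φ.1 a, ha⟩).1
        have h4 := (h3 ⟨φ.1 a, ha⟩).2
        rw [this] at h4
        exact h4.symm
      · by_cases ha' : φ'.1 a ∈ S
        · have : g φ ⟨φ'.1 a, ha'⟩ = a := φ'.1.injective (h3 ⟨φ'.1 a, ha'⟩).2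
          have h4 := (h3 ⟨φ'.1 a, ha'⟩).1
          rw [this] at h4
          exact h4
        · have := congrFun h2 a
          simpa [ha, ha'] using this
    subst hφ
    refine Prod.ext (funext fun x => ?_) rfl
    have := congrFun h2 (g φ x)
    have hx := hg φ x
    simp only [hx, Subtype.coe_eta, Finset.coe_mem, dif_pos] at this
    exact this
  have := Fintype.card_le_of_injective _ hinj
  simpa using this

theorem pow_le_mul_descFactorial {n h : ℕ} (hn : h ≤ n) : n ^ h ≤ h ^ h * n.descFactorial h := by
  rw [Nat.descFactorial_eq_prod_range]
  have : ∀ x : ℕ, x ^ h = ∏ _j ∈ Finset.range h, x := fun x => by simp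
  rw [this n, this h, ← Finset.prod_mul_distrib]
  refine Finset.prod_le_prod' fun j hj => ?_
  have hj := Finset.mem_range.1 hj
  obtain ⟨k, rfl⟩ : ∃ k, h = j + 1 + k := ⟨h - j - 1, by omega⟩
  obtain ⟨l, rfl⟩ : ∃ l, n = j + 1 + k + l := ⟨n - (j + 1 + k), by omega⟩
  have : j + 1 + k + l - j = 1 + k + l := by omega
  rw [this]
  nlinarith [Nat.zero_le (k * l), Nat.zero_le (j * l), Nat.zero_le (j * k)]

end Embeddings

section Enumeration

variable {α : Type*}

theorem exists_edge_enumeration [Fintype α] (H : SimpleGraph α) (hH : H.edgeSet.Nonempty) :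
    ∃ r : ℕ, 0 < r ∧ ∃ e : ℕ → Sym2 α, Set.InjOn e (Finset.range r : Set ℕ) ∧
      (∀ j, e j ∈ H.edgeSet) ∧ ∀ x ∈ H.edgeSet, ∃ j < r, e j = x := by
  obtain ⟨x₀, hx₀⟩ := hH
  let s := H.edgeSet.toFinset
  let f := s.equivFin
  have hs : ∀ x, x ∈ s ↔ x ∈ H.edgeSet := fun x => Set.mem_toFinset
  refine ⟨s.card, Finset.card_pos.2 ⟨x₀, (hs _).2 hx₀⟩,
    fun j => if h : j < s.card then (f.symm ⟨j, h⟩ : Sym2 α) else x₀, ?_, fun j => ?_, ?_⟩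
  · intro i hi j hj hij
    simp only [Finset.coe_range, Set.mem_Iio] at hi hj
    simp only [hi, hj, dif_pos] at hij
    simpa using f.symm.injective (Subtype.ext hij)
  · dsimp only
    split_ifs
    · exact (hs _).1 (f.symm _).2
    · exact hx₀
  · intro x hx
    refine ⟨f ⟨x, (hs x).2 hx⟩, (f _).2, ?_⟩
    simp

theorem le_m2 [Fintype α] [DecidableEq α] {H : SimpleGraph α} {e : ℕ → Sym2 α} {r : ℕ}
    (he : Set.InjOn e (Finset.range r : Set ℕ)) (heH : ∀ j, e j ∈ H.edgeSet)
    {T : Finset ℕ} (hT : T ⊆ Finset.range r) (hT2 : 2 ≤ T.card) :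
    ((T.card : ℝ) - 1) / ((T.biUnion fun j => (e j).toFinset).card - 2) ≤ m2 H := by
  have hF : ((e '' T).ncard : ℕ) = T.card := by
    rw [(he.mono (by exact_mod_cast hT)).ncard_image, Set.ncard_coe_finset]
  have hFH : e '' T ⊆ H.edgeSet := by
    rintro _ ⟨j, -, rfl⟩
    exact heH j
  rw [m2, if_pos (by rw [← hF] at hT2; exact hT2.trans (Set.ncard_le_ncard hFH (Set.toFinite _)))]
  refine le_csSup ?_ ⟨e '' T, hFH, by rwa [hF], ?_⟩
  · refine (Set.Finite.subset (Set.finite_range fun F : Set (Sym2 α) =>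
      ((F.ncard : ℝ) - 1) / (({v | ∃ e ∈ F, v ∈ e} : Set α).ncard - 2)) ?_).bddAbove
    rintro x ⟨F, -, -, rfl⟩
    exact ⟨F, rfl⟩
  · have : ({v | ∃ x ∈ e '' T, v ∈ x} : Set α) = (T.biUnion fun j => (e j).toFinset : Finset α) := by
      ext v
      simp
    rw [hF, this, Set.ncard_coe_finset]

theorem three_le_card_biUnion [DecidableEq α] {H : SimpleGraph α} {e : ℕ → Sym2 α} {r : ℕ}
    (he : Set.InjOn e (Finset.range r : Set ℕ)) (heH : ∀ j, e j ∈ H.edgeSet)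
    {T : Finset ℕ} (hT : T ⊆ Finset.range r) (hT2 : 2 ≤ T.card) :
    3 ≤ (T.biUnion fun j => (e j).toFinset).card := by
  have h2 : ∀ j, (e j).toFinset.card = 2 := fun j =>
    Sym2.card_toFinset_of_not_isDiag _ (H.not_isDiag_of_mem_edgeSet (heH j))
  obtain ⟨i, hi, j, hj, hij⟩ := Finset.one_lt_card.1 hT2
  by_contra! h
  have hsub : ∀ k ∈ T, (e k).toFinset = T.biUnion fun j => (e j).toFinset := fun k hk =>
    Finset.eq_of_subset_of_card_le (Finset.subset_biUnion_of_mem (fun j => (e j).toFinset) hk)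
      (by rw [h2]; omega)
  have h3 : (e i).toFinset = (e j).toFinset := (hsub i hi).trans (hsub j hj).symm
  refine hij (he (by simpa using hT hi) (by simpa using hT hj) ?_)
  ext v
  rw [← Sym2.mem_toFinset, h3, Sym2.mem_toFinset]

theorem half_le_m2 [Fintype α] {H : SimpleGraph α} {e : ℕ → Sym2 α} {r : ℕ}
    (he : Set.InjOn e (Finset.range r : Set ℕ)) (heH : ∀ j, e j ∈ H.edgeSet)
    (hr : ∀ x ∈ H.edgeSet, ∃ j < r, e j = x) : 1 / 2 ≤ m2 H := by
  by_cases h2r : 2 ≤ r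
  · have hT : ({0, 1} : Finset ℕ) ⊆ Finset.range r := by
      intro x hx
      simp only [Finset.mem_insert, Finset.mem_singleton] at hx
      exact Finset.mem_range.2 (by omega)
    have hc : ({0, 1} : Finset ℕ).card = 2 := rfl
    refine le_trans ?_ (le_m2 he heH hT hc.ge)
    have h3 := three_le_card_biUnion he heH hT hc.ge
    have h4 : (({0, 1} : Finset ℕ).biUnion fun j => (e j).toFinset).card ≤ 4 := by
      refine Finset.card_biUnion_le.trans ?_
      rw [Finset.sum_congr rfl fun j _ =>
        Sym2.card_toFinset_of_not_isDiag _ (H.not_isDiag_of_mem_edgeSet (heH j))]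
      simp
    have h3' : (3 : ℝ) ≤ (({0, 1} : Finset ℕ).biUnion fun j => (e j).toFinset).card := by
      exact_mod_cast h3
    have h4' : ((({0, 1} : Finset ℕ).biUnion fun j => (e j).toFinset).card : ℝ) ≤ 4 := by
      exact_mod_cast h4
    rw [hc, div_le_div_iff₀ (by norm_num) (by linarith)]
    push_cast
    linarith
  · rw [m2, if_neg]
    intro h
    have : H.edgeSet ⊆ e '' (Finset.range r : Set ℕ) := fun x hx => by
      obtain ⟨j, hj, rfl⟩ := hr x hx
      exact ⟨j, by simpa using hj, rfl⟩
    have h5 := (Set.ncard_le_ncard this (Set.toFinite _)).trans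
      (Set.ncard_image_le (Set.toFinite _))
    rw [Set.ncard_coe_finset, Finset.card_range] at h5
    omega

/-- The edge sets of a graph and their relation to its `2`-density. -/
theorem exists_edge_finsets [Fintype α] [DecidableEq α] (H : SimpleGraph α)
    (hH : H.edgeSet.Nonempty) :
    ∃ r : ℕ, 0 < r ∧ ∃ E : ℕ → Finset α, Set.InjOn E (Finset.range r : Set ℕ) ∧
      (∀ j, (E j).card = 2) ∧ (∀ j, ∃ a b, H.Adj a b ∧ E j = {a, b}) ∧
      (∀ a b, H.Adj a b → ∃ j < r, E j = {a, b}) ∧ 1 / 2 ≤ m2 H ∧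
      ∀ T ⊆ Finset.range r, 2 ≤ T.card → 3 ≤ (T.biUnion E).card ∧
        ((T.card : ℝ) - 1) / ((T.biUnion E).card - 2) ≤ m2 H := by
  obtain ⟨r, hr, e, he, heH, hall⟩ := exists_edge_enumeration H hH
  refine ⟨r, hr, fun j => (e j).toFinset, fun i hi j hj hij => he hi hj ?_, fun j =>
    Sym2.card_toFinset_of_not_isDiag _ (H.not_isDiag_of_mem_edgeSet (heH j)), fun j => ?_,
    fun a b hab => ?_, half_le_m2 he heH hall,
    fun T hT hT2 => ⟨three_le_card_biUnion he heH hT hT2, le_m2 he heH hT hT2⟩⟩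
  · ext v
    dsimp only at hij
    rw [← Sym2.mem_toFinset, hij, Sym2.mem_toFinset]
  · have h := heH j
    dsimp only
    revert h
    induction e j with
    | _ a b => exact fun h => ⟨a, b, h, Sym2.toFinset_mk_eq⟩
  · obtain ⟨j, hj, h⟩ := hall s(a, b) hab
    exact ⟨j, hj, by dsimp only; rw [h, Sym2.toFinset_mk_eq]⟩

end Enumeration

section Copies

variable {α : Type*} {n : ℕ} {E : ℕ → Finset α}
  {hE : ∀ j, (E j).card = 2} {r : ℕ}

/-- The image of the `j`-th edge under an embedding of the vertex set. -/
def copyEdge (E : ℕ → Finset α) (hE : ∀ j, (E j).card = 2) (φ : α ↪ Fin n) (j : ℕ) : Edge n :=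
  ⟨(E j).map φ, by rw [Finset.card_map, hE]⟩

theorem copyEdge_injOn (hinj : Set.InjOn E (Finset.range r : Set ℕ)) (φ : α ↪ Fin n) :
    Set.InjOn (copyEdge E hE φ) (Finset.range r : Set ℕ) := fun _ hi _ hj hij =>
  hinj hi hj (Finset.map_injective φ (Subtype.ext_iff.1 hij))

theorem copyCount_eq_sum_ind [Fintype α] [DecidableEq α] {H : SimpleGraph α}
    (hEH : ∀ j, ∃ a b, H.Adj a b ∧ E j = {a, b})
    (hHE : ∀ a b, H.Adj a b → ∃ j < r, E j = {a, b}) (ω : Finset (Edge n)) :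
    (copyCount H n ω : ℝ) = ∑ φ : α ↪ Fin n, ind ((Finset.range r).image (copyEdge E hE φ)) ω := by
  rw [copyCount]
  simp only [ind]
  rw [Finset.sum_boole]
  congr 2
  ext φ
  simp only [Finset.mem_filter, Finset.mem_univ, true_and, Finset.image_subset_iff,
    Finset.mem_range]
  constructor
  · intro h j _
    obtain ⟨a, b, hab, hj⟩ := hEH j
    have hφ : copyEdge E hE φ j = ⟨{φ a, φ b}, Finset.card_pair (φ.injective.ne hab.ne)⟩ :=
      Subtype.ext (by simp [copyEdge, hj])
    rw [hφ]
    exact h a b hab _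
  · intro h a b hab hc
    obtain ⟨j, hj, hjE⟩ := hHE a b hab
    have hφ : copyEdge E hE φ j = ⟨{φ a, φ b}, hc⟩ := Subtype.ext (by simp [copyEdge, hjE])
    rw [← hφ]
    exact h j hj

theorem expCopy_eq_sum_prod [Fintype α] [DecidableEq α] {H : SimpleGraph α} (hinj : Set.InjOn E (Finset.range r : Set ℕ))
    (hEH : ∀ j, ∃ a b, H.Adj a b ∧ E j = {a, b})
    (hHE : ∀ a b, H.Adj a b → ∃ j < r, E j = {a, b}) (q : Edge n → ℝ) :
    expCopy H n q = ∑ φ : α ↪ Fin n, ∏ j ∈ Finset.range r, q (copyEdge E hE φ j) := by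
  simp only [expCopy, copyCount_eq_sum_ind (hE := hE) hEH hHE, Finset.mul_sum]
  rw [Finset.sum_comm]
  refine Finset.sum_congr rfl fun φ _ => ?_
  simp only [ind]
  rw [sum_pw_subset, Finset.prod_image (copyEdge_injOn hinj φ)]

theorem expCopy_const [Fintype α] [DecidableEq α] {H : SimpleGraph α} (hinj : Set.InjOn E (Finset.range r : Set ℕ))
    (hE : ∀ j, (E j).card = 2) (hEH : ∀ j, ∃ a b, H.Adj a b ∧ E j = {a, b})
    (hHE : ∀ a b, H.Adj a b → ∃ j < r, E j = {a, b}) (p : ℝ) :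
    expCopy H n (fun _ => p) = Fintype.card (α ↪ Fin n) * p ^ r := by
  rw [expCopy_eq_sum_prod (hE := hE) hinj hEH hHE]
  simp

theorem pow_card_le_card_embedding [Fintype α] (hn : Fintype.card α ≤ n) :
    n ^ Fintype.card α ≤ Fintype.card α ^ Fintype.card α * Fintype.card (α ↪ Fin n) := by
  rw [Fintype.card_embedding_eq, Fintype.card_fin]
  exact pow_le_mul_descFactorial hn

theorem card_edge (n : ℕ) : Fintype.card (Edge n) = n.choose 2 := by
  rw [Fintype.card_finset_len, Fintype.card_fin]

theorem card_edge_le (n : ℕ) : Fintype.card (Edge n) ≤ n ^ 2 := by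
  rw [card_edge]
  exact Nat.choose_le_pow n 2

/-- Few embeddings cover a given set of vertices. -/
theorem card_filter_cover_le [Fintype α] (S : Finset (Fin n)) (P : (α ↪ Fin n) → Prop)
    [DecidablePred P] (hP : ∀ φ, P φ → ∀ x ∈ S, ∃ a, φ a = x) :
    n ^ S.card * (Finset.univ.filter P).card ≤ Fintype.card α ^ S.card * n ^ Fintype.card α := by
  refine le_trans (Nat.mul_le_mul_left _ ?_) (card_embedding_range_supset (α := α) S)
  rw [Fintype.card_subtype]
  exact Finset.card_le_card fun φ hφ => by
    simp only [Finset.mem_filter, Finset.mem_univ, true_and] at hφ ⊢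
    exact hP φ hφ

theorem exists_of_copyEdge_eq {φ : α ↪ Fin n} {j : ℕ} {v : Edge n} (h : copyEdge E hE φ j = v)
    {x : Fin n} (hx : x ∈ v.1) : ∃ a, φ a = x := by
  rw [← h] at hx
  obtain ⟨a, -, ha⟩ := Finset.mem_map.1 hx
  exact ⟨a, ha⟩

theorem card_copyEdge_eq_le [Fintype α] [DecidableEq α] (hn : Fintype.card α ≤ n) (i : ℕ) (v : Edge n) :
    (Fintype.card (Edge n) : ℝ) *
      (Finset.univ.filter fun φ : α ↪ Fin n => copyEdge E hE φ i = v).card ≤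
      2 ^ r * (Fintype.card α : ℝ) ^ (2 * Fintype.card α) * Fintype.card (α ↪ Fin n) := by
  have h1 := card_filter_cover_le v.1 (fun φ : α ↪ Fin n => copyEdge E hE φ i = v)
    fun φ h x hx => exists_of_copyEdge_eq h hx
  rw [v.2] at h1
  have h2 : 2 ≤ Fintype.card α := (hE 0).symm.le.trans (Finset.card_le_univ _)
  have h3 := pow_card_le_card_embedding (α := α) hn
  have h4 : Fintype.card (Edge n) *
      (Finset.univ.filter fun φ : α ↪ Fin n => copyEdge E hE φ i = v).card ≤
      2 ^ r * Fintype.card α ^ (2 * Fintype.card α) * Fintype.card (α ↪ Fin n) := by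
    calc _ ≤ n ^ 2 * _ := Nat.mul_le_mul_right _ (card_edge_le n)
      _ ≤ Fintype.card α ^ 2 * n ^ Fintype.card α := h1
      _ ≤ Fintype.card α ^ Fintype.card α *
          (Fintype.card α ^ Fintype.card α * Fintype.card (α ↪ Fin n)) :=
        Nat.mul_le_mul (Nat.pow_le_pow_right (by omega) h2) h3
      _ = 1 * Fintype.card α ^ (2 * Fintype.card α) * Fintype.card (α ↪ Fin n) := by
        rw [two_mul, pow_add]; ring
      _ ≤ _ := by
        gcongr
        exact Nat.one_le_two_pow
  exact_mod_cast h4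

theorem sum_pair_le [Fintype α] [DecidableEq α] {x : ℝ} (hx : 0 < x) (hn : Fintype.card α ≤ n)
    (hinj : Set.InjOn E (Finset.range r : Set ℕ))
    (hdense : ∀ T ⊆ Finset.range r, T.Nonempty →
      1 ≤ x ^ (T.card - 1) * (n : ℝ) ^ ((T.biUnion E).card - 2)) {i : ℕ} (hi : i < r) :
    Fintype.card (Edge n) * ∑ φ : α ↪ Fin n, ∑ φ' : α ↪ Fin n,
      (if copyEdge E hE φ i = copyEdge E hE φ' i then
        x ^ ((Finset.range i).image (copyEdge E hE φ) ∪
          (Finset.range i).image (copyEdge E hE φ')).card else 0) ≤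
      2 ^ r * (Fintype.card α : ℝ) ^ (2 * Fintype.card α) * x ^ (2 * i) *
        (Fintype.card (α ↪ Fin n) : ℝ) ^ 2 := by
  have h2 : 2 ≤ Fintype.card α := (hE 0).symm.le.trans (Finset.card_le_univ _)
  have hD : (n : ℝ) ^ Fintype.card α ≤
      (Fintype.card α : ℝ) ^ Fintype.card α * Fintype.card (α ↪ Fin n) := by
    exact_mod_cast pow_card_le_card_embedding (α := α) hn
  have hri : ∀ {j}, j ≤ i → j ∈ (Finset.range r : Set ℕ) := fun {j} hj => by
    simpa using hj.trans_lt hi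
  have hB : ∀ φ : α ↪ Fin n, ((Finset.range i).image (copyEdge E hE φ)).card = i := fun φ => by
    rw [Finset.card_image_of_injOn, Finset.card_range]
    exact (copyEdge_injOn hinj φ).mono fun j hj => hri (by
      have : j < i := by simpa using hj
      exact this.le)
  have hφ : ∀ φ : α ↪ Fin n, (n : ℝ) ^ 2 * ∑ φ' : α ↪ Fin n,
      (if copyEdge E hE φ i = copyEdge E hE φ' i then
        x ^ ((Finset.range i).image (copyEdge E hE φ) ∪
          (Finset.range i).image (copyEdge E hE φ')).card else 0) ≤
      2 ^ r * ((Fintype.card α : ℝ) ^ Fintype.card α * (n : ℝ) ^ Fintype.card α * x ^ (2 * i)) := by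
    intro φ
    let J : (α ↪ Fin n) → Finset ℕ := fun φ' =>
      (Finset.range i).filter fun j => copyEdge E hE φ j ∈ (Finset.range i).image (copyEdge E hE φ')
    have hJ : ∀ φ', ((Finset.range i).image (copyEdge E hE φ) ∪
        (Finset.range i).image (copyEdge E hE φ')).card = 2 * i - (J φ').card := by
      intro φ'
      have h1 : (J φ').image (copyEdge E hE φ) = (Finset.range i).image (copyEdge E hE φ) ∩
          (Finset.range i).image (copyEdge E hE φ') := by
        ext v
        simp only [J, Finset.mem_image, Finset.mem_filter, Finset.mem_inter]
        constructor
        · rintro ⟨j, ⟨hj, hj'⟩, rfl⟩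
          exact ⟨⟨j, hj, rfl⟩, hj'⟩
        · rintro ⟨⟨j, hj, rfl⟩, hj'⟩
          exact ⟨j, ⟨hj, hj'⟩, rfl⟩
      have h3 : ((J φ').image (copyEdge E hE φ)).card = (J φ').card :=
        Finset.card_image_of_injOn ((copyEdge_injOn hinj φ).mono fun j hj => hri
          (Finset.mem_range.1 (Finset.mem_filter.1 hj).1).le)
      rw [Finset.card_union, hB, hB, ← h1, h3, two_mul]
    have hsum : ∀ φ', (if copyEdge E hE φ i = copyEdge E hE φ' i then
        x ^ ((Finset.range i).image (copyEdge E hE φ) ∪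
          (Finset.range i).image (copyEdge E hE φ')).card else 0) =
        ∑ T ∈ (Finset.range i).powerset, if J φ' = T ∧ copyEdge E hE φ i = copyEdge E hE φ' i then
          x ^ (2 * i - T.card) else 0 := by
      intro φ'
      rw [Finset.sum_eq_single_of_mem (J φ') (Finset.mem_powerset.2 (Finset.filter_subset _ _)),
        hJ]
      · simp
      · intro T _ hT
        rw [if_neg fun h => hT h.1.symm]
    have hT : ∀ T ∈ (Finset.range i).powerset, (n : ℝ) ^ 2 * ∑ φ' : α ↪ Fin n,
        (if J φ' = T ∧ copyEdge E hE φ i = copyEdge E hE φ' i then x ^ (2 * i - T.card) else 0) ≤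
        (Fintype.card α : ℝ) ^ Fintype.card α * (n : ℝ) ^ Fintype.card α * x ^ (2 * i) := by
      intro T hT
      have hTi := Finset.mem_powerset.1 hT
      have hiT : i ∉ T := fun h => by simpa using hTi h
      have hTc : T.card ≤ i := by simpa using Finset.card_le_card hTi
      have hins : insert i T ⊆ Finset.range r := by
        intro j hj
        rcases Finset.mem_insert.1 hj with rfl | hj
        · exact Finset.mem_range.2 hi
        · exact Finset.mem_range.2 ((Finset.mem_range.1 (hTi hj)).trans hi)
      set A := (insert i T).biUnion E
      have hA2 : 2 ≤ A.card := by
        rw [← hE i]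
        exact Finset.card_le_card (Finset.subset_biUnion_of_mem E (Finset.mem_insert_self _ _))
      have hAα : A.card ≤ Fintype.card α := Finset.card_le_univ _
      have hd := hdense _ hins ⟨i, Finset.mem_insert_self _ _⟩
      rw [Finset.card_insert_of_notMem hiT, Nat.add_sub_cancel] at hd
      have hc := card_filter_cover_le (A.map φ)
        (fun φ' => J φ' = T ∧ copyEdge E hE φ i = copyEdge E hE φ' i) (by
          rintro φ' ⟨hJT, hφi⟩ y hy
          obtain ⟨a, ha, rfl⟩ := Finset.mem_map.1 hy
          obtain ⟨j, hj, haj⟩ := Finset.mem_biUnion.1 ha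
          have hmem : φ a ∈ (copyEdge E hE φ j).1 := Finset.mem_map_of_mem _ haj
          rcases Finset.mem_insert.1 hj with rfl | hj
          · exact exists_of_copyEdge_eq hφi.symm hmem
          · rw [← hJT] at hj
            obtain ⟨k, -, hk⟩ := Finset.mem_image.1 (Finset.mem_filter.1 hj).2
            exact exists_of_copyEdge_eq hk hmem)
      rw [Finset.card_map] at hc
      rw [← Finset.sum_filter, Finset.sum_const, nsmul_eq_mul]
      set m := (Finset.univ.filter fun φ' : α ↪ Fin n =>
        J φ' = T ∧ copyEdge E hE φ i = copyEdge E hE φ' i).card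
      have hc' : (n : ℝ) ^ A.card * m ≤
          (Fintype.card α : ℝ) ^ Fintype.card α * (n : ℝ) ^ Fintype.card α := by
        have : n ^ A.card * m ≤ Fintype.card α ^ Fintype.card α * n ^ Fintype.card α :=
          hc.trans (Nat.mul_le_mul_right _ (Nat.pow_le_pow_right (by omega) hAα))
        exact_mod_cast this
      calc (n : ℝ) ^ 2 * (m * x ^ (2 * i - T.card))
          ≤ (n : ℝ) ^ 2 * (m * x ^ (2 * i - T.card)) *
            (x ^ T.card * (n : ℝ) ^ (A.card - 2)) := le_mul_of_one_le_right (by positivity) hd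
        _ = (n : ℝ) ^ (2 + (A.card - 2)) * m * x ^ (2 * i - T.card + T.card) := by ring
        _ = (n : ℝ) ^ A.card * m * x ^ (2 * i) := by
            rw [Nat.add_sub_cancel' hA2, Nat.sub_add_cancel (by omega)]
        _ ≤ _ := mul_le_mul_of_nonneg_right hc' (by positivity)
    simp_rw [hsum]
    rw [Finset.sum_comm, Finset.mul_sum]
    refine (Finset.sum_le_sum hT).trans ?_
    rw [Finset.sum_const, Finset.card_powerset, Finset.card_range, nsmul_eq_mul]
    push_cast
    have : (2 : ℝ) ^ i ≤ 2 ^ r := pow_le_pow_right₀ (by norm_num) hi.le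
    exact mul_le_mul_of_nonneg_right this (by positivity)
  have hN : (Fintype.card (Edge n) : ℝ) ≤ (n : ℝ) ^ 2 := by exact_mod_cast card_edge_le n
  calc _ ≤ (n : ℝ) ^ 2 * _ := mul_le_mul_of_nonneg_right hN
        (Finset.sum_nonneg fun φ _ => Finset.sum_nonneg fun φ' _ => by split_ifs <;> positivity)
    _ ≤ ∑ _φ : α ↪ Fin n, 2 ^ r *
        ((Fintype.card α : ℝ) ^ Fintype.card α * (n : ℝ) ^ Fintype.card α * x ^ (2 * i)) := by
        rw [Finset.mul_sum]
        exact Finset.sum_le_sum fun φ _ => hφ φ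
    _ = Fintype.card (α ↪ Fin n) * (2 ^ r *
        ((Fintype.card α : ℝ) ^ Fintype.card α * (n : ℝ) ^ Fintype.card α * x ^ (2 * i))) := by
        rw [Finset.sum_const, nsmul_eq_mul, Finset.card_univ]
    _ ≤ Fintype.card (α ↪ Fin n) * (2 ^ r * ((Fintype.card α : ℝ) ^ Fintype.card α *
        ((Fintype.card α : ℝ) ^ Fintype.card α * Fintype.card (α ↪ Fin n)) * x ^ (2 * i))) := by
        gcongr
    _ = _ := by rw [two_mul (Fintype.card α), pow_add]; ring

end Copies

section UpperBound

theorem one_sub_sum_le_prod {ι : Type*} (s : Finset ι) {x : ι → ℝ}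
    (hx : ∀ i ∈ s, x i ∈ Set.Icc (0 : ℝ) 1) : 1 - ∑ i ∈ s, x i ≤ ∏ i ∈ s, (1 - x i) := by
  induction s using Finset.induction_on with
  | empty => simp
  | insert a s ha ih =>
    rw [Finset.sum_insert ha, Finset.prod_insert ha]
    have h1 := ih fun i hi => hx i (Finset.mem_insert_of_mem hi)
    obtain ⟨h2, h3⟩ := hx a (Finset.mem_insert_self _ _)
    have h4 : 0 ≤ ∑ i ∈ s, x i :=
      Finset.sum_nonneg fun i hi => (hx i (Finset.mem_insert_of_mem hi)).1
    nlinarith [mul_le_mul_of_nonneg_left h1 (sub_nonneg.2 h3), mul_nonneg h2 h4]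

variable {V : Type*} [Fintype V] [DecidableEq V] {ι : Type*} [Fintype ι] {c : ι → ℕ → V} {r : ℕ}

/-- A substantial decrease of the expected number of copies has a large entropy cost. -/
theorem le_sum_ip {p ε C : ℝ} {q : V → ℝ} (hp : 0 < p) (hp1 : p < 1) (hε : 0 < ε) (hC : 0 < C)
    (hr : 0 < r) (hι : 0 < Fintype.card ι) (hq : ∀ v, 0 ≤ q v) (hqp : ∀ v, q v ≤ p)
    (hdeg : ∀ i < r, ∀ v, (Fintype.card V : ℝ) * (Finset.univ.filter fun φ => c φ i = v).card ≤
      C * Fintype.card ι)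
    (hmean : ∑ φ, ∏ j ∈ Finset.range r, q (c φ j) ≤ (1 - ε) * (Fintype.card ι * p ^ r)) :
    p / 4 * (ε / (r * C)) ^ 2 * Fintype.card V ≤ ∑ v, ip p (q v) := by
  have hD : (0 : ℝ) < Fintype.card ι := Nat.cast_pos.2 hι
  have hN : (0 : ℝ) < Fintype.card V := by
    obtain ⟨φ₀⟩ := Fintype.card_pos_iff.1 hι
    exact Nat.cast_pos.2 (Fintype.card_pos_iff.2 ⟨c φ₀ 0⟩)
  let x : V → ℝ := fun v => (p - q v) / p
  have hx : ∀ v, x v ∈ Set.Icc (0 : ℝ) 1 := fun v =>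
    ⟨div_nonneg (by linarith [hqp v]) hp.le, (div_le_one hp).2 (by linarith [hq v])⟩
  have hqx : ∀ v, q v = p * (1 - x v) := fun v => by
    simp only [x]; field_simp; ring
  have h1 : ε * Fintype.card ι ≤ ∑ φ, ∑ j ∈ Finset.range r, x (c φ j) := by
    have h2 : ∑ φ, ∏ j ∈ Finset.range r, q (c φ j) =
        p ^ r * ∑ φ, ∏ j ∈ Finset.range r, (1 - x (c φ j)) := by
      rw [Finset.mul_sum]
      refine Finset.sum_congr rfl fun φ _ => ?_
      simp_rw [hqx, Finset.prod_mul_distrib]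
      rw [Finset.prod_const, Finset.card_range]
    have h3 : p ^ r * ∑ φ, ∏ j ∈ Finset.range r, (1 - x (c φ j)) ≤
        p ^ r * ((1 - ε) * Fintype.card ι) := by
      rw [← h2]; linarith
    have h4 := le_of_mul_le_mul_left h3 (by positivity)
    have h5 : ∑ φ : ι, (1 - ∑ j ∈ Finset.range r, x (c φ j)) ≤
        ∑ φ, ∏ j ∈ Finset.range r, (1 - x (c φ j)) :=
      Finset.sum_le_sum fun φ _ => one_sub_sum_le_prod _ fun j _ => hx _
    rw [Finset.sum_sub_distrib, Finset.sum_const, Finset.card_univ, nsmul_eq_mul, mul_one] at h5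
    linarith
  have h2 : ∀ j, ∑ φ, x (c φ j) =
      ∑ v, x v * (Finset.univ.filter fun φ => c φ j = v).card := by
    intro j
    rw [← Finset.sum_fiberwise Finset.univ (fun φ => c φ j) fun φ => x (c φ j)]
    refine Finset.sum_congr rfl fun v _ => ?_
    rw [Finset.sum_congr rfl fun φ hφ => by rw [(Finset.mem_filter.1 hφ).2], Finset.sum_const,
      nsmul_eq_mul, mul_comm]
  have h3 : Fintype.card V * (ε * Fintype.card ι) ≤ r * (C * Fintype.card ι * ∑ v, x v) := by
    refine (mul_le_mul_of_nonneg_left h1 hN.le).trans ?_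
    rw [Finset.sum_comm, Finset.mul_sum]
    calc _ ≤ ∑ j ∈ Finset.range r, C * Fintype.card ι * ∑ v, x v := by
          refine Finset.sum_le_sum fun j hj => ?_
          rw [h2, Finset.mul_sum, Finset.mul_sum]
          refine Finset.sum_le_sum fun v _ => ?_
          have := mul_le_mul_of_nonneg_left (hdeg j (Finset.mem_range.1 hj) v) (hx v).1
          linarith
      _ = _ := by simp
  have h4 : ε / (r * C) * Fintype.card V ≤ ∑ v, x v := by
    rw [div_mul_eq_mul_div, div_le_iff₀ (by positivity)]
    refine le_of_mul_le_mul_right ?_ hD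
    linarith
  have h5 : (ε / (r * C) * Fintype.card V) ^ 2 ≤ Fintype.card V * ∑ v, x v ^ 2 :=
    (pow_le_pow_left₀ (by positivity) h4 2).trans sq_sum_le_card_mul_sum_sq
  have h6 : (ε / (r * C)) ^ 2 * Fintype.card V ≤ ∑ v, x v ^ 2 := by
    refine le_of_mul_le_mul_left ?_ hN
    linarith
  calc _ = p / 4 * ((ε / (r * C)) ^ 2 * Fintype.card V) := by ring
    _ ≤ p / 4 * ∑ v, x v ^ 2 := mul_le_mul_of_nonneg_left h6 (by positivity)
    _ ≤ _ := by
      rw [Finset.mul_sum]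
      refine Finset.sum_le_sum fun v _ => (le_of_eq ?_).trans (sq_div_le_ip hp hp1 (hq v) (hqp v))
      simp only [x]
      field_simp

theorem sum_pw_mul_sum_ind (hinj : ∀ φ, Set.InjOn (c φ) (Finset.range r : Set ℕ)) (q : V → ℝ) :
    ∑ ω, pw q ω * ∑ φ, ind ((Finset.range r).image (c φ)) ω =
      ∑ φ, ∏ j ∈ Finset.range r, q (c φ j) := by
  simp_rw [Finset.mul_sum]
  rw [Finset.sum_comm]
  refine Finset.sum_congr rfl fun φ _ => ?_
  simp only [ind]
  rw [sum_pw_subset, Finset.prod_image (hinj φ)]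

theorem le_sum_pw_of_mean_le {X : Finset V → ℝ} {q : V → ℝ} {ε y : ℝ} (hε : ε ≤ 1) (hy : 0 ≤ y)
    (hX : ∀ ω, 0 ≤ X ω) (hq : ∀ v, q v ∈ Set.Icc (0 : ℝ) 1)
    (hmean : ∑ ω, pw q ω * X ω ≤ (1 - ε) * y) :
    ε ≤ ∑ ω, if X ω ≤ y then pw q ω else 0 := by
  have hsplit : (∑ ω, if X ω ≤ y then pw q ω else 0) + (∑ ω, if X ω ≤ y then 0 else pw q ω) = 1 := by
    rw [← sum_pw q, ← Finset.sum_add_distrib]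
    exact Finset.sum_congr rfl fun ω _ => by split_ifs <;> simp
  have hnn : ∀ ω, 0 ≤ pw q ω * X ω := fun ω => mul_nonneg (pw_nonneg hq ω) (hX ω)
  rcases hy.eq_or_lt with rfl | hy
  · have h0 : ∀ ω, pw q ω * X ω = 0 := fun ω =>
      (Finset.sum_eq_zero_iff_of_nonneg fun ω _ => hnn ω).1
        (le_antisymm (by simpa using hmean) (Finset.sum_nonneg fun ω _ => hnn ω)) ω
        (Finset.mem_univ _)
    have h1 : (∑ ω, if X ω ≤ 0 then 0 else pw q ω) = 0 := Finset.sum_eq_zero fun ω _ => by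
      split_ifs with h
      · rfl
      · exact (mul_eq_zero.1 (h0 ω)).resolve_right fun h' => h h'.le
    linarith
  · have h1 : y * (∑ ω, if X ω ≤ y then 0 else pw q ω) ≤ y * (1 - ε) := by
      rw [Finset.mul_sum, mul_comm y (1 - ε)]
      refine (Finset.sum_le_sum fun ω _ => ?_).trans hmean
      split_ifs with h
      · simpa using hnn ω
      · rw [mul_comm]
        exact mul_le_mul_of_nonneg_left (not_le.1 h).le (pw_nonneg hq ω)
    have := le_of_mul_le_mul_left h1 hy
    linarith

/-- The lower tail probability is bounded from below by the entropy of any product measure with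
few expected copies. -/
theorem neg_log_tail_le {p p₀ ε C η : ℝ} {q : V → ℝ} (hp : 0 < p) (hpp : p ≤ p₀) (hp1 : p₀ < 1)
    (hε : 0 < ε) (hε1 : ε ≤ 1) (hC : 0 < C) (hr : 0 < r) (hι : 0 < Fintype.card ι)
    (hinj : ∀ φ, Set.InjOn (c φ) (Finset.range r : Set ℕ))
    (hdeg : ∀ i < r, ∀ v, (Fintype.card V : ℝ) * (Finset.univ.filter fun φ => c φ i = v).card ≤
      C * Fintype.card ι)
    (hη : 0 ≤ η) (hη1 : η ≤ 1) (hq : ∀ v, q v ∈ Set.Icc (0 : ℝ) 1)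
    (hmean : ∑ φ, ∏ j ∈ Finset.range r, q (c φ j) ≤ (1 - ε) * η * (Fintype.card ι * p ^ r))
    (hD1 : 8 * (32 + 8 / (1 - p₀) ^ 2) / ε ^ 3 ≤ p / 4 * (ε / (r * C)) ^ 2 * Fintype.card V)
    (hD2 : 2 / ε * Real.log (2 / ε) ≤ p / 4 * (ε / (r * C)) ^ 2 * Fintype.card V) :
    -Real.log (∑ ω, if ∑ φ, ind ((Finset.range r).image (c φ)) ω ≤ η * (Fintype.card ι * p ^ r)
      then pw (fun _ => p) ω else 0) ≤ (1 + ε) * ∑ v, ip p (q v) := by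
  have hp' : p < 1 := hpp.trans_lt hp1
  let q' : V → ℝ := fun v => min (q v) p
  have hq0 : ∀ v, 0 ≤ q' v := fun v => le_min (hq v).1 hp.le
  have hqp : ∀ v, q' v ≤ p := fun v => min_le_right _ _
  have hE : (0 : ℝ) ≤ Fintype.card ι * p ^ r := by positivity
  have hmean' : ∑ φ, ∏ j ∈ Finset.range r, q' (c φ j) ≤
      (1 - ε) * (η * (Fintype.card ι * p ^ r)) := by
    rw [← mul_assoc]
    exact (Finset.sum_le_sum fun φ _ => Finset.prod_le_prod (fun j _ => hq0 _)
      fun j _ => min_le_left _ _).trans hmean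
  have hip : ∑ v, ip p (q' v) ≤ ∑ v, ip p (q v) := by
    refine Finset.sum_le_sum fun v _ => ?_
    rcases le_total (q v) p with h | h
    · simp only [q', min_eq_left h, le_refl]
    · simp only [q', min_eq_right h, ip_self]
      exact ip_nonneg hp hp' (hq v)
  have hlow := le_sum_ip hp hp' hε hC hr hι hq0 hqp hdeg (hmean'.trans (by
    refine mul_le_mul_of_nonneg_left ?_ (by linarith)
    exact mul_le_of_le_one_left hE hη1))
  have hA := le_sum_pw_of_mean_le (q := q') (ε := ε) hε1 (mul_nonneg hη hE)
    (X := fun ω => ∑ φ, ind ((Finset.range r).image (c φ)) ω)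
    (fun ω => Finset.sum_nonneg fun φ _ => ind_nonneg _ _)
    (fun v => ⟨hq0 v, (hqp v).trans hp'.le⟩) (by
      rw [sum_pw_mul_sum_ind hinj]; exact hmean')
  exact (neg_log_le_of_tilt _ hp hpp hp1 hε hq0 hqp hA (hD1.trans hlow) (hD2.trans hlow)).trans
    (mul_le_mul_of_nonneg_left hip (by linarith))

end UpperBound

section LowerBound

variable {V : Type*} [Fintype V] [DecidableEq V] {ι : Type*} [Fintype ι] {c : ι → ℕ → V} {r : ℕ}

theorem tail_pos {p y : ℝ} (hp : 0 < p) (hp1 : p < 1) (hr : 0 < r) (hy : 0 ≤ y) :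
    0 < ∑ ω, if ∑ φ, ind ((Finset.range r).image (c φ)) ω ≤ y then pw (fun _ => p) ω else 0 := by
  have hpI : ∀ _ : V, p ∈ Set.Icc (0 : ℝ) 1 := fun _ => ⟨hp.le, hp1.le⟩
  refine Finset.sum_pos' (fun ω _ => ?_) ⟨∅, Finset.mem_univ _, ?_⟩
  · split_ifs
    · exact pw_nonneg hpI ω
    · exact le_rfl
  · have h : ∀ φ, ind ((Finset.range r).image (c φ)) ∅ = 0 := fun φ =>
      if_neg fun h => by
        have := h (Finset.mem_image_of_mem (c φ) (Finset.mem_range.2 hr))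
        simp at this
    rw [if_pos (by simpa [h] using hy), pw, Finset.prod_empty, one_mul]
    exact Finset.prod_pos fun _ _ => by linarith

theorem tail_le_one {p y : ℝ} (hp : 0 < p) (hp1 : p < 1) :
    (∑ ω, if ∑ φ, ind ((Finset.range r).image (c φ)) ω ≤ y then pw (fun _ => p) ω else 0) ≤ 1 := by
  rw [← sum_pw fun _ : V => p]
  refine Finset.sum_le_sum fun ω _ => ?_
  split_ifs
  · exact le_rfl
  · exact pw_nonneg (fun _ => ⟨hp.le, hp1.le⟩) ω

/-- The entropy of some product measure with few expected copies is bounded by the logarithm of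
the lower tail probability. -/
theorem exists_profile_of_tail {p ε C δ η m : ℝ} (hp : 0 < p) (hp1 : p < 1) (hε : 0 < ε)
    (hε1 : ε < 1) (hC : 0 < C) (hr : 0 < r) (hδ : 0 < δ) (hδ1 : δ ≤ 1 / 2)
    (hδC : δ ≤ ε ^ 5 / (128 * r ^ 3 * C ^ 2)) (hι : 0 < Fintype.card ι)
    (hinj : ∀ φ, Set.InjOn (c φ) (Finset.range r : Set ℕ))
    (hdeg : ∀ i < r, ∀ v, (Fintype.card V : ℝ) * (Finset.univ.filter fun φ => c φ i = v).card ≤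
      C * Fintype.card ι)
    (hpair : ∀ i < r, Fintype.card V * ∑ φ, ∑ φ', (if c φ i = c φ' i then
      (δ * p) ^ ((Finset.range i).image (c φ) ∪ (Finset.range i).image (c φ')).card else 0) ≤
        C * (δ * p) ^ (2 * i) * (Fintype.card ι : ℝ) ^ 2) (hη : 0 ≤ η)
    (hm : -Real.log (∑ ω, if ∑ φ, ind ((Finset.range r).image (c φ)) ω ≤
      η * (Fintype.card ι * p ^ r) then pw (fun _ => p) ω else 0) ≤ m) (hm0 : 0 < m) :
    ∃ q : V → ℝ, (∀ v, q v ∈ Set.Icc (0 : ℝ) 1) ∧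
      ∑ φ, ∏ j ∈ Finset.range r, q (c φ j) ≤ (η + ε) * (Fintype.card ι * p ^ r) ∧
      (1 - ε) * ∑ v, ip p (q v) ≤ m := by
  let A : Finset V → Prop := fun ω =>
    ∑ φ, ind ((Finset.range r).image (c φ)) ω ≤ η * (Fintype.card ι * p ^ r)
  have hA : ∀ ω v, A ω → A (ω.erase v) := fun ω v h =>
    (Finset.sum_le_sum fun φ _ => by
      simp only [ind]
      split_ifs with h1 h2
      · exact le_rfl
      · exact absurd (h1.trans (Finset.erase_subset _ _)) h2
      · norm_num
      · exact le_rfl).trans h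
  set P := ∑ ω, if A ω then pw (fun _ => p) ω else 0 with hP
  have hP0 : 0 < P := by
    have := tail_pos (c := c) (y := η * (Fintype.card ι * p ^ r)) hp hp1 hr (by positivity)
    convert this
  refine exists_profile (ν := condMeasure p A) (M := P⁻¹) hp hp1 hε hε1 hC hr hδ hδ1 hδC hι hinj
    (condMeasure_nonneg hp hp1) ?_ (inv_pos.2 hP0) (fun ω => ?_)
    (sum_ind_condMeasure_le hp hp1 hA) (fun U v hv ω => condE_condMeasure_le hp hp1 hA hv ω)
    hdeg hpair (fun ω hω => ?_) (by rwa [Real.log_inv]) hm0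
  · simp only [condMeasure]
    rw [← Finset.sum_div]
    exact div_self hP0.ne'
  · rw [condMeasure, ← hP, div_eq_inv_mul]
    refine mul_le_mul_of_nonneg_left ?_ (inv_pos.2 hP0).le
    split_ifs
    · exact le_rfl
    · exact pw_nonneg (fun _ => ⟨hp.le, hp1.le⟩) ω
  · by_contra h
    exact hω (by rw [condMeasure, if_neg h, zero_div])

end LowerBound

section Graphs

variable {α : Type*} [Fintype α] [DecidableEq α] {H : SimpleGraph α} {n : ℕ} {p : ℝ}

theorem PhiCopy_le {η : ℝ} (hip : ∀ q : Edge n → ℝ, (∀ e, q e ∈ Set.Icc (0 : ℝ) 1) →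
    0 ≤ ∑ e, ip p (q e)) {q : Edge n → ℝ} (hq : ∀ e, q e ∈ Set.Icc (0 : ℝ) 1)
    (hmean : expCopy H n q ≤ η * expCopy H n (fun _ => p)) :
    PhiCopy H n p η ≤ ∑ e, ip p (q e) :=
  csInf_le ⟨0, by rintro x ⟨q, hq, -, rfl⟩; exact hip q hq⟩ ⟨q, hq, hmean, rfl⟩

theorem PhiCopy_nonneg {η : ℝ} (hip : ∀ q : Edge n → ℝ, (∀ e, q e ∈ Set.Icc (0 : ℝ) 1) →
    0 ≤ ∑ e, ip p (q e)) : 0 ≤ PhiCopy H n p η :=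
  Real.sInf_nonneg (by rintro x ⟨q, hq, -, rfl⟩; exact hip q hq)

theorem sq_le_four_mul_card_edge (hn : 2 ≤ n) : n ^ 2 ≤ 4 * Fintype.card (Edge n) := by
  rw [card_edge]
  have h2 := Nat.choose_two_right n
  obtain ⟨k, rfl⟩ : ∃ k, n = k + 2 := ⟨n - 2, by omega⟩
  have h3 : 2 ∣ (k + 2) * (k + 1) := by
    have := (Nat.even_mul_succ_self (k + 1)).two_dvd
    rwa [mul_comm] at this
  have h4 : 2 * (k + 2).choose 2 = (k + 2) * (k + 1) := by
    rw [h2]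
    exact Nat.mul_div_cancel' h3
  nlinarith

theorem PrCopy_eq_one (hn : n < Fintype.card α) (η : ℝ) : PrCopy H n p η = 1 := by
  have : IsEmpty (α ↪ Fin n) := Function.Embedding.isEmpty_of_card_lt (by simpa using hn)
  have h : ∀ ω, copyCount H n ω = 0 := fun ω => by simp [copyCount]
  simp [PrCopy, expCopy, h, sum_pw]

theorem expCopy_eq_zero (hn : n < Fintype.card α) (q : Edge n → ℝ) : expCopy H n q = 0 := by
  have : IsEmpty (α ↪ Fin n) := Function.Embedding.isEmpty_of_card_lt (by simpa using hn)
  have h : ∀ ω, copyCount H n ω = 0 := fun ω => by simp [copyCount]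
  simp [expCopy, h]

/-- The edge density at the threshold dominates the densities of all subgraphs. -/
theorem one_le_pow_mul_pow {m x : ℝ} (hn : 0 < n) (hm : 0 < m)
    (hx : (n : ℝ) ^ (-(1 / m)) ≤ x) {s v : ℕ} (hv : 3 ≤ v)
    (hsv : ((s : ℝ) - 1) / ((v : ℝ) - 2) ≤ m) (hs : 1 ≤ s) :
    1 ≤ x ^ (s - 1) * (n : ℝ) ^ (v - 2) := by
  have hn1 : (1 : ℝ) ≤ n := by exact_mod_cast hn
  have hn0 : (0 : ℝ) < n := by linarith
  have hv' : (3 : ℝ) ≤ v := by exact_mod_cast hv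
  have h1 : ((n : ℝ) ^ (-(1 / m))) ^ (s - 1) ≤ x ^ (s - 1) :=
    pow_le_pow_left₀ (Real.rpow_nonneg hn0.le _) hx _
  refine le_trans ?_ (mul_le_mul_of_nonneg_right h1 (by positivity))
  rw [← Real.rpow_natCast ((n : ℝ) ^ (-(1 / m))), ← Real.rpow_mul hn0.le,
    ← Real.rpow_natCast (n : ℝ), ← Real.rpow_add hn0]
  refine Real.one_le_rpow hn1 ?_
  rw [Nat.cast_sub hs, Nat.cast_sub (by omega)]
  rw [div_le_iff₀ (by linarith)] at hsv
  have h2 : ((s : ℝ) - 1) / m ≤ v - 2 := by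
    rw [div_le_iff₀ hm]; linarith
  push_cast
  have h3 : -(1 / m) * ((s : ℝ) - 1) = -(((s : ℝ) - 1) / m) := by ring
  rw [h3]
  linarith

end Graphs

end LowerTail

/-- Theorem `thm:graphs`: for every nonempty graph `H`, all `p₀ < 1` and every `ε > 0`
there is a constant `L` such that whenever `L n^{−1/m₂(H)} ≤ p ≤ p₀` and
`X = N_H(G(n,p))`, for every `η ∈ [0,1]`,
`(1−ε) Φ_{n,p}^H(η+ε) ≤ − log Pr(X ≤ η E[X]) ≤ (1+ε) Φ_{n,p}^H((1−ε)η)`.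
(The upper bound is rendered by quantifying over all product measures `q` feasible for
the parameter `(1−ε)η`, which is the correct reading of `(1+ε)·min{…}` also when the
feasible set is empty and the minimum is `+∞`.) -/
theorem graphs_lower_tail {α : Type*} [Fintype α] [DecidableEq α] (H : SimpleGraph α)
    (hH : H.edgeSet.Nonempty) (p₀ ε : ℝ) (hp₀ : p₀ < 1) (hε : 0 < ε) :
    ∃ L : ℝ, 0 < L ∧ ∀ (n : ℕ) (p : ℝ),
      L * (n : ℝ) ^ (-(1 / m2 H)) ≤ p → p ≤ p₀ →
      ∀ η : ℝ, 0 ≤ η → η ≤ 1 →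
        (1 - ε) * PhiCopy H n p (η + ε) ≤ - Real.log (PrCopy H n p η) ∧
        ∀ q : Edge n → ℝ, (∀ e, q e ∈ Set.Icc (0 : ℝ) 1) →
          expCopy H n q ≤ (1 - ε) * η * expCopy H n (fun _ => p) →
          - Real.log (PrCopy H n p η) ≤ (1 + ε) * ∑ e, ip p (q e) := by
  obtain ⟨r, hr, E, hinj, hE, hEH, hHE, hm2, hT⟩ := LowerTail.exists_edge_finsets H hH
  have hα : 2 ≤ Fintype.card α := (hE 0).symm.le.trans (Finset.card_le_univ _)
  have hm0 : 0 < m2 H := by linarith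
  set ε' : ℝ := min ε (1 / 2)
  have hε0 : 0 < ε' := lt_min hε (by norm_num)
  have hεε : ε' ≤ ε := min_le_left _ _
  have hεh : ε' ≤ 1 / 2 := min_le_right _ _
  set C : ℝ := 2 ^ r * (Fintype.card α : ℝ) ^ (2 * Fintype.card α)
  have hC0 : 0 < C := by positivity
  set δ : ℝ := min (1 / 2) (ε' ^ 5 / (128 * r ^ 3 * C ^ 2))
  have hδ0 : 0 < δ := lt_min (by norm_num) (by positivity)
  set K : ℝ := max (8 * (32 + 8 / (1 - p₀) ^ 2) / ε' ^ 3) (2 / ε' * Real.log (2 / ε'))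
  set L : ℝ := max (1 / δ) (16 * K / (ε' / (r * C)) ^ 2)
  have hL0 : 0 < L := lt_max_of_lt_left (by positivity)
  refine ⟨L, hL0, fun n p hp hpp η hη hη1 => ?_⟩
  have hp1 : p < 1 := hpp.trans_lt hp₀
  have hpos : 0 < n → 0 < p := fun hn =>
    (mul_pos hL0 (Real.rpow_pos_of_pos (Nat.cast_pos.2 hn) _)).trans_le hp
  have hedge : Edge n → 0 < n := fun e =>
    have h : e.1.Nonempty := Finset.card_pos.1 (by rw [e.2]; norm_num)
    Fin.pos h.choose
  have hip : ∀ q : Edge n → ℝ, (∀ e, q e ∈ Set.Icc (0 : ℝ) 1) → 0 ≤ ∑ e, ip p (q e) := by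
    intro q hq
    exact Finset.sum_nonneg fun e _ => LowerTail.ip_nonneg (hpos (hedge e)) hp1 (hq e)
  rcases lt_or_ge n (Fintype.card α) with hn | hn
  · rw [LowerTail.PrCopy_eq_one hn, Real.log_one, neg_zero]
    refine ⟨?_, fun q hq _ => mul_nonneg (by linarith) (hip q hq)⟩
    have h0 : PhiCopy H n p (η + ε) ≤ 0 := by
      refine (LowerTail.PhiCopy_le hip (q := fun _ => max p 0)
        (fun _ => ⟨le_max_right _ _, max_le hp1.le zero_le_one⟩)
        (by simp only [LowerTail.expCopy_eq_zero hn, mul_zero, le_refl])).trans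
        (le_of_eq (Finset.sum_eq_zero fun e _ => ?_))
      have : 0 < p := hpos (hedge e)
      rw [max_eq_left this.le, LowerTail.ip_self]
    rw [le_antisymm h0 (LowerTail.PhiCopy_nonneg hip), mul_zero]
  have hn2 : 2 ≤ n := hα.trans hn
  have hn0 : (0 : ℝ) < n := Nat.cast_pos.2 (by omega)
  have hp0 : 0 < p := hpos (by omega)
  have hcard : 0 < Fintype.card (α ↪ Fin n) := by
    rw [Fintype.card_embedding_eq, Fintype.card_fin]
    exact Nat.descFactorial_pos.2 hn
  have hinj' : ∀ φ : α ↪ Fin n, Set.InjOn (LowerTail.copyEdge E hE φ) (Finset.range r : Set ℕ) :=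
    LowerTail.copyEdge_injOn hinj
  have hdeg : ∀ i < r, ∀ v, (Fintype.card (Edge n) : ℝ) *
      (Finset.univ.filter fun φ : α ↪ Fin n => LowerTail.copyEdge E hE φ i = v).card ≤
      C * Fintype.card (α ↪ Fin n) :=
    fun i _ v => LowerTail.card_copyEdge_eq_le hn i v
  have hexp := LowerTail.expCopy_const (n := n) hinj hE hEH hHE p
  have hE0 : 0 ≤ expCopy H n fun _ => p := by rw [hexp]; positivity
  have hPr : PrCopy H n p η = ∑ ω, if ∑ φ : α ↪ Fin n,
      LowerTail.ind ((Finset.range r).image (LowerTail.copyEdge E hE φ)) ω ≤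
        η * (Fintype.card (α ↪ Fin n) * p ^ r) then pw (fun _ => p) ω else 0 := by
    simp only [PrCopy, LowerTail.copyCount_eq_sum_ind (hE := hE) hEH hHE, hexp]
  constructor
  · have hx : (n : ℝ) ^ (-(1 / m2 H)) ≤ δ * p := by
      have h1 : 1 ≤ δ * L := by
        have : 1 / δ ≤ L := le_max_left _ _
        rwa [div_le_iff₀ hδ0, mul_comm] at this
      calc _ ≤ δ * L * (n : ℝ) ^ (-(1 / m2 H)) :=
            le_mul_of_one_le_left (Real.rpow_nonneg hn0.le _) h1
        _ = δ * (L * (n : ℝ) ^ (-(1 / m2 H))) := by ring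
        _ ≤ _ := mul_le_mul_of_nonneg_left hp hδ0.le
    have hdense : ∀ T ⊆ Finset.range r, T.Nonempty →
        1 ≤ (δ * p) ^ (T.card - 1) * (n : ℝ) ^ ((T.biUnion E).card - 2) := by
      intro T hTr hTn
      rcases (Nat.succ_le_of_lt (Finset.card_pos.2 hTn)).eq_or_lt with h1 | h1
      · rw [← h1]
        simpa using one_le_pow₀ (n := (T.biUnion E).card - 2)
          (by exact_mod_cast hn2.trans' one_le_two : (1 : ℝ) ≤ n)
      · obtain ⟨h3, h4⟩ := hT T hTr h1
        exact LowerTail.one_le_pow_mul_pow (by omega) hm0 hx h3 h4 (by omega)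
    rw [hPr]
    refine le_of_forall_pos_le_add fun τ hτ => ?_
    have hlog : 0 ≤ -Real.log (∑ ω, if ∑ φ : α ↪ Fin n,
        LowerTail.ind ((Finset.range r).image (LowerTail.copyEdge E hE φ)) ω ≤
        η * (Fintype.card (α ↪ Fin n) * p ^ r) then pw (fun _ => p) ω else 0) :=
      neg_nonneg.2 (Real.log_nonpos (LowerTail.tail_pos hp0 hp1 hr (by positivity)).le
        (LowerTail.tail_le_one hp0 hp1))
    obtain ⟨q, hq, hmean, hq2⟩ := LowerTail.exists_profile_of_tail hp0 hp1 hε0 (by linarith) hC0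
      hr hδ0 (min_le_left _ _) (min_le_right _ _) hcard hinj' hdeg
      (fun i hi => LowerTail.sum_pair_le (mul_pos hδ0 hp0) hn hinj hdense hi) hη
      (le_add_of_nonneg_right hτ.le) (add_pos_of_nonneg_of_pos hlog hτ)
    refine le_trans ?_ hq2
    have hPhi : PhiCopy H n p (η + ε) ≤ ∑ e, ip p (q e) := by
      refine LowerTail.PhiCopy_le hip hq ?_
      rw [LowerTail.expCopy_eq_sum_prod (hE := hE) hinj hEH hHE q]
      refine hmean.trans ?_
      rw [← hexp]
      exact mul_le_mul_of_nonneg_right (by linarith) hE0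
    exact (mul_le_mul_of_nonneg_right (by linarith : 1 - ε ≤ 1 - ε')
      (LowerTail.PhiCopy_nonneg hip)).trans (mul_le_mul_of_nonneg_left hPhi (by linarith))
  · intro q hq hmean
    have hKp : K ≤ p / 4 * (ε' / (r * C)) ^ 2 * Fintype.card (Edge n) := by
      have h1 : L ≤ p * n ^ 2 := by
        have h2 : (1 : ℝ) ≤ (n : ℝ) ^ (-(1 / m2 H)) * (n : ℝ) ^ 2 := by
          rw [← Real.rpow_natCast (n : ℝ), ← Real.rpow_add hn0]
          refine Real.one_le_rpow (by exact_mod_cast hn2.trans' one_le_two) ?_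
          have : 1 / m2 H ≤ 2 := by
            rw [div_le_iff₀ hm0]; linarith
          push_cast
          linarith
        calc L ≤ L * ((n : ℝ) ^ (-(1 / m2 H)) * (n : ℝ) ^ 2) := le_mul_of_one_le_right hL0.le h2
          _ = L * (n : ℝ) ^ (-(1 / m2 H)) * (n : ℝ) ^ 2 := by ring
          _ ≤ _ := mul_le_mul_of_nonneg_right hp (by positivity)
      have h2 : (n : ℝ) ^ 2 ≤ 4 * Fintype.card (Edge n) := by
        exact_mod_cast LowerTail.sq_le_four_mul_card_edge hn2
      have h3 : 16 * K / (ε' / (r * C)) ^ 2 ≤ p * (4 * Fintype.card (Edge n)) :=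
        (le_max_right _ _).trans (h1.trans (mul_le_mul_of_nonneg_left h2 hp0.le))
      rw [div_le_iff₀ (by positivity)] at h3
      linarith
    have hη' : 0 ≤ η * expCopy H n fun _ => p := mul_nonneg hη hE0
    rw [hPr]
    refine (LowerTail.neg_log_tail_le (q := q) hp0 hpp hp₀ hε0 (by linarith) hC0 hr hcard hinj' hdeg
      hη hη1 hq ?_ ((le_max_left _ _).trans hKp) ((le_max_right _ _).trans hKp)).trans
      (mul_le_mul_of_nonneg_right (by linarith) (hip q hq))
    rw [← LowerTail.expCopy_eq_sum_prod (hE := hE) hinj hEH hHE q, ← hexp]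
    refine hmean.trans ?_
    rw [mul_assoc, mul_assoc]
    exact mul_le_mul_of_nonneg_right (by linarith) hη'

end
end
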